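/- Fix α > 1. For every ε > 0 there is a constant K = K(α,ε) > 0 such that for all R > 0, the number of B-reduced quadratic irrationals ω with ω ≥ α and ϱ_B(ω) ≤ R satisfies |#{ω ∈ ℛ_B : ω ≥ α, ϱ_B(ω) ≤ R} − (e^R/(2ζ(2)))·log(α/(α−1))| ≤ K·e^{(3/4+ε)R}. (Here ζ(2) = π²/6 and log(α/(α−1)) = ∫_α^∞ du/(u(u−1)), the μ_B-measure of [α,∞).) -/

import Mathlib

noncomputable section

/-- `ω'` is the conjugate of the quadratic irrational `ω`: both are roots of the
minimal integer polynomial `A X^2 + B X + C` of `ω` (with `A > 0`, `gcd(A,B,C) = 1`),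
and `ω' ≠ ω`. -/
def IsConjPair (ω ω' : ℝ) : Prop :=
  Irrational ω ∧ ∃ A B C : ℤ, 0 < A ∧ Int.gcd (Int.gcd A B : ℤ) C = 1 ∧
    (A : ℝ) * ω ^ 2 + B * ω + C = 0 ∧ (A : ℝ) * ω' ^ 2 + B * ω' + C = 0 ∧ ω' ≠ ω

/-- The quadratic irrational `ω` has discriminant `Δ = B^2 - 4AC`, where
`A X^2 + B X + C` is its minimal integer polynomial (`A > 0`, `gcd(A,B,C) = 1`). -/
def HasDisc (ω : ℝ) (Δ : ℤ) : Prop :=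
  Irrational ω ∧ ∃ A B C : ℤ, 0 < A ∧ Int.gcd (Int.gcd A B : ℤ) C = 1 ∧
    (A : ℝ) * ω ^ 2 + B * ω + C = 0 ∧ Δ = B ^ 2 - 4 * A * C

/-- The matrix `M(a,e) = (a, e; 1, 0)`. -/
def Mmat (a e : ℤ) : Matrix (Fin 2) (Fin 2) ℤ := !![a, e; 1, 0]

/-- The spectral radius of a 2x2 integer matrix with trace `t`, namely
`(t + sqrt (t^2 - 4)) / 2`. -/
def specRad (σ : Matrix (Fin 2) (Fin 2) ℤ) : ℝ :=
  ((σ.trace : ℝ) + Real.sqrt ((σ.trace : ℝ) ^ 2 - 4)) / 2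

/-- The BCF Gauss shift `T_B(u) = 1 / (1 + ⎣u⎦ - u)`. -/
def TB (u : ℝ) : ℝ := 1 / ((1 + ⌊u⌋ : ℤ) - u)

/-- The least period of `ω` under `T_B` (junk value `0` if `ω` is not periodic). -/
def perB (ω : ℝ) : ℕ := sInf {n : ℕ | 0 < n ∧ TB^[n] ω = ω}

/-- `Ω_B(ω) = M(a₁,-1) ⋯ M(aₙ,-1)`, where `n = per(ω)` and `aᵢ = 1 + ⎣T_B^{i-1}(ω)⎦`. -/
def OmegaB (ω : ℝ) : Matrix (Fin 2) (Fin 2) ℤ :=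
  ((List.range (perB ω)).map (fun i => Mmat (1 + ⌊TB^[i] ω⌋) (-1))).prod

/-- The length `ϱ_B(ω) = 2 log 𝔯(Ω_B(ω))`. -/
def rhoB (ω : ℝ) : ℝ := 2 * Real.log (specRad (OmegaB ω))


set_option linter.all false

open PowerSeries in
lemma exists_quad_root {k : Type*} [Field k] (a : k) (ha : a ≠ 0) (d e : PowerSeries k)
    (hd : constantCoeff d = 1) (he : constantCoeff e = 0) :
    ∃ z : PowerSeries k, constantCoeff z ≠ 0 ∧ C a * z ^ 2 - d * z + e = 0 := by
  obtain ⟨d', hd'⟩ : ∃ d', d * d' = 1 := ⟨d⁻¹, PowerSeries.mul_inv_cancel d (by simp [hd])⟩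
  set u : PowerSeries k := C a * e * d' ^ 2 with hu
  have hus : HasSubst u := HasSubst.of_constantCoeff_zero' (by simp [hu, he])
  set c0 : PowerSeries k := (catalanSeries.map (Nat.castRingHom k)) with hc0
  have hc0' : c0 ^ 2 * X + 1 = c0 := by
    have := congrArg (PowerSeries.map (Nat.castRingHom k)) catalanSeries_sq_mul_X_add_one
    simpa [hc0] using this
  set c : PowerSeries k := substAlgHom (R := k) hus c0 with hc
  have hcc : c ^ 2 * u + 1 = c := by
    have := congrArg (substAlgHom (R := k) hus) hc0'
    rw [map_add, map_mul, map_pow, map_one, substAlgHom_X] at this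
    exact this
  have hCa : C a * C a⁻¹ = (1 : PowerSeries k) := by
    rw [← map_mul, mul_inv_cancel₀ ha, map_one]
  refine ⟨C a⁻¹ * d - e * d' * c, by simp [hd, he, ha], ?_⟩
  have h1 : C a * (C a⁻¹ * d - e * d' * c) ^ 2 - d * (C a⁻¹ * d - e * d' * c) + e
    = e * (c ^ 2 * u + 1 - c) := by
    have : c ^ 2 * u = c ^ 2 * (C a * e * d' ^ 2) := rfl
    rw [this]
    linear_combination (C a⁻¹ * d ^2 - 2 * d * e * d' * c) * hCa - e * c * hd'
  rw [h1, hcc]; ring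

lemma exists_generic {k : Type*} [Field k] (p : ℕ) (hp : 2 ≤ p) (a b : k) (ha : a ≠ 0) :
    ∃ x y : LaurentSeries k, x ≠ 0 ∧ y ≠ 0 ∧ y ^ p - y = HahnSeries.C a * x + HahnSeries.C b * x⁻¹ ∧
      x.order = -(p : ℤ) ∧ y.order = -1 := by
  obtain ⟨z, hz0, hz⟩ := exists_quad_root a ha (1 - PowerSeries.X ^ (p - 1))
    (PowerSeries.C b * PowerSeries.X ^ (2 * p)) (by simp [zero_pow (show p - 1 ≠ 0 by omega)])
    (by simp [zero_pow (show 2 * p ≠ 0 by omega)])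
  set t : LaurentSeries k := HahnSeries.single 1 1 with ht
  set s : LaurentSeries k := HahnSeries.single (-1) 1 with hs
  have hts : t * s = 1 := by simp [ht, hs, HahnSeries.single_mul_single]
  have hsn : ∀ n : ℕ, s ^ n = HahnSeries.single (-(n : ℤ)) 1 := by
    intro n; rw [hs, HahnSeries.single_pow]; simp
  set Z : LaurentSeries k := HahnSeries.ofPowerSeries ℤ k z with hZ
  have hZe : HahnSeries.C a * Z ^ 2 - (1 - t ^ (p-1)) * Z + HahnSeries.C b * t ^ (2 * p) = 0 := by
    have := congrArg (HahnSeries.ofPowerSeries ℤ k) hz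
    simp only [map_add, map_sub, map_mul, map_pow, map_one, map_zero, HahnSeries.ofPowerSeries_C,
      HahnSeries.ofPowerSeries_X] at this
    exact this
  have hZc : Z.coeff 0 ≠ 0 := by
    have : Z.coeff ((0:ℕ):ℤ) = PowerSeries.coeff 0 z := by
      rw [hZ]; exact HahnSeries.ofPowerSeries_apply_coeff z 0
    rw [show (0:ℤ) = ((0:ℕ):ℤ) from rfl, this]; simpa using hz0
  have hZ0 : Z ≠ 0 := by intro h; simp [h] at hZc
  have hZo : Z.order = 0 := by
    apply le_antisymm (HahnSeries.order_le_of_coeff_ne_zero hZc)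
    by_contra h
    push Not at h
    have h2 : Z.coeff Z.order ≠ 0 := HahnSeries.coeff_order_eq_zero.not.mpr hZ0
    apply h2
    rw [hZ, HahnSeries.ofPowerSeries_apply, HahnSeries.embDomain_notin_range]
    rintro ⟨n, hn⟩
    have : (n : ℤ) = Z.order := hn
    omega
  have hs0 : s ≠ 0 := by intro h; rw [h] at hts; simp at hts
  have hx0 : s ^ p * Z ≠ 0 := mul_ne_zero (pow_ne_zero _ hs0) hZ0
  have hso : s.order = -1 := HahnSeries.order_single one_ne_zero
  refine ⟨s ^ p * Z, s, hx0, hs0, ?_, ?_, hso⟩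
  · have h1 : (s ^ p - s) * (s ^ p * Z) = HahnSeries.C a * (s ^ p * Z) * (s ^ p * Z) + HahnSeries.C b := by
      obtain ⟨m, rfl⟩ : ∃ m, p = m + 1 := ⟨p - 1, by omega⟩
      have e1 : t ^ m * s ^ m = 1 := by rw [← mul_pow, hts, one_pow]
      have e2 : t ^ (2 * (m+1)) * s ^ (2 * (m+1)) = 1 := by rw [← mul_pow, hts, one_pow]
      simp only [Nat.add_sub_cancel] at hZe
      have e3 : s ^ (2 * (m+1)) = s ^ (m+1) * s ^ (m+1) := by ring
      rw [e3] at e2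
      linear_combination (-s ^ (m+1) * s ^ (m+1)) * hZe + HahnSeries.C b * e2 + (s^(m+2)* Z) * e1
    field_simp
    field_simp at h1
    linear_combination h1
  · rw [HahnSeries.order_mul (pow_ne_zero _ hs0) hZ0, HahnSeries.order_pow, hso, hZo]; simp

/-- elements of a Laurent series field with distinct orders are independent -/
lemma indep_of_order {k : Type*} [Field k] {ι : Type*} [Fintype ι] (z : ι → LaurentSeries k)
    (hz : ∀ i, z i ≠ 0) (hinj : Function.Injective fun i => (z i).order) (c : ι → k) (hc : c ≠ 0) :
    ∑ i, c i • z i ≠ 0 := by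
  classical
  obtain ⟨i1, hi1⟩ : ∃ i, c i ≠ 0 := by
    by_contra h; push Not at h; exact hc (funext h)
  obtain ⟨i0, hi0, hmin⟩ := Finset.exists_min_image (Finset.univ.filter fun i => c i ≠ 0)
    (fun i => (z i).order) ⟨i1, by simp [hi1]⟩
  simp at hi0 hmin
  intro h
  have := congrArg (fun f => HahnSeries.coeff f (z i0).order) h
  simp only [HahnSeries.coeff_sum, HahnSeries.coeff_smul, HahnSeries.coeff_zero] at this
  rw [Finset.sum_eq_single i0] at this
  · exact (mul_ne_zero hi0 (HahnSeries.coeff_order_eq_zero.not.mpr (hz i0))) this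
  · intro j _ hj
    by_cases hcj : c j = 0
    · simp [hcj]
    · rw [HahnSeries.coeff_eq_zero_of_lt_order, smul_zero]
      exact lt_of_le_of_ne (hmin j hcj) (fun h => hj (hinj h.symm))
  · simp

section Wspan
variable {k Λ : Type*} [Field k] [CommRing Λ] [Algebra k Λ] (X : Λˣ) (Y : Λ)

/-- span of monomials `X^e Y^j`, `-A ≤ e ≤ B`, `j ≤ d` -/
def Wsp (k : Type*) {Λ : Type*} [Field k] [CommRing Λ] [Algebra k Λ] (X : Λˣ) (Y : Λ)
    (A B : ℤ) (d : ℕ) : Submodule k Λ :=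
  Submodule.span k {z | ∃ e : ℤ, ∃ j : ℕ, -A ≤ e ∧ e ≤ B ∧ j ≤ d ∧ z = ((X ^ e : Λˣ) : Λ) * Y ^ j}

lemma Wsp_mem {A B : ℤ} {d : ℕ} {e : ℤ} {j : ℕ} (h1 : -A ≤ e) (h2 : e ≤ B) (h3 : j ≤ d) :
    ((X ^ e : Λˣ) : Λ) * Y ^ j ∈ Wsp k X Y A B d :=
  Submodule.subset_span ⟨e, j, h1, h2, h3, rfl⟩

lemma Wsp_mono {A B A' B' : ℤ} {d d' : ℕ} (h1 : A ≤ A') (h2 : B ≤ B') (h3 : d ≤ d') :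
    Wsp k X Y A B d ≤ Wsp k X Y A' B' d' := by
  apply Submodule.span_mono
  rintro z ⟨e, j, a1, a2, a3, rfl⟩
  exact ⟨e, j, by omega, by omega, by omega, rfl⟩

lemma Wsp_mul {A B A' B' : ℤ} {d d' : ℕ} {u v : Λ} (hu : u ∈ Wsp k X Y A B d)
    (hv : v ∈ Wsp k X Y A' B' d') : u * v ∈ Wsp k X Y (A + A') (B + B') (d + d') := by
  have := Submodule.mul_mem_mul hu hv
  rw [Wsp, Wsp, Submodule.span_mul_span] at this
  refine Submodule.span_mono ?_ this
  rintro z ⟨_, ⟨e, j, a1, a2, a3, rfl⟩, _, ⟨e', j', b1, b2, b3, rfl⟩, rfl⟩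
  refine ⟨e + e', j + j', by omega, by omega, by omega, ?_⟩
  rw [zpow_add, pow_add, Units.val_mul]; dsimp only; ring

lemma Wsp_pow {A B : ℤ} {d : ℕ} {u : Λ} (hu : u ∈ Wsp k X Y A B d) (n : ℕ) :
    u ^ n ∈ Wsp k X Y (n * A) (n * B) (n * d) := by
  induction n with
  | zero =>
    have := Wsp_mem (k := k) X Y (A := 0) (B := 0) (d := 0) (e := 0) (j := 0) (by simp) (by simp) (by simp)
    simpa using this
  | succ n ih =>
    have := Wsp_mul X Y ih hu
    rw [pow_succ]
    convert this using 1
    congr 1 <;> push_cast <;> ring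

lemma Wsp_reduce (p : ℕ) (hp : 2 ≤ p) (a b : k)
    (hY : Y ^ p = Y + a • (X : Λ) + b • ((X⁻¹ : Λˣ) : Λ)) {A B : ℤ} {u : Λ}
    (hu : u ∈ Wsp k X Y A B (2 * p - 2)) : u ∈ Wsp k X Y (A + 1) (B + 1) (p - 1) := by
  revert u
  change Wsp k X Y A B (2 * p - 2) ≤ _
  apply Submodule.span_le.mpr
  rintro z ⟨e, j, a1, a2, a3, rfl⟩
  by_cases hj : j < p
  · exact Wsp_mem X Y (by omega) (by omega) (by omega)
  · obtain ⟨r, rfl⟩ : ∃ r, j = p + r := ⟨j - p, by omega⟩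
    have : ((X ^ e : Λˣ) : Λ) * Y ^ (p + r) = ((X ^ e : Λˣ) : Λ) * Y ^ (r + 1)
      + a • (((X ^ (e + 1) : Λˣ) : Λ) * Y ^ r) + b • (((X ^ (e - 1) : Λˣ) : Λ) * Y ^ r) := by
      rw [pow_add, hY, zpow_add, zpow_sub, Units.val_mul, Units.val_mul]
      simp only [Algebra.smul_def, zpow_one]
      ring
    rw [this]
    exact add_mem (add_mem (Wsp_mem X Y (by omega) (by omega) (by omega))
      (Submodule.smul_mem _ _ (Wsp_mem X Y (by omega) (by omega) (by omega))))
      (Submodule.smul_mem _ _ (Wsp_mem X Y (by omega) (by omega) (by omega)))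

lemma Wsp_mem_iff {A B : ℤ} {d : ℕ} {u : Λ} (hu : u ∈ Wsp k X Y A B d) :
    ∃ g : (Finset.Icc (-A) B) × Fin (d + 1) → k,
      u = ∑ ι, g ι • (((X ^ (ι.1 : ℤ) : Λˣ) : Λ) * Y ^ (ι.2 : ℕ)) := by
  have : Wsp k X Y A B d = Submodule.span k (Set.range
    fun ι : (Finset.Icc (-A) B) × Fin (d + 1) => ((X ^ (ι.1 : ℤ) : Λˣ) : Λ) * Y ^ (ι.2 : ℕ)) := by
    apply le_antisymm
    · apply Submodule.span_mono
      rintro z ⟨e, j, a1, a2, a3, rfl⟩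
      exact ⟨(⟨e, by simp [a1, a2]⟩, ⟨j, by omega⟩), rfl⟩
    · apply Submodule.span_mono
      rintro z ⟨⟨⟨e, he⟩, ⟨j, hj⟩⟩, rfl⟩
      simp at he
      exact ⟨e, j, he.1, he.2, by omega, rfl⟩
  rw [this, Submodule.mem_span_range_iff_exists_fun] at hu
  obtain ⟨g, hg⟩ := hu
  exact ⟨g, hg.symm⟩

lemma Wsp_finrank {A B : ℤ} {d : ℕ} :
    Module.Finite k (Wsp k X Y A B d) ∧
    Module.finrank k (Wsp k X Y A B d) ≤ (B + 1 + A).toNat * (d + 1) := by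
  classical
  have : Wsp k X Y A B d = Submodule.span k (((Finset.Icc (-A) B ×ˢ Finset.range (d + 1)).image
    fun ι : ℤ × ℕ => ((X ^ (ι.1 : ℤ) : Λˣ) : Λ) * Y ^ (ι.2 : ℕ) : Finset Λ) : Set Λ) := by
    rw [Wsp]; congr 1; ext z
    simp only [Set.mem_setOf_eq, Finset.coe_image, Set.mem_image, Finset.mem_coe, Finset.mem_product,
      Finset.mem_Icc, Finset.mem_range, Prod.exists]
    constructor
    · rintro ⟨e, j, a1, a2, a3, rfl⟩
      exact ⟨e, j, ⟨⟨a1, a2⟩, by omega⟩, rfl⟩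
    · rintro ⟨e, j, ⟨⟨a1, a2⟩, a3⟩, rfl⟩
      exact ⟨e, j, a1, a2, by omega, rfl⟩
  rw [this]
  refine ⟨Module.Finite.span_finset k _, ?_⟩
  refine (finrank_span_finset_le_card _).trans (Finset.card_image_le.trans ?_)
  simp [Int.card_Icc]

end Wspan

lemma Wsp_term {k Λ : Type*} [Field k] [CommRing Λ] [Algebra k Λ] (X : Λˣ) (Y : Λ)
    (p m w : ℕ) (hp : 2 ≤ p) (hm : 1 ≤ m) (hw : w = p ^ (m - 1)) (a b : k)
    (hY : Y ^ p = Y + a • (X : Λ) + b • ((X⁻¹ : Λˣ) : Λ))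
    (hYQ : Y ^ (p * w) = Y + ∑ r ∈ Finset.range m,
      (a • ((X ^ (p ^ r : ℤ) : Λˣ) : Λ) + b • ((X ^ (-(p ^ r : ℤ)) : Λˣ) : Λ)))
    (γ : k) (s i j : ℕ) (hi : i < p) (hj : j < p) :
    (X : Λ) ^ s * (Y ^ (p * w)) ^ i * (Y + algebraMap k Λ γ) ^ j ∈
      Wsp k X Y (p * w + 1) (s + p * w + 1) (p - 1) := by
  have hX : (X : Λ) ^ s ∈ Wsp k X Y 0 s 0 := by
    have := Wsp_mem (k := k) X Y (A := 0) (B := s) (d := 0) (e := s) (j := 0) (by simp) (by simp) (by simp)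
    simpa using this
  have h1 : Y + algebraMap k Λ γ ∈ Wsp k X Y 0 0 1 := by
    have e1 := Wsp_mem (k := k) X Y (A := 0) (B := 0) (d := 1) (e := 0) (j := 0) (by simp) (by simp) (by simp)
    have e2 := Wsp_mem (k := k) X Y (A := 0) (B := 0) (d := 1) (e := 0) (j := 1) (by simp) (by simp) (by simp)
    have := add_mem e2 (Submodule.smul_mem _ γ e1)
    simpa [Algebra.smul_def] using this
  have h2 : Y ^ (p * w) ∈ Wsp k X Y w w 1 := by
    rw [hYQ]
    have hw0 : 0 < w := by rw [hw]; positivity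
    have e2 := Wsp_mem (k := k) X Y (A := w) (B := w) (d := 1) (e := 0) (j := 1) (by simp) (by simp) (by simp)
    refine add_mem (by simpa using e2) (Submodule.sum_mem _ ?_)
    intro r hr
    have hr' : p ^ r ≤ w := by
      rw [hw]; exact Nat.pow_le_pow_right (by omega) (by simp at hr; omega)
    have hr2 : (p ^ r : ℤ) ≤ w := by exact_mod_cast hr'
    have hr3 : (0 : ℤ) ≤ p ^ r := by positivity
    have e3 := Wsp_mem (k := k) X Y (A := w) (B := w) (d := 1) (e := p ^ r) (j := 0) (by omega) (by omega) (by simp)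
    have e4 := Wsp_mem (k := k) X Y (A := w) (B := w) (d := 1) (e := -(p ^ r)) (j := 0) (by omega) (by omega) (by simp)
    rw [pow_zero, mul_one] at e3 e4
    exact add_mem (Submodule.smul_mem _ _ e3) (Submodule.smul_mem _ _ e4)
  have h3 := Wsp_mul X Y (Wsp_mul X Y hX (Wsp_pow X Y h2 i)) (Wsp_pow X Y h1 j)
  have hpw : (i : ℤ) * w ≤ p * w := by
    have : (i : ℤ) ≤ p := by exact_mod_cast hi.le
    gcongr
  apply Wsp_reduce X Y p hp a b hY
  exact Wsp_mono X Y (by linarith) (by linarith) (by omega) h3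

lemma stepanov_core {k Λ : Type*} [Field k] [CommRing Λ] [Algebra k Λ] (X : Λˣ) (Y : Λ)
    (p m w : ℕ) (hp : 2 ≤ p) (hm : 2 ≤ m) (hw : w = p ^ (m - 1)) (a b : k)
    (hY : Y ^ p = Y + a • (X : Λ) + b • ((X⁻¹ : Λˣ) : Λ))
    (hYQ : Y ^ (p * w) = Y + ∑ r ∈ Finset.range m,
      (a • ((X ^ (p ^ r : ℤ) : Λˣ) : Λ) + b • ((X ^ (-(p ^ r : ℤ)) : Λˣ) : Λ)))
    (γ : k) :
    ∃ c : Fin w × Fin p × Fin (w + 4) × Fin p → k, c ≠ 0 ∧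
      ∑ ι, c ι • ((X : Λ) ^ ((ι.1 : ℕ) * (p * w) + ι.2.2.1) * (Y ^ (p * w)) ^ (ι.2.1 : ℕ)
        * (Y + algebraMap k Λ γ) ^ (ι.2.2.2 : ℕ)) = 0 ∧
      ∑ ι, c ι • ((X : Λ) ^ ((ι.1 : ℕ) + (p * w) * ι.2.2.1) * Y ^ (ι.2.1 : ℕ)
        * (Y ^ (p * w)) ^ (ι.2.2.2 : ℕ)) ∈ Wsp k X Y (p * w + 1) (w + p * w * (w + 3) + p * w) (p - 1) := by
  classical
  have hw2 : 2 ≤ w := by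
    rw [hw]; calc 2 ≤ p := hp
      _ = p ^ 1 := (pow_one p).symm
      _ ≤ p ^ (m - 1) := Nat.pow_le_pow_right (by omega) (by omega)
  let term : Fin w × Fin p × Fin (w + 4) × Fin p → Λ := fun ι =>
    ((X : Λ) ^ ((ι.1 : ℕ) * (p * w) + ι.2.2.1) * (Y ^ (p * w)) ^ (ι.2.1 : ℕ)
        * (Y + algebraMap k Λ γ) ^ (ι.2.2.2 : ℕ))
  have hterm : ∀ ι, term ι ∈ Wsp k X Y (p * w + 1) ((w - 1 : ℤ) * (p * w) + (w + 3) + p * w + 1) (p - 1) := by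
    rintro ⟨a1, b1, i1, j1⟩
    have := Wsp_term X Y p m w hp (by omega) hw a b hY hYQ γ ((a1 : ℕ) * (p * w) + i1) b1 j1 b1.2 j1.2
    refine Wsp_mono X Y le_rfl ?_ le_rfl this
    have h1 : (a1 : ℤ) ≤ w - 1 := by have := a1.2; omega
    have h2 : (i1 : ℤ) ≤ w + 3 := by have := i1.2; omega
    push_cast
    have : (a1 : ℤ) * (p * w) ≤ (w - 1 : ℤ) * (p * w) := by gcongr
    linarith
  set W := Wsp k X Y (p * w + 1) ((w - 1 : ℤ) * (p * w) + (w + 3) + p * w + 1) (p - 1) with hW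
  obtain ⟨hfin, hrank⟩ := Wsp_finrank (k := k) X Y (A := p * w + 1) (B := (w - 1 : ℤ) * (p * w) + (w + 3) + p * w + 1) (d := p - 1)
  rw [← hW] at hfin hrank
  let Φ : (Fin w × Fin p × Fin (w + 4) × Fin p → k) →ₗ[k] W :=
    Fintype.linearCombination k (fun ι => (⟨term ι, hterm ι⟩ : W))
  have hlt : Module.finrank k W < Module.finrank k (Fin w × Fin p × Fin (w + 4) × Fin p → k) := by
    refine lt_of_le_of_lt hrank ?_
    rw [Module.finrank_fintype_fun_eq_card]
    simp only [Fintype.card_prod, Fintype.card_fin]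
    rw [show p - 1 + 1 = p by omega]
    have : ((w - 1 : ℤ) * (p * w) + (w + 3) + p * w + 1 + 1 + (p * w + 1)).toNat = w * (p * w) + w + 6 + p * w := by
      have : ((w - 1 : ℤ) * (p * w) + (w + 3) + p * w + 1 + 1 + (p * w + 1)) = ((w * (p * w) + w + 6 + p * w : ℕ) : ℤ) := by
        push_cast; ring
      rw [this]; rfl
    rw [this]
    have : w * (p * ((w + 4) * p)) = (w * p * (w + 4)) * p := by ring
    rw [this]
    apply Nat.mul_lt_mul_of_pos_right _ (by omega)
    nlinarith
  have hker : LinearMap.ker Φ ≠ ⊥ := by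
    intro h
    have := LinearMap.finrank_le_finrank_of_injective (LinearMap.ker_eq_bot.mp h)
    omega
  obtain ⟨c, hc, hc0⟩ := Submodule.exists_mem_ne_zero_of_ne_bot hker
  refine ⟨c, hc0, ?_, ?_⟩
  · have : ((Φ c : W) : Λ) = 0 := by rw [LinearMap.mem_ker.mp hc]; rfl
    rw [Fintype.linearCombination_apply] at this
    simpa [term] using this
  · apply Submodule.sum_mem
    rintro ⟨a1, b1, i1, j1⟩ _
    apply Submodule.smul_mem
    have := Wsp_term X Y p m w hp (by omega) hw a b hY hYQ 0 ((a1 : ℕ) + (p * w) * i1) j1 b1 j1.2 b1.2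
    rw [map_zero, add_zero, mul_right_comm ((X : Λ) ^ _)] at this
    refine Wsp_mono X Y le_rfl ?_ le_rfl this
    have h1 : (a1 : ℤ) ≤ w - 1 := by have := a1.2; omega
    have h2 : (i1 : ℤ) ≤ w + 3 := by have := i1.2; omega
    push_cast
    have : (p * w : ℤ) * i1 ≤ (p * w) * (w + 3) := by gcongr
    linarith

lemma frob_tower {p : ℕ} [Fact p.Prime] {Λ : Type*} [CommRing Λ] [Nontrivial Λ] [Algebra (ZMod p) Λ]
    (X : Λˣ) (Y : Λ) (a b : ZMod p)
    (hY : Y ^ p = Y + a • (X : Λ) + b • ((X⁻¹ : Λˣ) : Λ)) (m : ℕ) :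
    Y ^ (p ^ m) = Y + ∑ r ∈ Finset.range m,
      (a • ((X ^ (p ^ r : ℤ) : Λˣ) : Λ) + b • ((X ^ (-(p ^ r : ℤ)) : Λˣ) : Λ)) := by
  haveI : CharP Λ p := charP_of_injective_algebraMap (algebraMap (ZMod p) Λ).injective p
  induction m with
  | zero => simp
  | succ m ih =>
    rw [pow_succ, pow_mul, ih]
    have h1 : ∀ z : Λ, z ^ p = frobenius Λ p z := fun z => rfl
    rw [h1, map_add, map_sum, Finset.sum_range_succ', ← h1, hY]
    have h2 : ∀ (c : ZMod p) (z : Λ), frobenius Λ p (c • z) = c • z ^ p := by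
      intro c z
      rw [← h1, Algebra.smul_def, mul_pow, ← map_pow, ZMod.pow_card, ← Algebra.smul_def]
    have h3 : ∀ r, frobenius Λ p (a • ((X ^ (p ^ r : ℤ) : Λˣ) : Λ) + b • ((X ^ (-(p ^ r : ℤ)) : Λˣ) : Λ))
      = (a • ((X ^ (p ^ (r+1) : ℤ) : Λˣ) : Λ) + b • ((X ^ (-(p ^ (r+1) : ℤ)) : Λˣ) : Λ)) := by
      intro r
      rw [map_add, h2, h2, ← Units.val_pow_eq_pow_val, ← Units.val_pow_eq_pow_val, ← zpow_natCast,
        ← zpow_mul, ← zpow_natCast, ← zpow_mul, pow_succ, neg_mul]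
    rw [Finset.sum_congr rfl (fun r _ => h3 r)]
    simp
    ring

lemma pow_pn_add_const {p : ℕ} [Fact p.Prime] {F : Type*} [Field F] [Algebra (ZMod p) F] 
    (y z : F) (hy : y ^ p - y = z) (n : ℕ) :
    y ^ (p ^ n) = y + ∑ r ∈ Finset.range n, z ^ (p ^ r) := by
  haveI : CharP F p := charP_of_injective_algebraMap (algebraMap (ZMod p) F).injective p
  induction n with
  | zero => simp
  | succ n ih =>
    rw [pow_succ, pow_mul, ih]
    have h1 : ∀ z : F, z ^ p = frobenius F p z := fun z => rfl
    rw [h1, map_add, map_sum, Finset.sum_range_succ', ← h1]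
    simp only [← h1, ← pow_mul, ← pow_succ]
    rw [← hy]; simp; ring


lemma stepanov_gen {k : Type*} [Field k] (p w : ℕ) (hp : 2 ≤ p) (xg yg : LaurentSeries k) (hxg0 : xg ≠ 0)
    (hyg0 : yg ≠ 0) (hxo : xg.order = -(p : ℤ)) (hyo : yg.order = -1)
    (g : Fin w × Fin p × Fin (w + 4) × Fin p → k) (hg0 : g ≠ 0) :
    ∑ ι, g ι • (xg ^ ((ι.1 : ℕ) + (p * w) * ι.2.2.1) * yg ^ (ι.2.1 : ℕ)
        * (yg ^ (p * w)) ^ (ι.2.2.2 : ℕ)) ≠ 0 := by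
  apply indep_of_order _ _ _ _ hg0
  · intro i
    exact mul_ne_zero (mul_ne_zero (pow_ne_zero _ hxg0) (pow_ne_zero _ hyg0))
      (pow_ne_zero _ (pow_ne_zero _ hyg0))
  · rintro ⟨a1, b1, i1, j1⟩ ⟨a2, b2, i2, j2⟩ h
    simp only at h
    rw [HahnSeries.order_mul (mul_ne_zero (pow_ne_zero _ hxg0) (pow_ne_zero _ hyg0))
      (pow_ne_zero _ (pow_ne_zero _ hyg0)), HahnSeries.order_mul (pow_ne_zero _ hxg0) (pow_ne_zero _ hyg0),
      HahnSeries.order_mul (mul_ne_zero (pow_ne_zero _ hxg0) (pow_ne_zero _ hyg0))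
      (pow_ne_zero _ (pow_ne_zero _ hyg0)), HahnSeries.order_mul (pow_ne_zero _ hxg0) (pow_ne_zero _ hyg0)] at h
    simp only [HahnSeries.order_pow, hxo, hyo] at h
    have h' : (p * a1 + b1 : ℕ) + (p * w) * (p * i1 + j1) = (p * a2 + b2 : ℕ) + (p * w) * (p * i2 + j2) := by
      zify
      simp only [nsmul_eq_mul] at h
      push_cast at h
      linarith
    have hb : ∀ (u : Fin w) (v : Fin p), p * (u : ℕ) + v < p * w := by
      intro u v
      have := u.2; have := v.2
      calc p * (u : ℕ) + v < p * u + p := by omega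
        _ = p * (u + 1) := by ring
        _ ≤ p * w := Nat.mul_le_mul_left _ (by omega)
    have hdig : ∀ (B u u' v v' : ℕ), u < B → u' < B → u + B * v = u' + B * v' → u = u' ∧ v = v' := by
      intro B u u' v v' hu hu' h
      have h1 := congrArg (· % B) h
      simp [Nat.mod_eq_of_lt hu, Nat.mod_eq_of_lt hu'] at h1
      subst h1
      refine ⟨rfl, ?_⟩
      have : B * v = B * v' := by omega
      exact Nat.eq_of_mul_eq_mul_left (by omega) this
    obtain ⟨e1, e2⟩ := hdig _ _ _ _ _ (hb a1 b1) (hb a2 b2) h'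
    obtain ⟨e3, e4⟩ := hdig p b1 b2 a1 a2 b1.2 b2.2 (by linarith)
    obtain ⟨e5, e6⟩ := hdig p j1 j2 i1 i2 j1.2 j2.2 (by linarith)
    simp only [Prod.mk.injEq]
    exact ⟨Fin.ext e4, Fin.ext e3, Fin.ext e6, Fin.ext e5⟩

lemma stepanov_van {p : ℕ} [Fact p.Prime] {Om : Type*} [Field Om] [Algebra (ZMod p) Om]
    (m w : ℕ) (hpw : p * w = p ^ m) (x y : Om) (c : ZMod p)
    (hx : x ^ (p ^ (2 * m)) = x) (hy : y ^ (p ^ (2 * m)) = y + algebraMap _ _ c)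
    (g : Fin w × Fin p × Fin (w + 4) × Fin p → ZMod p)
    (h2 : ∑ ι, g ι • (x ^ ((ι.1 : ℕ) * (p * w) + ι.2.2.1) * (y ^ (p * w)) ^ (ι.2.1 : ℕ)
        * (y + algebraMap _ _ c) ^ (ι.2.2.2 : ℕ)) = 0) :
    ∑ ι, g ι • (x ^ ((ι.1 : ℕ) + (p * w) * ι.2.2.1) * y ^ (ι.2.1 : ℕ)
        * (y ^ (p * w)) ^ (ι.2.2.2 : ℕ)) = 0 := by
  haveI : CharP Om p := charP_of_injective_algebraMap (algebraMap (ZMod p) Om).injective p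
  have hp0 : 0 < p := (Fact.out : p.Prime).pos
  have hQQ : (p * w) * (p * w) = p ^ (2 * m) := by rw [hpw, ← pow_add]; congr 1; omega
  apply pow_eq_zero_iff (n := p ^ m) (by positivity) |>.mp
  rw [sum_pow_char_pow, ← h2]
  apply Finset.sum_congr rfl
  intro ι _
  rw [Algebra.smul_def, mul_pow, ← map_pow, ZMod.pow_card_pow, ← Algebra.smul_def]
  congr 1
  rw [← hy, ← hpw, mul_pow, mul_pow]
  congr 1
  · congr 1
    · rw [← pow_mul, add_mul, pow_add, pow_add]
      congr 1
      rw [mul_right_comm, hQQ, pow_mul, hx]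
    · rw [← pow_mul, ← pow_mul, mul_comm]
  · rw [← pow_mul, ← pow_mul, ← pow_mul, ← hQQ]; congr 1; ring

lemma stepanov_ypoly {p : ℕ} [Fact p.Prime] {Om : Type*} [Field Om] [Algebra (ZMod p) Om]
    [IsAlgClosed Om] (d : ℕ) (hd : d + 1 = p) (z : Om) (cf : Fin (d + 1) → Om)
    (h : ∀ y : Om, y ^ p - y = z → ∑ j, cf j * y ^ (j : ℕ) = 0) (j : Fin (d + 1)) : cf j = 0 := by
  haveI : CharP Om p := charP_of_injective_algebraMap (algebraMap (ZMod p) Om).injective p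
  have hp : 2 ≤ p := (Fact.out : p.Prime).two_le
  let pol : Polynomial Om := ∑ j : Fin (d + 1), Polynomial.C (cf j) * Polynomial.X ^ (j : ℕ)
  have hpoldeg : pol.natDegree < p := by
    have : pol.natDegree ≤ p - 1 := by
      apply Polynomial.natDegree_sum_le_of_forall_le
      intro j _
      refine (Polynomial.natDegree_C_mul_X_pow_le _ _).trans ?_
      have := j.2; omega
    omega
  have hpol0 : pol = 0 := by
    obtain ⟨y0, hy0⟩ := IsAlgClosed.exists_root (k := Om) (Polynomial.X ^ p - Polynomial.X - Polynomial.C z) (by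
      have : (Polynomial.X ^ p - Polynomial.X - Polynomial.C z : Polynomial Om).natDegree = p := by
        rw [sub_sub]
        rw [Polynomial.natDegree_sub_eq_left_of_natDegree_lt]
        · simp
        · rw [Polynomial.natDegree_X_add_C, Polynomial.natDegree_X_pow]; omega
      intro h
      have h2 : _ = 0 := Polynomial.natDegree_eq_of_degree_eq_some h
      rw [this] at h2
      exact absurd h2 (by omega))
    have hy0' : y0 ^ p - y0 = z := by
      have := hy0
      simp only [Polynomial.IsRoot, Polynomial.eval_sub, Polynomial.eval_pow, Polynomial.eval_X, Polynomial.eval_C] at this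
      exact sub_eq_zero.mp this
    have hroot : ∀ i : ZMod p, pol.eval (y0 + algebraMap _ _ i) = 0 := by
      intro i
      have hpt : (y0 + algebraMap _ _ i) ^ p - (y0 + algebraMap (ZMod p) Om i) = z := by
        rw [add_pow_char, ← map_pow, ZMod.pow_card, ← hy0']; ring
      have h1 := h _ hpt
      rw [Polynomial.eval_finset_sum]
      simp only [Polynomial.eval_mul, Polynomial.eval_C, Polynomial.eval_pow, Polynomial.eval_X]
      exact h1
    apply Polynomial.eq_zero_of_natDegree_lt_card_of_eval_eq_zero pol
      (f := fun i : ZMod p => y0 + algebraMap _ _ i) _ hroot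
    · rw [ZMod.card]; exact hpoldeg
    · intro i j h
      exact (algebraMap (ZMod p) Om).injective (add_left_cancel h)
  have h3 : pol.coeff j = 0 := by rw [hpol0]; simp
  have h4 : pol.coeff j = cf j := by
    simp only [pol, Polynomial.finset_sum_coeff, Polynomial.coeff_C_mul, Polynomial.coeff_X_pow]
    rw [Finset.sum_eq_single j]
    · simp
    · intro i _ hij
      rw [if_neg, mul_zero]
      intro h; exact hij (Fin.ext h.symm)
    · simp
  rw [h4] at h3; exact h3

lemma stepanov_xpoly {p : ℕ} [Fact p.Prime] {Om : Type*} [Field Om] [Algebra (ZMod p) Om]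
    (A : ℕ) (B : ℤ) (G : Finset.Icc (-(A : ℤ)) B → ZMod p) (hG : ∃ e, G e ≠ 0) (S : Finset Om)
    (hS0 : ∀ x ∈ S, x ≠ 0)
    (hS : ∀ x ∈ S, ∑ e, G e • x ^ (e : ℤ) = 0) : (S.card : ℤ) ≤ A + B := by
  classical
  obtain ⟨e0, he0⟩ := hG
  have he0' := e0.2
  rw [Finset.mem_Icc] at he0'
  let pol : Polynomial Om := ∑ e, Polynomial.C (algebraMap (ZMod p) Om (G e)) * Polynomial.X ^ ((e : ℤ) + A).toNat
  have hdeg : pol.natDegree ≤ (A + B).toNat := by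
    apply Polynomial.natDegree_sum_le_of_forall_le
    intro e _
    refine (Polynomial.natDegree_C_mul_X_pow_le _ _).trans ?_
    have := e.2
    rw [Finset.mem_Icc] at this
    omega
  have hne : pol ≠ 0 := by
    intro h
    have h3 : pol.coeff ((e0 : ℤ) + A).toNat = 0 := by rw [h]; simp
    have h4 : pol.coeff ((e0 : ℤ) + A).toNat = algebraMap (ZMod p) Om (G e0) := by
      simp only [pol, Polynomial.finset_sum_coeff, Polynomial.coeff_C_mul, Polynomial.coeff_X_pow]
      rw [Finset.sum_eq_single e0]
      · simp
      · intro e _ hij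
        rw [if_neg, mul_zero]
        intro h
        apply hij
        have := e.2
        rw [Finset.mem_Icc] at this
        apply Subtype.ext
        omega
      · simp
    rw [h4] at h3
    exact he0 ((algebraMap (ZMod p) Om).injective (by rw [h3, map_zero]))
  have hroots : S ⊆ pol.roots.toFinset := by
    intro x hx
    rw [Multiset.mem_toFinset, Polynomial.mem_roots hne, Polynomial.IsRoot]
    simp only [pol, Polynomial.eval_finset_sum, Polynomial.eval_mul, Polynomial.eval_C, Polynomial.eval_pow, Polynomial.eval_X]
    have := congrArg (fun z => x ^ (A : ℤ) * z) (hS x hx)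
    simp only [mul_zero] at this
    rw [← this, Finset.mul_sum]
    apply Finset.sum_congr rfl
    intro e _
    have h2 := e.2
    rw [Finset.mem_Icc] at h2
    rw [Algebra.smul_def, mul_left_comm, ← zpow_add₀ (hS0 x hx), ← zpow_natCast]
    congr 2
    omega
  have := (Finset.card_le_card hroots).trans ((Multiset.toFinset_card_le _).trans (Polynomial.card_roots' pol))
  omega

/-- Bombieri-Stepanov bound -/
lemma stepanov_bound_aux {p : ℕ} [Fact p.Prime] {Om : Type*} [Field Om] [Algebra (ZMod p) Om]
    [IsAlgClosed Om] (a b : ZMod p) (ha : a ≠ 0) (c : ZMod p) (m : ℕ) (hm : 2 ≤ m)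
    {L : Type*} [Field L] [Algebra (ZMod p) L] (xg yg : L) (hxg0 : xg ≠ 0) (hrel : yg ^ p - yg = a • xg + b • xg⁻¹)
    (hgen : ∀ w, ∀ g : Fin w × Fin p × Fin (w + 4) × Fin p → ZMod p, g ≠ 0 →
      ∑ ι, g ι • (xg ^ ((ι.1 : ℕ) + (p * w) * ι.2.2.1) * yg ^ (ι.2.1 : ℕ)
        * (yg ^ (p * w)) ^ (ι.2.2.2 : ℕ)) ≠ 0)
    (S : Finset Om)
    (hS0 : ∀ x ∈ S, x ≠ 0) (hSq : ∀ x ∈ S, x ^ (p ^ (2 * m)) = x)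
    (hSc : ∀ x ∈ S, ∑ r ∈ Finset.range (2 * m), (a • x + b • x⁻¹) ^ (p ^ r) = algebraMap _ _ c) :
    S.card ≤ p ^ (2 * m - 1) + 8 * p ^ m := by
  classical
  have hp : 2 ≤ p := (Fact.out : p.Prime).two_le
  let P := {z : Om × Om // z.1 ∈ S ∧ z.2 ^ p - z.2 = a • z.1 + b • z.1⁻¹}
  let X : ((P → Om) × L)ˣ := ⟨(fun z => z.1.1, xg), (fun z => z.1.1⁻¹, xg⁻¹),
      Prod.ext (funext fun z => mul_inv_cancel₀ (hS0 _ z.2.1)) (mul_inv_cancel₀ hxg0),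
      Prod.ext (funext fun z => inv_mul_cancel₀ (hS0 _ z.2.1)) (inv_mul_cancel₀ hxg0)⟩
  let Y : ((P → Om) × L) := (fun z => z.1.2, yg)
  have hY : Y ^ p = Y + a • (X : ((P → Om) × L)) + b • ((X⁻¹ : ((P → Om) × L)ˣ) : ((P → Om) × L)) := by
    refine Prod.ext ?_ ?_
    · funext z
      have := z.2.2
      change z.1.2 ^ p = z.1.2 + a • z.1.1 + b • z.1.1⁻¹
      rw [add_assoc, ← this]; ring
    · change yg ^ p = yg + a • xg + b • xg⁻¹
      rw [add_assoc, ← hrel]; ring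
  obtain ⟨w, hw⟩ : ∃ w, w = p ^ (m - 1) := ⟨_, rfl⟩
  have hpw : p * w = p ^ m := by rw [hw, ← pow_succ']; congr 1; omega
  have hYQ := frob_tower X Y a b hY m
  rw [← hpw] at hYQ
  obtain ⟨g, hg0, hgker, hgW⟩ := stepanov_core X Y p m w hp hm hw a b hY hYQ c
  obtain ⟨G, hG⟩ := Wsp_mem_iff X Y hgW
  have hG0 : ∃ ι, G ι ≠ 0 := by
    by_contra h
    push Not at h
    apply hgen w g hg0
    have := congrArg Prod.snd hG
    simp only [h, zero_smul, Finset.sum_const_zero] at this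
    rw [Prod.snd_sum] at this
    exact this
  have hz : ∀ (z : P) (n : ℤ), ((X ^ n : ((P → Om) × L)ˣ) : ((P → Om) × L)).1 z = z.1.1 ^ n := by
    intro z n
    cases n with
    | ofNat n =>
      rw [Int.ofNat_eq_natCast, zpow_natCast, zpow_natCast, Units.val_pow_eq_pow_val]; rfl
    | negSucc n => 
      rw [zpow_negSucc, zpow_negSucc, ← inv_pow, ← inv_pow, Units.val_pow_eq_pow_val]; rfl
  have hvan : ∀ z : P, ∑ ι, G ι • (z.1.1 ^ (ι.1 : ℤ) * z.1.2 ^ (ι.2 : ℕ)) = 0 := by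
    intro z
    have hy : z.1.2 ^ (p ^ (2 * m)) = z.1.2 + algebraMap _ _ c := by
      rw [pow_pn_add_const _ _ z.2.2, hSc _ z.2.1]
    have h3 := stepanov_van m w hpw z.1.1 z.1.2 c (hSq _ z.2.1) hy g (by
      have := congrArg (fun e => e.1 z) hgker
      simp only [Prod.fst_sum, Finset.sum_apply] at this
      exact this)
    have h4 := congrArg (fun e => e.1 z) hG
    simp only [Prod.fst_sum, Finset.sum_apply] at h4
    rw [← h3]
    refine Eq.trans ?_ h4.symm
    apply Finset.sum_congr rfl
    intro ι _
    rw [← hz]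
    rfl
  obtain ⟨⟨e0, j0⟩, hι⟩ := hG0
  have hfin := stepanov_xpoly (p := p) (p * w + 1) ((w : ℤ) + p * w * (w + 3) + p * w)
    (fun e => G (⟨e.1, by have := e.2; push_cast at this; exact this⟩, j0))
    ⟨⟨e0.1, by have := e0.2; push_cast; exact this⟩, hι⟩ S hS0 (by
      intro x hx
      have hcf := stepanov_ypoly (p := p) (p - 1) (by omega) (a • x + b • x⁻¹)
        (fun j => ∑ e : Finset.Icc (-((p : ℤ) * w + 1)) ((w : ℤ) + p * w * (w + 3) + p * w), G (e, j) • x ^ (e : ℤ))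
        (by
          intro y hy
          have := hvan ⟨(x, y), hx, hy⟩
          rw [Fintype.sum_prod_type_right] at this
          rw [← this]
          apply Finset.sum_congr rfl
          intro j _
          rw [Finset.sum_mul]
          apply Finset.sum_congr rfl
          intro e _
          rw [smul_mul_assoc]) j0
      rw [← hcf]
      refine Finset.sum_bij' (fun e _ => ⟨e.1, by have := e.2; push_cast at this; exact this⟩) (fun e _ => ⟨e.1, by have := e.2; push_cast; exact this⟩) ?_ ?_ ?_ ?_ ?_
      · intros; simp
      · intros; simp
      · intros; rfl
      · intros; rfl
      · intro e _; rfl)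
  have e1 : p ^ (2 * m - 1) = p ^ m * w := by rw [hw, ← pow_add]; congr 1; omega
  rw [e1, ← hpw]
  have hw1 : 1 ≤ w := by rw [hw]; exact Nat.one_le_pow _ _ (by omega)
  zify
  push_cast at hfin
  have : (1 : ℤ) ≤ w := by exact_mod_cast hw1
  have : (2 : ℤ) ≤ p := by exact_mod_cast hp
  nlinarith

lemma stepanov_bound {p : ℕ} [Fact p.Prime] {Om : Type*} [Field Om] [Algebra (ZMod p) Om]
    [IsAlgClosed Om] (a b : ZMod p) (ha : a ≠ 0) (c : ZMod p) (m : ℕ) (hm : 2 ≤ m)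
    (S : Finset Om)
    (hS0 : ∀ x ∈ S, x ≠ 0) (hSq : ∀ x ∈ S, x ^ (p ^ (2 * m)) = x)
    (hSc : ∀ x ∈ S, ∑ r ∈ Finset.range (2 * m), (a • x + b • x⁻¹) ^ (p ^ r) = algebraMap _ _ c) :
    S.card ≤ p ^ (2 * m - 1) + 8 * p ^ m := by
  have hp : 2 ≤ p := (Fact.out : p.Prime).two_le
  obtain ⟨xg, yg, hxg0, hyg0, hrel, hxo, hyo⟩ := exists_generic p hp a b ha
  letI : Algebra (ZMod p) (LaurentSeries (ZMod p)) := RingHom.toAlgebra HahnSeries.C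
  have hsm : ∀ (c : ZMod p) (z : LaurentSeries (ZMod p)), this.toSMul.smul c z = HahnSeries.C c * z := fun c z => rfl
  refine stepanov_bound_aux a b ha c m hm xg yg hxg0 hrel ?_ S hS0 hSq hSc
  intro w g hg
  have := stepanov_gen p w hp xg yg hxg0 hyg0 hxo hyo g hg
  convert this using 2 with ι
  rw [← HahnSeries.C_mul_eq_smul]
  rfl

lemma quad_count {p : ℕ} [Fact p.Prime] {Om : Type*} [Field Om] [Algebra (ZMod p) Om] [DecidableEq Om]
    [IsAlgClosed Om] (n : ℕ) (F E : Finset Om) (hF : ∀ x, x ∈ F ↔ x ^ (p ^ n) = x)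
    (hE : ∀ x, x ∈ E ↔ (x ^ (p ^ n)) ^ (p ^ n) = x) (s m : Om) (hs : s ∈ F) (hm : m ∈ F) (hm0 : m ≠ 0) :
    (((F.filter (· ≠ 0)) ×ˢ (F.filter (· ≠ 0))).filter (fun z => (z.1 + z.2, z.1 * z.2) = (s, m))).card
    + ((E.filter (· ≠ 0)).filter (fun z => (z + z ^ (p ^ n), z * z ^ (p ^ n)) = (s, m))).card = 2 := by
  haveI : CharP Om p := charP_of_injective_algebraMap (algebraMap (ZMod p) Om).injective p
  have hp : p.Prime := Fact.out
  rw [hF] at hs hm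
  obtain ⟨z1, z2, hz1, hz2⟩ : ∃ z1 z2 : Om, z1 + z2 = s ∧ z1 * z2 = m := by
    obtain ⟨z, hz⟩ := IsAlgClosed.exists_root (Polynomial.X ^ 2 - Polynomial.C s * Polynomial.X + Polynomial.C m : Polynomial Om) (by
      have : (Polynomial.X ^ 2 - Polynomial.C s * Polynomial.X + Polynomial.C m : Polynomial Om) = Polynomial.C 1 * Polynomial.X ^ 2 + Polynomial.C (-s) * Polynomial.X + Polynomial.C m := by
        simp; ring
      rw [this, Polynomial.degree_quadratic one_ne_zero]
      decide)
    refine ⟨z, s - z, by ring, ?_⟩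
    simp [Polynomial.IsRoot] at hz
    linear_combination -hz
  have hroots : ∀ z, z * (s - z) = m ↔ z = z1 ∨ z = z2 := by
    intro z
    rw [← hz1, ← hz2]
    constructor
    · intro h
      have : (z - z1) * (z - z2) = 0 := by linear_combination -h
      rcases mul_eq_zero.mp this with h | h
      · left; exact sub_eq_zero.mp h
      · right; exact sub_eq_zero.mp h
    · rintro (rfl | rfl) <;> ring
  have hfr : ∀ z, z * (s - z) = m → z ^ (p ^ n) * (s - z ^ (p ^ n)) = m := by
    intro z hz
    have := congrArg (· ^ (p ^ n)) hz
    simp only [mul_pow, sub_pow_char_pow, hs, hm] at this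
    exact this
  have c1 : (((F.filter (· ≠ 0)) ×ˢ (F.filter (· ≠ 0))).filter (fun z => (z.1 + z.2, z.1 * z.2) = (s, m))).card
     = (({z1, z2} : Finset Om).filter (fun z => z ^ (p ^ n) = z)).card := by
    apply Finset.card_bij (fun z _ => z.1)
    · rintro ⟨x, y⟩ h
      simp only [Finset.mem_filter, Finset.mem_product, Prod.mk.injEq, hF] at h
      simp only [Finset.mem_filter, Finset.mem_insert, Finset.mem_singleton]
      refine ⟨?_, h.1.1.1⟩
      rw [← hroots, ← h.2.1, ← h.2.2]; ring
    · rintro ⟨x, y⟩ h ⟨x', y'⟩ h' hh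
      simp only [Finset.mem_filter, Finset.mem_product, Prod.mk.injEq, hF] at h h' hh
      subst hh
      have := h.2.1.trans h'.2.1.symm
      rw [Prod.mk.injEq]; exact ⟨rfl, add_left_cancel this⟩
    · intro z hz
      simp only [Finset.mem_filter, Finset.mem_insert, Finset.mem_singleton] at hz
      have hz' := (hroots z).mpr hz.1
      refine ⟨(z, s - z), ?_, rfl⟩
      simp only [Finset.mem_filter, Finset.mem_product, Prod.mk.injEq, hF]
      refine ⟨⟨⟨hz.2, ?_⟩, ⟨by rw [sub_pow_char_pow, hs, hz.2], ?_⟩⟩, by ring, hz'⟩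
      · intro h; rw [h] at hz'; simp at hz'; exact hm0 hz'.symm
      · intro h; rw [h] at hz'; simp at hz'; exact hm0 hz'.symm
  have c2 : ((E.filter (· ≠ 0)).filter (fun z => (z + z ^ (p ^ n), z * z ^ (p ^ n)) = (s, m)))
     = (({z1, z2} : Finset Om).filter (fun z => z ^ (p ^ n) = s - z)) := by
    ext z
    simp only [Finset.mem_filter, Finset.mem_insert, Finset.mem_singleton, hE, Prod.mk.injEq, ← hroots]
    constructor
    · rintro ⟨⟨h1, h2⟩, h3, h4⟩
      refine ⟨?_, by rw [← h3]; ring⟩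
      rw [← h3, ← h4]; ring
    · rintro ⟨h1, h2⟩
      refine ⟨⟨?_, ?_⟩, ?_, ?_⟩
      · rw [h2, sub_pow_char_pow, hs, h2]; ring
      · intro h; rw [h] at h1; simp at h1; exact hm0 h1.symm
      · rw [h2]; ring
      · rw [h2, h1]
  rw [c1, c2]
  have q1 := (hroots _).mp (hfr z1 ((hroots z1).mpr (Or.inl rfl)))
  have q2 := (hroots _).mp (hfr z2 ((hroots z2).mpr (Or.inr rfl)))
  have e1 : s - z1 = z2 := by rw [← hz1]; ring
  have e2 : s - z2 = z1 := by rw [← hz1]; ring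
  have hinj : z1 ^ (p ^ n) = z2 ^ (p ^ n) → z1 = z2 := by
    intro h
    have : (z1 - z2) ^ (p ^ n) = 0 := by rw [sub_pow_char_pow, h, sub_self]
    exact sub_eq_zero.mp (pow_eq_zero_iff (by have := hp.pos; positivity) |>.mp this)
  by_cases h12 : z1 = z2
  · subst h12
    have : z1 ^ p ^ n = z1 := by simpa using q1
    simp [Finset.filter_singleton, this, e1]
  · have h21 : z2 ≠ z1 := fun h => h12 h.symm
    rcases q1 with h | h <;> rcases q2 with h' | h'
    · exact absurd (hinj (h.trans h'.symm)) h12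
    · simp [Finset.filter_insert, Finset.filter_singleton, h, h', e1, e2, h12, h21]
    · simp [Finset.filter_insert, Finset.filter_singleton, h, h', e1, e2, h12, h21]
    · exact absurd (hinj (h.trans h'.symm)) h12

lemma quad_step {p : ℕ} [Fact p.Prime] {Om : Type*} [Field Om] [Algebra (ZMod p) Om] [DecidableEq Om]
    [IsAlgClosed Om] (n : ℕ) (F E : Finset Om) (hF : ∀ x, x ∈ F ↔ x ^ (p ^ n) = x)
    (hE : ∀ x, x ∈ E ↔ (x ^ (p ^ n)) ^ (p ^ n) = x) (f : Om → ℂ)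
    (hf : ∀ x ∈ F, ∀ y ∈ F, f (x + y) = f x * f y)
    (hf2 : ∀ c ∈ F, ∑ s ∈ F, f (s * c) = if c = 0 then (p : ℂ) ^ n else 0)
    (A B : Om) (hA : A ∈ F) (hB : B ∈ F) (hA0 : A ≠ 0) (hB0 : B ≠ 0) :
    (∑ x ∈ F.filter (· ≠ 0), f (A * x + B * x⁻¹)) ^ 2 +
    ∑ z ∈ E.filter (· ≠ 0), f (A * (z + z ^ (p ^ n)) + B * (z⁻¹ + (z ^ (p ^ n))⁻¹)) = 2 * p ^ n := by
  haveI : CharP Om p := charP_of_injective_algebraMap (algebraMap (ZMod p) Om).injective p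
  have hp : p.Prime := Fact.out
  have hadd : ∀ x y, x ∈ F → y ∈ F → x + y ∈ F := by
    intro x y hx hy; rw [hF] at *; rw [add_pow_char_pow, hx, hy]
  have hmul : ∀ x y, x ∈ F → y ∈ F → x * y ∈ F := by
    intro x y hx hy; rw [hF] at *; rw [mul_pow, hx, hy]
  have hinv : ∀ x, x ∈ F → x⁻¹ ∈ F := by
    intro x hx; rw [hF] at *; rw [inv_pow, hx]
  let g : Om × Om → ℂ := fun sm => f (A * sm.1 + B * (sm.1 * sm.2⁻¹))
  have h1 : (∑ x ∈ F.filter (· ≠ 0), f (A * x + B * x⁻¹)) ^ 2 =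
      ∑ z ∈ (F.filter (· ≠ 0)) ×ˢ (F.filter (· ≠ 0)), g (z.1 + z.2, z.1 * z.2) := by
    rw [sq, Finset.sum_mul_sum, ← Finset.sum_product']
    apply Finset.sum_congr rfl
    rintro ⟨x, y⟩ h
    simp only [Finset.mem_product, Finset.mem_filter] at h
    rw [← hf _ (hadd _ _ (hmul _ _ hA h.1.1) (hmul _ _ hB (hinv _ h.1.1))) _ (hadd _ _ (hmul _ _ hA h.2.1) (hmul _ _ hB (hinv _ h.2.1)))]
    simp only [g]
    congr 1
    have := h.1.2; have := h.2.2
    field_simp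
    ring
  have h2 : ∑ z ∈ E.filter (· ≠ 0), f (A * (z + z ^ (p ^ n)) + B * (z⁻¹ + (z ^ (p ^ n))⁻¹)) =
      ∑ z ∈ E.filter (· ≠ 0), g (z + z ^ (p ^ n), z * z ^ (p ^ n)) := by
    apply Finset.sum_congr rfl
    intro z h
    simp only [Finset.mem_filter] at h
    simp only [g]
    congr 1
    have := h.2
    field_simp
    ring
  rw [h1, h2]
  have t1 : ∀ z ∈ (F.filter (· ≠ 0)) ×ˢ (F.filter (· ≠ 0)), (z.1 + z.2, z.1 * z.2) ∈ F ×ˢ (F.filter (· ≠ 0)) := by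
    rintro ⟨x, y⟩ h
    simp only [Finset.mem_product, Finset.mem_filter] at *
    exact ⟨hadd _ _ h.1.1 h.2.1, hmul _ _ h.1.1 h.2.1, mul_ne_zero h.1.2 h.2.2⟩
  have t2 : ∀ z ∈ E.filter (· ≠ 0), (z + z ^ (p ^ n), z * z ^ (p ^ n)) ∈ F ×ˢ (F.filter (· ≠ 0)) := by
    intro z h
    simp only [Finset.mem_product, Finset.mem_filter, hF, hE] at *
    refine ⟨?_, ?_, mul_ne_zero h.2 (pow_ne_zero _ h.2)⟩
    · rw [add_pow_char_pow, h.1, add_comm]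
    · rw [mul_pow, h.1, mul_comm]
  rw [← Finset.sum_fiberwise_of_maps_to t1, ← Finset.sum_fiberwise_of_maps_to t2, ← Finset.sum_add_distrib]
  have t3 : ∀ sm ∈ F ×ˢ (F.filter (· ≠ 0)),
      (∑ z ∈ (F.filter (· ≠ 0)) ×ˢ (F.filter (· ≠ 0)) with (z.1 + z.2, z.1 * z.2) = sm, g (z.1 + z.2, z.1 * z.2)) +
      (∑ z ∈ E.filter (· ≠ 0) with (z + z ^ (p ^ n), z * z ^ (p ^ n)) = sm, g (z + z ^ (p ^ n), z * z ^ (p ^ n))) = 2 * g sm := by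
    rintro ⟨s, m⟩ h
    simp only [Finset.mem_product, Finset.mem_filter] at h
    have hc := quad_count n F E hF hE s m h.1 h.2.1 h.2.2
    have u1 := Finset.sum_congr (s₁ := ((F.filter (· ≠ 0)) ×ˢ (F.filter (· ≠ 0))).filter (fun z => (z.1 + z.2, z.1 * z.2) = (s, m))) rfl (fun z hz => congrArg g (Finset.mem_filter.mp hz).2)
    have u2 := Finset.sum_congr (s₁ := (E.filter (· ≠ 0)).filter (fun z => (z + z ^ (p ^ n), z * z ^ (p ^ n)) = (s, m))) rfl (fun z hz => congrArg g (Finset.mem_filter.mp hz).2)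
    rw [u1, u2, Finset.sum_const, Finset.sum_const, ← add_smul, hc]
    simp
  rw [Finset.sum_congr rfl t3, ← Finset.mul_sum]
  congr 1
  rw [Finset.sum_product_right]
  have hr : ∀ m ∈ F.filter (· ≠ 0), ∑ s ∈ F, g (s, m) = if m = -B / A then (p : ℂ) ^ n else 0 := by
    intro m hm
    simp only [Finset.mem_filter] at hm
    have : ∀ s, g (s, m) = f (s * (A + B * m⁻¹)) := by
      intro s; simp only [g]; congr 1; ring
    simp only [this]
    rw [hf2 _ (hadd _ _ hA (hmul _ _ hB (hinv _ hm.1)))]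
    congr 1
    rw [eq_div_iff hA0]
    have := hm.2
    apply propext
    constructor
    · intro h
      field_simp at h
      linear_combination h
    · intro h
      field_simp
      linear_combination h
  rw [Finset.sum_congr rfl hr, Finset.sum_ite_eq', if_pos]
  simp only [Finset.mem_filter]
  refine ⟨?_, div_ne_zero (neg_ne_zero.mpr hB0) hA0⟩
  rw [neg_div, div_eq_mul_inv]
  have hn1 : (-1 : Om) ∈ F := by
    rw [hF]
    have h0 : (0:Om) ^ (p ^ n) = 0 := zero_pow (by have := hp.pos; positivity)
    have : ((0:Om) - 1) ^ (p ^ n) = 0 - 1 := by rw [sub_pow_char_pow, h0, one_pow]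
    simpa using this
  have := hmul _ _ hn1 (hmul _ _ hB (hinv _ hA))
  simpa using this

section Weil
variable {p : ℕ} [hpF : Fact p.Prime] {Om : Type*} [Field Om] [Algebra (ZMod p) Om] [IsAlgClosed Om]

lemma FF_exists (p : ℕ) [hpF : Fact p.Prime] (Om : Type*) [Field Om] [Algebra (ZMod p) Om] [IsAlgClosed Om] (n : ℕ) (hn : n ≠ 0) : ∃ F : Finset Om, (∀ x, x ∈ F ↔ x ^ (p ^ n) = x) ∧ F.card = p ^ n := by
  classical
  haveI : CharP Om p := charP_of_injective_algebraMap (algebraMap (ZMod p) Om).injective p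
  have hdeg := FiniteField.X_pow_card_pow_sub_X_natDegree_eq Om hn hpF.out.one_lt
  have hne : (Polynomial.X ^ p ^ n - Polynomial.X : Polynomial Om) ≠ 0 := by
    intro h; rw [h] at hdeg; simp at hdeg
    have := hpF.out.pos; have := pow_pos this n; omega
  refine ⟨(Polynomial.X ^ p ^ n - Polynomial.X : Polynomial Om).roots.toFinset, ?_, ?_⟩
  · intro x
    rw [Multiset.mem_toFinset, Polynomial.mem_roots hne]
    simp [Polynomial.IsRoot, sub_eq_zero]
  · rw [Multiset.toFinset_card_of_nodup (Polynomial.nodup_roots (galois_poly_separable p _ (dvd_pow_self p hn))),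
      Polynomial.splits_iff_card_roots.mp (IsAlgClosed.splits _), hdeg]

def TT (p : ℕ) {Om : Type*} [Field Om] (n : ℕ) (z : Om) : Om := ∑ r ∈ Finset.range n, z ^ (p ^ r)

lemma TT_add (n : ℕ) (x y : Om) : TT p n (x + y) = TT p n x + TT p n y := by
  haveI : CharP Om p := charP_of_injective_algebraMap (algebraMap (ZMod p) Om).injective p
  simp only [TT, ← Finset.sum_add_distrib, add_pow_char_pow]

lemma TT_smul (n : ℕ) (c : ZMod p) (y : Om) : TT p n (c • y) = c • TT p n y := by
  simp only [TT, Finset.smul_sum]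
  apply Finset.sum_congr rfl
  intro r _
  rw [Algebra.smul_def, mul_pow, ← map_pow, ZMod.pow_card_pow, ← Algebra.smul_def]

lemma TT_double (n : ℕ) (z : Om) : TT p (n + n) z = TT p n (z + z ^ (p ^ n)) := by
  rw [TT_add]
  simp only [TT, Finset.sum_range_add]
  congr 1
  apply Finset.sum_congr rfl
  intro r _
  rw [← pow_mul, ← pow_add]

lemma mem_range_of_pow (z : Om) (hz : z ^ p = z) : ∃ c : ZMod p, z = algebraMap _ _ c := by
  classical
  obtain ⟨F, hF, hcard⟩ := FF_exists p Om 1 one_ne_zero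
  have : Finset.univ.image (algebraMap (ZMod p) Om) = F := by
    apply Finset.eq_of_subset_of_card_le
    · intro x hx
      simp only [Finset.mem_image, Finset.mem_univ, true_and] at hx
      obtain ⟨c, rfl⟩ := hx
      rw [hF, pow_one, ← map_pow, ZMod.pow_card]
    · rw [Finset.card_image_of_injective _ (algebraMap (ZMod p) Om).injective, hcard]
      simp [ZMod.card]
  have hz' : z ∈ F := by rw [hF, pow_one, hz]
  rw [← this] at hz'
  simp only [Finset.mem_image, Finset.mem_univ, true_and] at hz'
  obtain ⟨c, hc⟩ := hz'
  exact ⟨c, hc.symm⟩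

lemma TT_mem (n : ℕ) (z : Om) (hz : z ^ (p ^ n) = z) : ∃ c : ZMod p, TT p n z = algebraMap _ _ c := by
  haveI : CharP Om p := charP_of_injective_algebraMap (algebraMap (ZMod p) Om).injective p
  apply mem_range_of_pow
  have : (TT p n z) ^ p = ∑ r ∈ Finset.range n, z ^ (p ^ (r + 1)) := by
    simp only [TT]
    rw [sum_pow_char]
    apply Finset.sum_congr rfl
    intro r _
    rw [← pow_mul, ← pow_succ]
  rw [this, TT]
  have h1 := Finset.sum_range_succ (fun r => z ^ (p ^ r)) n
  have h2 := Finset.sum_range_succ' (fun r => z ^ (p ^ r)) n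
  rw [h1] at h2
  rw [hz] at h2
  simp only [pow_zero, pow_one] at h2
  exact (add_right_cancel h2).symm

noncomputable def psin (ψ : AddChar (ZMod p) ℂ) (n : ℕ) (z : Om) : ℂ :=
  ψ (Function.invFun (algebraMap (ZMod p) Om) (TT p n z))

lemma psin_spec (ψ : AddChar (ZMod p) ℂ) (n : ℕ) (z : Om) (c : ZMod p) (h : TT p n z = algebraMap _ _ c) :
    psin ψ n z = ψ c := by
  rw [psin, h, Function.leftInverse_invFun (algebraMap (ZMod p) Om).injective]

lemma psin_add (ψ : AddChar (ZMod p) ℂ) (n : ℕ) (x y : Om) (hx : x ^ (p ^ n) = x) (hy : y ^ (p ^ n) = y) :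
    psin ψ n (x + y) = psin ψ n x * psin ψ n y := by
  obtain ⟨c, hc⟩ := TT_mem n x hx
  obtain ⟨d, hd⟩ := TT_mem n y hy
  rw [psin_spec ψ n x c hc, psin_spec ψ n y d hd, psin_spec ψ n (x + y) (c + d) (by rw [TT_add, hc, hd, map_add]),
    AddChar.map_add_eq_mul]

lemma psin_double (ψ : AddChar (ZMod p) ℂ) (n : ℕ) (z : Om) :
    psin ψ (n + n) z = psin ψ n (z + z ^ (p ^ n)) := by
  rw [psin, psin, TT_double]

lemma psin_nontriv (ψ : AddChar (ZMod p) ℂ) (hψ : ψ ≠ 1) (n : ℕ) (hn : n ≠ 0) :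
    ∃ s : Om, s ^ (p ^ n) = s ∧ psin ψ n s ≠ 1 := by
  classical
  obtain ⟨c0, hc0⟩ := (AddChar.ne_one_iff).mp hψ
  obtain ⟨F, hF, hcard⟩ := FF_exists p Om n hn
  obtain ⟨z, hz, hTz⟩ : ∃ z ∈ F, TT p n z ≠ 0 := by
    by_contra h
    push Not at h
    let pol : Polynomial Om := ∑ r ∈ Finset.range n, Polynomial.X ^ (p ^ r)
    have hev : ∀ z, pol.eval z = TT p n z := by
      intro z; simp [pol, TT, Polynomial.eval_finset_sum]
    have hdeg : pol.natDegree ≤ p ^ (n - 1) := by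
      apply Polynomial.natDegree_sum_le_of_forall_le
      intro r hr
      rw [Polynomial.natDegree_X_pow]
      exact Nat.pow_le_pow_right hpF.out.pos (by simp at hr; omega)
    have h0 : pol = 0 := by
      apply Polynomial.eq_zero_of_natDegree_lt_card_of_eval_eq_zero' pol F (fun z hz => by rw [hev, h z hz])
      rw [hcard]
      refine hdeg.trans_lt (Nat.pow_lt_pow_right hpF.out.one_lt (by omega))
    have : pol.coeff 1 = 1 := by
      simp only [pol, Polynomial.finset_sum_coeff, Polynomial.coeff_X_pow]
      rw [Finset.sum_eq_single 0]
      · simp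
      · intro r hr hr0
        rw [if_neg]
        exact (Nat.one_lt_pow hr0 hpF.out.one_lt).ne
      · intro h; simp at h; exact absurd h hn
    rw [h0] at this; simp at this
  rw [hF] at hz
  obtain ⟨c, hc⟩ := TT_mem n z hz
  have hc' : c ≠ 0 := by rintro rfl; rw [map_zero] at hc; exact hTz hc
  refine ⟨(c0 / c) • z, ?_, ?_⟩
  · rw [Algebra.smul_def, mul_pow, ← map_pow, ZMod.pow_card_pow, hz]
  · rw [psin_spec ψ n _ c0]
    · exact hc0
    · rw [TT_smul, hc, Algebra.smul_def, ← map_mul, div_mul_cancel₀ _ hc']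

lemma psin_sum (ψ : AddChar (ZMod p) ℂ) (hψ : ψ ≠ 1) (n : ℕ) (hn : n ≠ 0) (F : Finset Om)
    (hF : ∀ x, x ∈ F ↔ x ^ (p ^ n) = x) (hcard : F.card = p ^ n) [DecidableEq Om] (c : Om) (hc : c ∈ F) :
    ∑ s ∈ F, psin ψ n (s * c) = if c = 0 then (p : ℂ) ^ n else 0 := by
  haveI : CharP Om p := charP_of_injective_algebraMap (algebraMap (ZMod p) Om).injective p
  split_ifs with h
  · subst h
    have : psin ψ n (0 : Om) = 1 := by
      rw [psin_spec ψ n 0 0]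
      · simp
      · simp only [TT, map_zero]
        apply Finset.sum_eq_zero
        intro r _
        exact zero_pow (by have := hpF.out.pos; positivity)
    simp [this, hcard]
  · obtain ⟨s, hs, hs1⟩ := psin_nontriv (Om := Om) ψ hψ n hn
    rw [hF] at hc
    have h1 : ∑ t ∈ F, psin ψ n (t * c) = psin ψ n s * ∑ t ∈ F, psin ψ n (t * c) := by
      rw [Finset.mul_sum]
      refine Finset.sum_bij' (fun t _ => t - s / c) (fun t _ => t + s / c) ?_ ?_ ?_ ?_ ?_
      · intro t ht; rw [hF] at *; rw [sub_pow_char_pow, div_pow, ht, hs, hc]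
      · intro t ht; rw [hF] at *; rw [add_pow_char_pow, div_pow, ht, hs, hc]
      · intros; ring
      · intros; ring
      · intro t ht
        rw [hF] at ht
        rw [← psin_add ψ n _ _ hs]
        · congr 1; field_simp; ring
        · rw [mul_pow, sub_pow_char_pow, div_pow, ht, hs, hc]
    have h2 : (psin ψ n s - 1) * ∑ t ∈ F, psin ψ n (t * c) = 0 := by linear_combination -h1
    rcases mul_eq_zero.mp h2 with h3 | h3
    · exact absurd (sub_eq_zero.mp h3) hs1
    · exact h3

open Classical in
lemma K_double (ψ : AddChar (ZMod p) ℂ) (hψ : ψ ≠ 1) (n : ℕ) (hn : n ≠ 0) (F E : Finset Om)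
    (hF : ∀ x, x ∈ F ↔ x ^ (p ^ n) = x) (hcard : F.card = p ^ n)
    (hE : ∀ x, x ∈ E ↔ x ^ (p ^ (n + n)) = x) (a b : ZMod p) (ha : a ≠ 0) (hb : b ≠ 0) :
    (∑ x ∈ F.filter (· ≠ 0), psin ψ n (a • x + b • x⁻¹)) ^ 2 +
    ∑ x ∈ E.filter (· ≠ 0), psin ψ (n + n) (a • x + b • x⁻¹) = 2 * p ^ n := by
  haveI : CharP Om p := charP_of_injective_algebraMap (algebraMap (ZMod p) Om).injective p
  have hinj := (algebraMap (ZMod p) Om).injective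
  have hc : ∀ c : ZMod p, algebraMap (ZMod p) Om c ∈ F := fun c => by
    rw [hF, ← map_pow, ZMod.pow_card_pow]
  have := quad_step n F E hF (fun x => by rw [hE, ← pow_mul, ← pow_add]) (psin ψ n)
    (fun x hx y hy => psin_add ψ n x y ((hF x).mp hx) ((hF y).mp hy))
    (fun c hc => psin_sum ψ hψ n hn F hF hcard c hc) (algebraMap _ _ a) (algebraMap _ _ b) (hc a) (hc b)
    (by rwa [Ne, map_eq_zero]) (by rwa [Ne, map_eq_zero])
  rw [← this]
  congr 1
  · simp only [Algebra.smul_def]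
  · apply Finset.sum_congr rfl
    intro z _
    rw [psin_double]
    congr 1
    have h1 := (hF _).mp (hc a)
    have h2 := (hF _).mp (hc b)
    rw [Algebra.smul_def, Algebra.smul_def, add_pow_char_pow, mul_pow, mul_pow, h1, h2, inv_pow]
    ring

open Classical in
lemma K_bound (ψ : AddChar (ZMod p) ℂ) (hψ : ψ ≠ 1) (m : ℕ) (hm : 2 ≤ m) (F : Finset Om)
    (hF : ∀ x, x ∈ F ↔ x ^ (p ^ (2 * m)) = x) (hcard : F.card = p ^ (2 * m))
    (a b : ZMod p) (ha : a ≠ 0) :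
    ‖∑ x ∈ F.filter (· ≠ 0), psin ψ (2 * m) (a • x + b • x⁻¹)‖ ≤ (8 * p + 1) * (p : ℝ) ^ m := by
  haveI : CharP Om p := charP_of_injective_algebraMap (algebraMap (ZMod p) Om).injective p
  set n := 2 * m with hn
  have hF' : ∀ x ∈ F, (a • x + b • x⁻¹) ^ (p ^ n) = a • x + b • x⁻¹ := by
    intro x hx
    rw [hF] at hx
    rw [add_pow_char_pow]
    simp only [Algebra.smul_def, mul_pow, ← map_pow, ZMod.pow_card_pow, inv_pow, hx]
  let τ : Om → ZMod p := fun x => Function.invFun (algebraMap (ZMod p) Om) (TT p n (a • x + b • x⁻¹))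
  have hτ : ∀ x ∈ F, TT p n (a • x + b • x⁻¹) = algebraMap _ _ (τ x) := by
    intro x hx
    obtain ⟨c, hc⟩ := TT_mem n _ (hF' x hx)
    simp only [τ]
    rw [hc, Function.leftInverse_invFun (algebraMap (ZMod p) Om).injective]
  let Nc : ZMod p → ℕ := fun c => ((F.filter (· ≠ 0)).filter (fun x => τ x = c)).card
  obtain ⟨M, hM⟩ : ∃ M : ℝ, M = p ^ (2 * m - 1) + 8 * p ^ m := ⟨_, rfl⟩
  have hNc : ∀ c, (Nc c : ℝ) ≤ M := by
    intro c
    have := stepanov_bound a b ha c m hm ((F.filter (· ≠ 0)).filter (fun x => τ x = c))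
      (fun x hx => by simp only [Finset.mem_filter] at hx; exact hx.1.2)
      (fun x hx => by simp only [Finset.mem_filter] at hx; exact (hF x).mp hx.1.1)
      (fun x hx => by
        simp only [Finset.mem_filter] at hx
        have := hτ x hx.1.1
        rw [hx.2] at this; exact this)
    rw [hM]; exact_mod_cast this
  have hsum : ∑ c, (Nc c : ℝ) = p ^ n - 1 := by
    have h1 : ∑ c, Nc c = (F.filter (· ≠ 0)).card := 
      (Finset.card_eq_sum_card_fiberwise (fun x _ => Finset.mem_coe.mpr (Finset.mem_univ (τ x)))).symm
    have h2 : (F.filter (· ≠ 0)).card + 1 = p ^ n := by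
      rw [← hcard, Finset.filter_ne', Finset.card_erase_add_one]
      rw [hF]; exact zero_pow (by have := hpF.out.pos; positivity)
    have h3 : ((∑ c, Nc c : ℕ) : ℝ) + 1 = p ^ n := by rw [h1]; exact_mod_cast h2
    push_cast at h3; linarith
  have hK : ∑ x ∈ F.filter (· ≠ 0), psin ψ n (a • x + b • x⁻¹) = ∑ c, ((Nc c : ℂ) - M) * ψ c := by
    simp only [sub_mul, Finset.sum_sub_distrib]
    rw [← Finset.mul_sum, AddChar.sum_eq_zero_of_ne_one hψ, mul_zero, sub_zero]
    rw [← Finset.sum_fiberwise_of_maps_to (t := Finset.univ) (g := τ) (fun x _ => Finset.mem_univ _)]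
    apply Finset.sum_congr rfl
    intro c _
    rw [Finset.sum_congr rfl (g := fun _ => ψ c), Finset.sum_const, nsmul_eq_mul]
    intro x hx
    simp only [Finset.mem_filter] at hx
    rw [psin]
    exact congrArg ψ hx.2
  rw [hK]
  refine (norm_sum_le _ _).trans ?_
  have : ∀ c, ‖((Nc c : ℂ) - M) * ψ c‖ = M - Nc c := by
    intro c
    rw [norm_mul, AddChar.norm_apply, mul_one]
    have : ((Nc c : ℂ) - M) = ((Nc c - M : ℝ) : ℂ) := by push_cast; rfl
    rw [this, Complex.norm_real, Real.norm_eq_abs, abs_of_nonpos (by linarith [hNc c])]; ring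
  simp only [this, Finset.sum_sub_distrib, hsum, Finset.sum_const, Finset.card_univ, ZMod.card, nsmul_eq_mul]
  rw [hM]
  have e1 : (p : ℝ) * p ^ (2 * m - 1) = p ^ n := by rw [← pow_succ']; congr 1; omega
  have e2 : (1 : ℝ) ≤ p ^ m := one_le_pow₀ (by exact_mod_cast hpF.out.pos)
  nlinarith

end Weil

lemma tower_growth (k : ℕ → ℝ) (P C : ℝ) (hP : 0 < P) (h : ∀ j, k (j + 1) ≥ k j ^ 2 - 2 * P ^ (2 ^ j))
    (hk0 : ∀ j, 0 ≤ k j) (hb : ∀ j, 2 ≤ j → k j ^ 2 ≤ C ^ 2 * P ^ (2 ^ j)) (hC : 0 ≤ C) : k 0 ^ 2 ≤ 4 * P := by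
  by_contra hcon
  push Not at hcon
  set r := Real.sqrt P with hr
  have hr0 : 0 < r := Real.sqrt_pos.mpr hP
  have hr2 : r ^ 2 = P := Real.sq_sqrt hP.le
  let c : ℕ → ℝ := fun j => k j / r ^ (2 ^ j)
  have hc1 : ∀ j, c (j + 1) ≥ c j ^ 2 - 2 := by
    intro j
    simp only [c, div_pow]
    rw [ge_iff_le, le_div_iff₀ (by positivity), pow_succ 2 j, pow_mul, sub_mul,
      div_mul_cancel₀ _ (by positivity)]
    have : (r ^ 2 ^ j) ^ 2 = P ^ 2 ^ j := by rw [← pow_mul, mul_comm, pow_mul, hr2]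
    rw [this]; exact h j
  have hc0 : 2 < c 0 := by
    simp only [c, pow_zero, pow_one]
    rw [lt_div_iff₀ hr0]
    apply lt_of_pow_lt_pow_left₀ 2 (hk0 0)
    rw [mul_pow, hr2]; linarith
  set δ := c 0 - 2 with hδ
  have hδ0 : 0 < δ := by linarith
  have hg : ∀ j : ℕ, c j ≥ 2 + 4 ^ j * δ := by
    intro j
    induction j with
    | zero => simp [hδ]
    | succ j ih =>
      have h1 := hc1 j
      have h2 : 0 < 4 ^ j * δ := by positivity
      rw [pow_succ]
      nlinarith
  have hcb : ∀ j, 2 ≤ j → c j ≤ C := by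
    intro j hj
    simp only [c]
    rw [div_le_iff₀ (by positivity)]
    refine le_of_pow_le_pow_left₀ two_ne_zero (by positivity) ?_
    rw [mul_pow, ← pow_mul r, mul_comm _ 2, pow_mul r, hr2]
    exact hb j hj
  obtain ⟨j, hj⟩ := pow_unbounded_of_one_lt (C / δ) (by norm_num : (1:ℝ) < 4)
  have h1 := hcb (j + 2) (by omega)
  have h2 := hg (j + 2)
  rw [div_lt_iff₀ hδ0] at hj
  have : (4:ℝ) ^ (j + 2) = 16 * 4 ^ j := by ring
  rw [this] at h2
  nlinarith [show (0:ℝ) < 4 ^ j * δ by positivity]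

/-- Weil bound for Kloosterman sums modulo a prime. -/
theorem weil_prime {p : ℕ} [hpF : Fact p.Prime] (ψ : AddChar (ZMod p) ℂ) (hψ : ψ ≠ 1) (a b : ZMod p)
    (ha : a ≠ 0) (hb : b ≠ 0) :
    ‖∑ x : (ZMod p)ˣ, ψ (a * x + b * (x⁻¹ : (ZMod p)ˣ))‖ ^ 2 ≤ 4 * p := by
  classical
  have hp0 : (0:ℝ) < p := by exact_mod_cast hpF.out.pos
  have hex : ∀ j : ℕ, ∃ F : Finset (AlgebraicClosure (ZMod p)), (∀ x, x ∈ F ↔ x ^ (p ^ (2 ^ j)) = x) ∧ F.card = p ^ (2 ^ j) :=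
    fun j => FF_exists p _ _ (by positivity)
  choose F hF hcard using hex
  let K : ℕ → ℂ := fun j => ∑ x ∈ (F j).filter (· ≠ 0), psin ψ (2 ^ j) (a • x + b • x⁻¹)
  have h0 : ∑ x : (ZMod p)ˣ, ψ (a * x + b * (x⁻¹ : (ZMod p)ˣ)) = K 0 := by
    simp only [K]
    refine Finset.sum_bij (fun x _ => algebraMap (ZMod p) (AlgebraicClosure (ZMod p)) x) ?_ ?_ ?_ ?_
    · intro x _
      simp only [Finset.mem_filter, hF, pow_zero, pow_one, ← map_pow, ZMod.pow_card, true_and]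
      rw [Ne, map_eq_zero]; exact x.ne_zero
    · intro x _ y _ h
      exact Units.ext ((algebraMap (ZMod p) (AlgebraicClosure (ZMod p))).injective h)
    · intro z hz
      simp only [Finset.mem_filter, hF, pow_zero, pow_one] at hz
      obtain ⟨c, rfl⟩ := mem_range_of_pow z hz.1
      have : c ≠ 0 := by rintro rfl; simp at hz
      exact ⟨Units.mk0 c this, Finset.mem_univ _, rfl⟩
    · intro x _
      rw [psin_spec]
      simp only [TT, pow_zero, Finset.range_one, Finset.sum_singleton, pow_one]
      rw [map_add, map_mul, map_mul, Algebra.smul_def, Algebra.smul_def, Units.val_inv_eq_inv_val, map_inv₀]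
  rw [h0]
  refine tower_growth (fun j => ‖K j‖) p (8 * p + 1) hp0 ?_ (fun j => norm_nonneg _) ?_ (by positivity)
  · intro j
    have hj := K_double ψ hψ (2 ^ j) (by positivity) (F j) (F (j + 1)) (hF j) (hcard j) (by
      intro x; rw [hF, pow_succ, mul_two]) a b ha hb
    have h2 : K (j + 1) = 2 * p ^ (2 ^ j) - K j ^ 2 := by
      have : 2 ^ (j + 1) = 2 ^ j + 2 ^ j := by rw [pow_succ, mul_two]
      simp only [K, this]
      rw [← hj]; ring
    rw [h2, ← norm_pow]
    have := norm_sub_norm_le (K j ^ 2) (2 * p ^ (2 ^ j))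
    rw [norm_sub_rev]
    have h3 : ‖(2 * p ^ (2 ^ j) : ℂ)‖ = 2 * p ^ (2 ^ j) := by simp
    linarith
  · intro j hj
    have hm : 2 ^ j = 2 * 2 ^ (j - 1) := by rw [← pow_succ']; congr 1; omega
    have := K_bound ψ hψ (2 ^ (j - 1)) (by
        calc 2 = 2 ^ 1 := rfl
          _ ≤ _ := Nat.pow_le_pow_right (by norm_num) (by omega)) (F j) (by rw [← hm]; exact hF j) (by rw [← hm]; exact hcard j) a b ha
    rw [← hm] at this
    have h2 : ‖K j‖ ^ 2 ≤ ((8 * p + 1) * (p : ℝ) ^ (2 ^ (j - 1))) ^ 2 := by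
      gcongr
    rw [mul_pow, ← pow_mul, mul_comm (2 ^ (j-1)), ← hm] at h2
    exact h2

/-- property: Kloosterman sum bound mod q -/
def KlB (q : ℕ) : Prop := ∀ _ : NeZero q, ∃ s u v : ℕ, q = s * u ^ 2 * v ∧ v ∣ u ∧
  ∀ ψ : AddChar (ZMod q) ℂ, ψ.IsPrimitive → ∀ (a : ZMod q) (b : ℕ),
    ‖∑ x : (ZMod q)ˣ, ψ (a * x + b * (x⁻¹ : (ZMod q)ˣ))‖ ≤
      q.divisors.card * Nat.gcd b q * Real.sqrt q * (u * Real.sqrt v)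

lemma kl_trivial (q : ℕ) [NeZero q] (ψ : AddChar (ZMod q) ℂ) (a b : ZMod q) :
    ‖∑ x : (ZMod q)ˣ, ψ (a * x + b * (x⁻¹ : (ZMod q)ˣ))‖ ≤ q := by
  refine (norm_sum_le _ _).trans ?_
  simp only [AddChar.norm_apply, Finset.sum_const, Finset.card_univ, ZMod.card_units_eq_totient, nsmul_eq_mul, mul_one]
  exact_mod_cast Nat.totient_le q

lemma KlB_prime (p : ℕ) (hp : p.Prime) : KlB p := by
  intro _
  haveI : Fact p.Prime := ⟨hp⟩
  refine ⟨p, 1, 1, by simp, by simp, ?_⟩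
  intro ψ hψ a b
  have hψ1 : ψ ≠ 1 := by
    have := hψ (one_ne_zero)
    simpa using this
  have hd : p.divisors.card = 2 := by rw [hp.divisors]; exact Finset.card_pair hp.one_lt.ne
  have hp1 : (1:ℝ) ≤ p := by exact_mod_cast hp.one_lt.le
  have hs1 : 1 ≤ Real.sqrt p := by rw [Real.one_le_sqrt]; exact hp1
  rw [hd]
  simp only [Nat.cast_one, Real.sqrt_one, mul_one]
  by_cases hb : p ∣ b
  · rw [Nat.gcd_eq_right hb]
    refine (kl_trivial p ψ a b).trans ?_
    push_cast
    nlinarith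
  have hg : Nat.gcd b p = 1 := Nat.Coprime.symm ((Nat.Prime.coprime_iff_not_dvd hp).mpr hb)
  have hb0 : (b : ZMod p) ≠ 0 := by rwa [Ne, ZMod.natCast_eq_zero_iff]
  rw [hg]
  by_cases ha : a = 0
  · subst ha
    have h1 : ∑ x : (ZMod p)ˣ, ψ (0 * x + b * (x⁻¹ : (ZMod p)ˣ)) = -1 := by
      simp only [zero_mul, zero_add]
      rw [← Equiv.sum_comp (Equiv.inv (ZMod p)ˣ)]
      simp only [Equiv.inv_apply, inv_inv]
      have h2 := AddChar.sum_mulShift (ψ := ψ) (b : ZMod p) hψ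
      rw [if_neg hb0] at h2
      have h3 : ∑ x : ZMod p, ψ (x * b) = 1 + ∑ x : (ZMod p)ˣ, ψ (b * x) := by
        rw [Fintype.sum_eq_add_sum_compl 0]
        simp only [zero_mul, AddChar.map_zero_eq_one]
        congr 1
        symm
        refine Finset.sum_bij (fun x _ => (x : ZMod p)) ?_ ?_ ?_ ?_
        · intro x _; simp
        · intro x _ y _ h; exact Units.ext h
        · intro x hx; simp at hx; exact ⟨Units.mk0 x hx, by simp, rfl⟩
        · intro x _; rw [mul_comm]
      rw [h3] at h2
      push_cast at h2
      linear_combination h2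
    rw [h1]; simp; linarith
  · have := weil_prime ψ hψ1 a b ha hb0
    have h2 : (2 * Real.sqrt p) ^ 2 = 4 * p := by rw [mul_pow, Real.sq_sqrt (by positivity)]; norm_num
    rw [← h2] at this
    have := le_of_pow_le_pow_left₀ two_ne_zero (by positivity) this
    exact this.trans (by push_cast; linarith)

lemma KlB_prime_pow (p k : ℕ) (hp : p.Prime) (hk : 2 ≤ k) : KlB (p ^ k) := by
  intro _
  refine ⟨1, p ^ (k / 2), p ^ (k % 2), ?_, ?_, ?_⟩
  · rw [one_mul, ← pow_mul, ← pow_add]; congr 1; omega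
  · apply pow_dvd_pow; omega
  intro ψ hψ a b
  refine (kl_trivial _ ψ a b).trans ?_
  have h1 : (1:ℝ) ≤ ((p ^ k).divisors.card : ℕ) := by
    exact_mod_cast Finset.card_pos.mpr (Nat.nonempty_divisors.mpr (pow_ne_zero _ hp.ne_zero))
  have h2 : (1:ℝ) ≤ (Nat.gcd b (p ^ k) : ℕ) := by
    exact_mod_cast Nat.gcd_pos_of_pos_right _ (pow_pos hp.pos _)
  have h3 : Real.sqrt (p ^ k : ℕ) * ((p ^ (k / 2) : ℕ) * Real.sqrt (p ^ (k % 2) : ℕ)) = (p ^ k : ℕ) := by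
    have : ((p ^ (k / 2) : ℕ) : ℝ) = Real.sqrt ((p ^ (k / 2) : ℕ) ^ 2) := by rw [Real.sqrt_sq (by positivity)]
    rw [this, ← Real.sqrt_mul (by positivity)]
    have : (((p ^ (k / 2) : ℕ) : ℝ) ^ 2 * (p ^ (k % 2) : ℕ)) = (p ^ k : ℕ) := by
      push_cast
      rw [← pow_mul, ← pow_add]; congr 1; omega
    rw [this, Real.mul_self_sqrt (by positivity)]
  rw [mul_assoc (_ * _), h3]
  have : (1:ℝ) ≤ ((p ^ k).divisors.card : ℕ) * (Nat.gcd b (p ^ k) : ℕ) := by nlinarith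
  exact le_mul_of_one_le_left (by positivity) this

lemma KlB_mul (m n : ℕ) (hm : KlB m) (hn : KlB n) (hmn : m.Coprime n) : KlB (m * n) := by
  intro hne
  haveI : NeZero m := ⟨fun h => hne.out (by simp [h])⟩
  haveI : NeZero n := ⟨fun h => hne.out (by simp [h])⟩
  obtain ⟨s1, u1, v1, e1, d1, B1⟩ := hm inferInstance
  obtain ⟨s2, u2, v2, e2, d2, B2⟩ := hn inferInstance
  refine ⟨s1 * s2, u1 * u2, v1 * v2, ?_, mul_dvd_mul d1 d2, ?_⟩
  · conv_lhs => rw [e1, e2]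
    ring
  intro ψ hψ a b
  let e := ZMod.chineseRemainder hmn
  let ψ1 : AddChar (ZMod m) ℂ :=
    { toFun := fun x => ψ (e.symm (x, 0))
      map_zero_eq_one' := by rw [← Prod.zero_eq_mk, map_zero, AddChar.map_zero_eq_one]
      map_add_eq_mul' := fun x y => by
        rw [← AddChar.map_add_eq_mul, ← map_add]; simp }
  let ψ2 : AddChar (ZMod n) ℂ :=
    { toFun := fun x => ψ (e.symm (0, x))
      map_zero_eq_one' := by rw [← Prod.zero_eq_mk, map_zero, AddChar.map_zero_eq_one]
      map_add_eq_mul' := fun x y => by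
        rw [← AddChar.map_add_eq_mul, ← map_add]; simp }
  have hψ12 : ∀ z : ZMod m × ZMod n, ψ (e.symm z) = ψ1 z.1 * ψ2 z.2 := by
    intro z
    change _ = ψ (e.symm _) * ψ (e.symm _)
    rw [← AddChar.map_add_eq_mul, ← map_add]; simp
  have hp1 : ψ1.IsPrimitive := by
    intro x hx
    have h0 : e.symm (x, 0) ≠ 0 := by
      rw [Ne, EmbeddingLike.map_eq_zero_iff]; simpa using hx
    have := hψ h0
    rw [AddChar.ne_one_iff] at this ⊢
    obtain ⟨z, hz⟩ := this
    refine ⟨(e z).1, ?_⟩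
    rw [AddChar.mulShift_apply] at hz ⊢
    change ψ (e.symm (x * (e z).1, 0)) ≠ 1
    have : e.symm (x * (e z).1, 0) = e.symm (x, 0) * z := by
      apply e.injective; rw [map_mul]; simp [Prod.ext_iff]
    rwa [this]
  have hp2 : ψ2.IsPrimitive := by
    intro x hx
    have h0 : e.symm (0, x) ≠ 0 := by
      rw [Ne, EmbeddingLike.map_eq_zero_iff]; simpa using hx
    have := hψ h0
    rw [AddChar.ne_one_iff] at this ⊢
    obtain ⟨z, hz⟩ := this
    refine ⟨(e z).2, ?_⟩
    rw [AddChar.mulShift_apply] at hz ⊢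
    change ψ (e.symm (0, x * (e z).2)) ≠ 1
    have : e.symm (0, x * (e z).2) = e.symm (0, x) * z := by
      apply e.injective; rw [map_mul]; simp [Prod.ext_iff]
    rwa [this]
  let eu : (ZMod (m * n))ˣ ≃* (ZMod m)ˣ × (ZMod n)ˣ := (Units.mapEquiv e.toMulEquiv).trans MulEquiv.prodUnits
  have hsum : ∑ x : (ZMod (m * n))ˣ, ψ (a * x + b * (x⁻¹ : (ZMod (m * n))ˣ)) =
      (∑ x : (ZMod m)ˣ, ψ1 ((e a).1 * x + b * (x⁻¹ : (ZMod m)ˣ))) *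
      (∑ x : (ZMod n)ˣ, ψ2 ((e a).2 * x + b * (x⁻¹ : (ZMod n)ˣ))) := by
    rw [Finset.sum_mul_sum, ← Fintype.sum_prod_type']
    rw [← Equiv.sum_comp eu.toEquiv]
    apply Finset.sum_congr rfl
    intro x _
    have h1 := hψ12 (e (a * x + b * (x⁻¹ : (ZMod (m * n))ˣ)))
    rw [RingEquiv.symm_apply_apply] at h1
    rw [h1]
    simp only [map_add, map_mul, map_natCast, Prod.fst_add, Prod.fst_mul, Prod.snd_add, Prod.snd_mul, Prod.fst_natCast, Prod.snd_natCast]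
    rfl
  rw [hsum, norm_mul]
  refine (mul_le_mul (B1 ψ1 hp1 _ b) (B2 ψ2 hp2 _ b) (norm_nonneg _) ((norm_nonneg _).trans (B1 ψ1 hp1 (e a).1 b))).trans (le_of_eq ?_)
  rw [Nat.Coprime.card_divisors_mul hmn, Nat.Coprime.gcd_mul b hmn]
  push_cast
  rw [Real.sqrt_mul (by positivity), Real.sqrt_mul (by positivity)]
  ring

theorem KlB_all (q : ℕ) : KlB q := by
  induction q using Nat.recOnPosPrimePosCoprime with
  | zero => intro h; exact absurd rfl h.out
  | one =>
    intro _
    refine ⟨1, 1, 1, by simp, by simp, ?_⟩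
    intro ψ hψ a b
    refine (kl_trivial 1 ψ a b).trans ?_
    simp
  | prime_pow p n hp hn =>
    rcases Nat.lt_or_ge n 2 with h | h
    · have : n = 1 := by omega
      subst this; rw [pow_one]; exact KlB_prime p hp
    · exact KlB_prime_pow p n hp h
  | coprime a b ha hb hab h1 h2 => exact KlB_mul a b h1 h2 hab

section Sec8
open ZMod

lemma zsum_range {M : Type*} [AddCommMonoid M] (q : ℕ) [hq : NeZero q] (f : ZMod q → M) :
    ∑ x, f x = ∑ n ∈ Finset.range q, f n := by
  symm
  refine Finset.sum_bij' (fun n _ => (n : ZMod q)) (fun x _ => x.val) ?_ ?_ ?_ ?_ ?_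
  · simp
  · intro x _; simp [ZMod.val_lt]
  · intro n hn; simp at hn; exact ZMod.val_cast_of_lt hn
  · intro x _; simp
  · intros; rfl

/-- weight -/
noncomputable def wt {q : ℕ} (c : ZMod q) : ℝ := 1 / c.val + 1 / (q - c.val)

lemma wt_neg {q : ℕ} [NeZero q] (c : ZMod q) : wt (-c) = wt c := by
  by_cases hc : c = 0
  · simp [hc]
  · haveI : NeZero c := ⟨hc⟩
    have h := ZMod.val_neg_of_ne_zero c
    have hl := ZMod.val_lt c
    rw [wt, wt, h, Nat.cast_sub hl.le]
    ring

lemma wt_nonneg {q : ℕ} [NeZero q] (c : ZMod q) : 0 ≤ wt c := by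
  have : (c.val : ℝ) < q := by exact_mod_cast ZMod.val_lt c
  rw [wt]
  have : (0:ℝ) < q - c.val := by linarith
  positivity

lemma std_sub_one {q : ℕ} [NeZero q] (c : ZMod q) (hc : c ≠ 0) :
    stdAddChar c ≠ 1 ∧ 1 / ‖stdAddChar c - 1‖ ≤ q / 4 * wt c := by
  have hq : (0:ℝ) < q := by exact_mod_cast NeZero.pos q
  have hv : (c.val : ℝ) < q := by exact_mod_cast ZMod.val_lt c
  have hv0 : (0:ℝ) < c.val := by
    have : c.val ≠ 0 := by rwa [Ne, ZMod.val_eq_zero]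
    exact_mod_cast Nat.pos_of_ne_zero this
  have h1 : ‖stdAddChar c - 1‖ = 2 * |Real.sin (Real.pi * c.val / q)| := by
    rw [stdAddChar_apply, toCircle_apply]
    have : (2 * (Real.pi : ℂ) * Complex.I * c.val / q) = Complex.I * ((2 * Real.pi * c.val / q : ℝ) : ℂ) := by
      push_cast; ring
    rw [this, Complex.norm_exp_I_mul_ofReal_sub_one, norm_mul]
    simp only [Real.norm_eq_abs]
    rw [abs_two]; congr 3; ring
  have hpi := Real.pi_pos
  obtain ⟨t, ht⟩ : ∃ t : ℝ, t = (c.val : ℝ) := ⟨_, rfl⟩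
  rw [← ht] at hv hv0 h1
  have hd : 0 < (q:ℝ) - t := by linarith
  have key : ∃ mm : ℝ, 0 < mm ∧ (mm = t ∨ mm = q - t) ∧ 2 * mm / q ≤ Real.sin (Real.pi * t / q) := by
    rcases le_total (2 * t) q with h | h
    · refine ⟨t, hv0, Or.inl rfl, ?_⟩
      have := Real.mul_le_sin (x := Real.pi * t / q) (by positivity) (by
        rw [div_le_iff₀ hq]; nlinarith)
      refine le_trans (le_of_eq ?_) this
      field_simp
    · refine ⟨q - t, hd, Or.inr rfl, ?_⟩
      have := Real.mul_le_sin (x := Real.pi * (q - t) / q) (by positivity) (by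
        rw [div_le_iff₀ hq]; nlinarith)
      have h2 : Real.pi * (q - t) / q = Real.pi - Real.pi * t / q := by field_simp
      rw [h2, Real.sin_pi_sub] at this
      refine le_trans (le_of_eq ?_) this
      rw [← h2]
      field_simp
  obtain ⟨mm, hm0, hmm, hs⟩ := key
  have hs0 : 0 < Real.sin (Real.pi * t / q) := lt_of_lt_of_le (by positivity) hs
  rw [abs_of_pos hs0] at h1
  have hn : 0 < ‖stdAddChar c - 1‖ := by rw [h1]; positivity
  refine ⟨fun h => by rw [h] at hn; simp at hn, ?_⟩
  have h3 : 4 * mm / q ≤ ‖stdAddChar c - 1‖ := by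
    rw [h1]; calc 4 * mm / q = 2 * (2 * mm / q) := by ring
      _ ≤ _ := by linarith
  have h4 : 1 / ‖stdAddChar c - 1‖ ≤ 1 / (4 * mm / q) := one_div_le_one_div_of_le (by positivity) h3
  refine h4.trans ?_
  have h5 : 1 / mm ≤ wt c := by
    rw [wt, ← ht]
    rcases hmm with h | h
    · rw [h]; have := one_div_pos.mpr hd; linarith
    · rw [h]; have := one_div_pos.mpr hv0; linarith
  calc 1 / (4 * mm / q) = q / 4 * (1 / mm) := by field_simp
    _ ≤ _ := by gcongr

lemma std_pow {q : ℕ} [NeZero q] (n : ℕ) (k : ZMod q) : stdAddChar (-((n : ZMod q) * k)) = stdAddChar (-k) ^ n := by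
  rw [← AddChar.map_nsmul_eq_pow]; congr 1; rw [nsmul_eq_mul]; ring

lemma std_pow_q {q : ℕ} [NeZero q] (k : ZMod q) : stdAddChar k ^ q = 1 := by
  rw [← AddChar.map_nsmul_eq_pow, nsmul_eq_mul]; simp

lemma dft_I {q : ℕ} [NeZero q] (x0 : ℕ) (k : ZMod q) (hk : k ≠ 0) :
    ‖𝓕 (fun x : ZMod q => if x0 ≤ x.val then (1:ℂ) else 0) k‖ ≤ q / 2 * wt k := by
  obtain ⟨h1, h2⟩ := std_sub_one (-k) (neg_ne_zero.mpr hk)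
  rw [wt_neg] at h2
  rw [dft_apply, zsum_range]
  set z := stdAddChar (-k) with hz
  have hznorm : ‖z‖ = 1 := by rw [hz, AddChar.norm_apply]
  have h3 : ∑ n ∈ Finset.range q, stdAddChar (-((n : ZMod q) * k)) • (if x0 ≤ (n : ZMod q).val then (1:ℂ) else 0)
      = ∑ n ∈ Finset.range q, (if x0 ≤ n then z ^ n else 0) := by
    apply Finset.sum_congr rfl
    intro n hn
    rw [ZMod.val_cast_of_lt (Finset.mem_range.mp hn), std_pow, ← hz]
    split_ifs <;> simp
  rw [h3]
  have h4 : ∑ n ∈ Finset.range q, (if x0 ≤ n then z ^ n else 0) = (1 - z ^ (min x0 q)) / (z - 1) := by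
    have e1 : ∑ n ∈ Finset.range q, (if x0 ≤ n then z ^ n else 0) + ∑ n ∈ Finset.range q, (if x0 ≤ n then 0 else z ^ n) = ∑ n ∈ Finset.range q, z ^ n := by
      rw [← Finset.sum_add_distrib]; apply Finset.sum_congr rfl; intro n _; split_ifs <;> simp
    have e2 : ∑ n ∈ Finset.range q, (if x0 ≤ n then 0 else z ^ n) = ∑ n ∈ Finset.range (min x0 q), z ^ n := by
      have e5 : ∀ n ∈ Finset.range q, (if x0 ≤ n then 0 else z ^ n) = (if n < x0 then z ^ n else 0) := by
        intro n _
        by_cases h : x0 ≤ n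
        · simp [h, not_lt.mpr h]
        · simp [h, not_le.mp h]
      rw [Finset.sum_congr rfl e5, ← Finset.sum_filter]
      apply Finset.sum_congr _ (fun _ _ => rfl)
      ext n; simp; omega
    have e3 := geom_sum_eq h1 q
    have e4 := geom_sum_eq h1 (min x0 q)
    rw [std_pow_q, sub_self, zero_div] at e3
    rw [e2, e4, e3] at e1
    rw [eq_neg_of_add_eq_zero_left e1, ← neg_div, neg_sub]
  rw [h4, norm_div]
  have h5 : ‖1 - z ^ (min x0 q)‖ ≤ 2 := by
    refine (norm_sub_le _ _).trans ?_
    rw [norm_pow, hznorm, one_pow, norm_one]; norm_num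
  calc ‖1 - z ^ (min x0 q)‖ / ‖z - 1‖ ≤ 2 / ‖z - 1‖ := by gcongr
    _ = 2 * (1 / ‖z - 1‖) := by ring
    _ ≤ 2 * (q / 4 * wt k) := by gcongr
    _ = _ := by ring

/-- sawtooth -/
noncomputable def Bs {q : ℕ} (n : ZMod q) : ℝ := (n.val : ℝ) / q - (q - 1) / (2 * q)

lemma sum_mul_pow (z : ℂ) (n : ℕ) : (z - 1) * ∑ i ∈ Finset.range n, (i : ℂ) * z ^ i = n * z ^ n - z * ∑ i ∈ Finset.range n, z ^ i := by
  induction n with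
  | zero => simp
  | succ n ih =>
    rw [Finset.sum_range_succ, mul_add, ih, Finset.sum_range_succ]
    push_cast; ring

lemma dft_B {q : ℕ} [NeZero q] (k : ZMod q) (hk : k ≠ 0) :
    ‖𝓕 (fun x : ZMod q => ((Bs x : ℝ) : ℂ)) k‖ ≤ q / 4 * wt k := by
  obtain ⟨h1, h2⟩ := std_sub_one (-k) (neg_ne_zero.mpr hk)
  have hq : (q:ℂ) ≠ 0 := by exact_mod_cast NeZero.ne q
  rw [wt_neg] at h2
  rw [dft_apply, zsum_range]
  set z := stdAddChar (-k) with hz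
  have e3 := geom_sum_eq h1 q
  rw [std_pow_q, sub_self, zero_div] at e3
  have h3 : ∑ n ∈ Finset.range q, stdAddChar (-((n : ZMod q) * k)) • ((Bs (n : ZMod q) : ℝ) : ℂ)
      = 1 / q * ∑ n ∈ Finset.range q, (n : ℂ) * z ^ n - (q - 1) / (2 * q) * ∑ n ∈ Finset.range q, z ^ n := by
    rw [Finset.mul_sum, Finset.mul_sum, ← Finset.sum_sub_distrib]
    apply Finset.sum_congr rfl
    intro n hn
    rw [Bs, ZMod.val_cast_of_lt (Finset.mem_range.mp hn), std_pow, ← hz]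
    push_cast
    rw [smul_eq_mul]
    ring
  have h4 := sum_mul_pow z q
  rw [e3, std_pow_q, mul_zero, sub_zero, mul_one] at h4
  have h5 : ∑ n ∈ Finset.range q, (n : ℂ) * z ^ n = q / (z - 1) := by
    rw [eq_div_iff (sub_ne_zero.mpr h1), ← h4]; ring
  rw [h3, e3, h5, mul_zero, sub_zero]
  have : 1 / (q:ℂ) * (q / (z - 1)) = 1 / (z - 1) := by field_simp
  rw [this, norm_div, norm_one]
  exact h2

lemma dft_B_zero {q : ℕ} [NeZero q] :
    𝓕 (fun x : ZMod q => ((Bs x : ℝ) : ℂ)) 0 = 0 := by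
  have hq : (q:ℂ) ≠ 0 := by exact_mod_cast NeZero.ne q
  rw [dft_apply, zsum_range]
  have h3 : ∑ n ∈ Finset.range q, stdAddChar (-((n : ZMod q) * 0)) • ((Bs (n : ZMod q) : ℝ) : ℂ)
      = 1 / q * ∑ n ∈ Finset.range q, (n : ℂ) - q * ((q - 1) / (2 * q)) := by
    rw [Finset.mul_sum]
    have : (q : ℂ) * ((q - 1) / (2 * q)) = ∑ n ∈ Finset.range q, ((q - 1) / (2 * q) : ℂ) := by simp
    rw [this, ← Finset.sum_sub_distrib]
    apply Finset.sum_congr rfl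
    intro n hn
    rw [Bs, ZMod.val_cast_of_lt (Finset.mem_range.mp hn)]
    push_cast
    simp
    ring
  rw [h3]
  have h4 : (∑ n ∈ Finset.range q, (n : ℂ)) = q * (q - 1) / 2 := by
    have h := Finset.sum_range_id_mul_two q
    have h' : ((∑ n ∈ Finset.range q, n : ℕ) : ℂ) * 2 = q * (q - 1 : ℕ) := by exact_mod_cast h
    rw [Nat.cast_sub (NeZero.pos q)] at h'
    push_cast at h'
    linear_combination h' / 2
  rw [h4]; field_simp; ring

lemma dft_I_zero {q : ℕ} [NeZero q] (x0 : ℕ) :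
    ‖𝓕 (fun x : ZMod q => if x0 ≤ x.val then (1:ℂ) else 0) 0‖ ≤ q := by
  rw [dft_apply]
  refine (norm_sum_le _ _).trans ?_
  have : (q : ℝ) = ∑ x : ZMod q, (1:ℝ) := by simp [ZMod.card]
  rw [this]
  apply Finset.sum_le_sum
  intro x _
  rw [norm_smul, AddChar.norm_apply]
  split_ifs <;> simp

lemma fourier_inv {q : ℕ} [NeZero q] (f : ZMod q → ℂ) (x : ZMod q) :
    f x = (q : ℂ)⁻¹ * ∑ j, stdAddChar (j * x) * 𝓕 f j := by
  have h := invDFT_apply (𝓕 f) x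
  rw [LinearEquiv.symm_apply_apply] at h
  rw [h]; simp [smul_eq_mul]

lemma fourier_kl {q : ℕ} [NeZero q] (f g : ZMod q → ℂ) (Z κ : ZMod q) (K : ℝ)
    (hK : ∀ (a : ZMod q) (b : ℕ), ‖∑ x : (ZMod q)ˣ, stdAddChar (a * (x : ZMod q) + (b : ZMod q) * ((x⁻¹ : (ZMod q)ˣ) : ZMod q))‖ ≤ K * Nat.gcd b q) :
    ‖∑ x : (ZMod q)ˣ, f x * g (Z + κ * x + (x⁻¹ : (ZMod q)ˣ))‖ ≤
      K * ((∑ a, ‖𝓕 f a‖) / q) * ((∑ b, ‖𝓕 g b‖ * Nat.gcd b.val q) / q) := by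
  have h1 : ∑ x : (ZMod q)ˣ, f x * g (Z + κ * x + (x⁻¹ : (ZMod q)ˣ)) =
      (q:ℂ)⁻¹ * (q:ℂ)⁻¹ * ∑ a, ∑ b, 𝓕 f a * 𝓕 g b * stdAddChar (b * Z) *
        ∑ x : (ZMod q)ˣ, stdAddChar ((a + b * κ) * (x : ZMod q) + ((b.val : ℕ) : ZMod q) * ((x⁻¹ : (ZMod q)ˣ) : ZMod q)) := by
    have : ∀ x : (ZMod q)ˣ, f x * g (Z + κ * x + (x⁻¹ : (ZMod q)ˣ)) = (q:ℂ)⁻¹ * (q:ℂ)⁻¹ * ∑ a, ∑ b, 𝓕 f a * 𝓕 g b * stdAddChar (b * Z) *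
        stdAddChar ((a + b * κ) * (x : ZMod q) + ((b.val : ℕ) : ZMod q) * ((x⁻¹ : (ZMod q)ˣ) : ZMod q)) := by
      intro x
      rw [fourier_inv f x, fourier_inv g, mul_mul_mul_comm, Finset.sum_mul_sum]
      congr 1
      apply Finset.sum_congr rfl; intro a _
      apply Finset.sum_congr rfl; intro b _
      have : stdAddChar (a * (x : ZMod q)) * stdAddChar (b * (Z + κ * (x : ZMod q) + ((x⁻¹ : (ZMod q)ˣ) : ZMod q))) = stdAddChar (b * Z) *
        stdAddChar ((a + b * κ) * (x : ZMod q) + ((b.val : ℕ) : ZMod q) * ((x⁻¹ : (ZMod q)ˣ) : ZMod q)) := by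
        rw [← AddChar.map_add_eq_mul, ← AddChar.map_add_eq_mul]
        congr 1
        rw [ZMod.natCast_zmod_val]; ring
      linear_combination 𝓕 f a * 𝓕 g b * this
    rw [Finset.sum_congr rfl (fun x _ => this x), ← Finset.mul_sum]
    congr 1
    rw [Finset.sum_comm]
    apply Finset.sum_congr rfl; intro a _
    rw [Finset.sum_comm]
    apply Finset.sum_congr rfl; intro b _
    rw [Finset.mul_sum]
  rw [h1, norm_mul]
  have h2 : ‖∑ a, ∑ b, 𝓕 f a * 𝓕 g b * stdAddChar (b * Z) *
        ∑ x : (ZMod q)ˣ, stdAddChar ((a + b * κ) * (x : ZMod q) + ((b.val : ℕ) : ZMod q) * ((x⁻¹ : (ZMod q)ˣ) : ZMod q))‖ ≤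
      ∑ a, ∑ b, ‖𝓕 f a‖ * (K * (‖𝓕 g b‖ * Nat.gcd b.val q)) := by
    refine (norm_sum_le _ _).trans (Finset.sum_le_sum fun a _ => ?_)
    refine (norm_sum_le _ _).trans (Finset.sum_le_sum fun b _ => ?_)
    rw [norm_mul, norm_mul, norm_mul, AddChar.norm_apply, mul_one]
    calc _ ≤ ‖𝓕 f a‖ * ‖𝓕 g b‖ * (K * Nat.gcd b.val q) := by gcongr; exact hK _ _
      _ = _ := by ring
  have h3 : ∑ a, ∑ b, ‖𝓕 f a‖ * (K * (‖𝓕 g b‖ * Nat.gcd b.val q)) = (∑ a, ‖𝓕 f a‖) * (K * ∑ b, ‖𝓕 g b‖ * Nat.gcd b.val q) := by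
    rw [Finset.mul_sum, Finset.sum_mul_sum]
  rw [h3] at h2
  have h4 : ‖(q:ℂ)⁻¹ * (q:ℂ)⁻¹‖ = (q:ℝ)⁻¹ * (q:ℝ)⁻¹ := by simp
  rw [h4]
  calc _ ≤ (q:ℝ)⁻¹ * (q:ℝ)⁻¹ * ((∑ a, ‖𝓕 f a‖) * (K * ∑ b, ‖𝓕 g b‖ * Nat.gcd b.val q)) := by gcongr
    _ = _ := by ring
end Sec8

section Sec9
open ZMod

lemma wt_sum_gen {q : ℕ} [NeZero q] (g : ℕ → ℝ) (hg : ∀ n ∈ Finset.Ico 1 q, g (q - n) = g n) :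
    ∑ b : ZMod q, (if b = 0 then 0 else wt b * g b.val) = 2 * ∑ n ∈ Finset.Ico 1 q, g n / n := by
  rw [zsum_range]
  have hq : 1 ≤ q := NeZero.pos q
  have h1 : ∑ n ∈ Finset.range q, (if (n : ZMod q) = 0 then 0 else wt (n : ZMod q) * g (n : ZMod q).val)
      = ∑ n ∈ Finset.Ico 1 q, (g n / n + g n / ((q - n : ℕ) : ℝ)) := by
    rw [Finset.range_eq_Ico, Finset.sum_eq_sum_Ico_succ_bot (by omega)]
    simp only [Nat.cast_zero, if_true, zero_add]
    apply Finset.sum_congr rfl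
    intro n hn
    rw [Finset.mem_Ico] at hn
    have hv : (n : ZMod q).val = n := ZMod.val_cast_of_lt hn.2
    have : (n : ZMod q) ≠ 0 := by
      intro h; rw [h] at hv; simp at hv; omega
    rw [if_neg this, wt, hv, Nat.cast_sub hn.2.le]
    ring
  rw [h1, Finset.sum_add_distrib, two_mul]
  congr 1
  refine Finset.sum_bij' (fun n _ => q - n) (fun n _ => q - n) ?_ ?_ ?_ ?_ ?_
  · intro n hn; rw [Finset.mem_Ico] at *; omega
  · intro n hn; rw [Finset.mem_Ico] at *; omega
  · intro n hn; rw [Finset.mem_Ico] at *; omega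
  · intro n hn; rw [Finset.mem_Ico] at *; omega
  · intro n hn; rw [hg n hn]

lemma inv_sum_le (q : ℕ) (hq : 1 ≤ q) : ∑ n ∈ Finset.Ico 1 q, (1:ℝ) / n ≤ 1 + Real.log q := by
  have h := harmonic_le_one_add_log q
  refine le_trans ?_ h
  rw [harmonic_eq_sum_Icc]
  push_cast
  simp only [one_div]
  apply Finset.sum_le_sum_of_subset_of_nonneg
  · intro n hn; simp at *; omega
  · intros; positivity

lemma gcd_sum_le (q : ℕ) (hq : 1 ≤ q) : ∑ n ∈ Finset.Ico 1 q, (Nat.gcd n q : ℝ) / n ≤ q.divisors.card * (1 + Real.log q) := by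
  have h1 : ∀ n ∈ Finset.Ico 1 q, (Nat.gcd n q : ℝ) / n ≤ ∑ d ∈ q.divisors, if d ∣ n then (d:ℝ) / n else 0 := by
    intro n hn
    have := Finset.single_le_sum (s := q.divisors) (f := fun d => if d ∣ n then (d:ℝ) / n else 0) (a := Nat.gcd n q)
      (by intro i _; split_ifs <;> positivity) (by rw [Nat.mem_divisors]; exact ⟨Nat.gcd_dvd_right _ _, by omega⟩)
    rwa [if_pos (Nat.gcd_dvd_left _ _)] at this
  refine (Finset.sum_le_sum h1).trans ?_
  rw [Finset.sum_comm, ← nsmul_eq_mul]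
  apply Finset.sum_le_card_nsmul
  intro d hd
  have hd0 : 0 < d := Nat.pos_of_mem_divisors hd
  rw [← Finset.sum_filter]
  have hsub : (Finset.Ico 1 q).filter (fun n => d ∣ n) ⊆ (Finset.Ico 1 q).image (fun m => d * m) := by
    intro n hn
    simp only [Finset.mem_filter, Finset.mem_Ico, Finset.mem_image] at *
    obtain ⟨⟨a, b⟩, m, rfl⟩ := hn
    refine ⟨m, ⟨?_, ?_⟩, rfl⟩
    · rcases Nat.eq_zero_or_pos m with h | h
      · subst h; simp at a
      · exact h
    · nlinarith
  refine (Finset.sum_le_sum_of_subset_of_nonneg hsub (by intros; positivity)).trans ?_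
  rw [Finset.sum_image (by intro a _ b _ h; exact Nat.eq_of_mul_eq_mul_left hd0 h)]
  refine le_trans (le_of_eq ?_) (inv_sum_le q hq)
  apply Finset.sum_congr rfl
  intro m hm
  have : (d:ℝ) ≠ 0 := by positivity
  push_cast
  rw [div_mul_eq_div_div, div_self this]

theorem per_q (q : ℕ) (hq : NeZero q) : ∃ s u v : ℕ, q = s * u ^ 2 * v ∧ v ∣ u ∧ ∀ (x0 : ℕ) (Z κ : ZMod q),
    |∑ x : (ZMod q)ˣ, if x0 ≤ (x : ZMod q).val then Bs (Z + κ * (x : ZMod q) + ((x⁻¹ : (ZMod q)ˣ) : ZMod q)) else 0| ≤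
     (q.divisors.card : ℝ) ^ 2 * Real.sqrt q * (u * Real.sqrt v) * (2 + Real.log q) ^ 2 := by
  obtain ⟨s, u, v, h1, h2, h3⟩ := KlB_all q hq
  refine ⟨s, u, v, h1, h2, fun x0 Z κ => ?_⟩
  have hq1 : 1 ≤ q := NeZero.pos q
  have hq0 : (0:ℝ) < q := by exact_mod_cast hq1
  have hlog : 0 ≤ Real.log q := Real.log_natCast_nonneg q
  have hf := fourier_kl (fun x : ZMod q => if x0 ≤ x.val then (1:ℂ) else 0) (fun x => ((Bs x : ℝ) : ℂ)) Z κ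
    (q.divisors.card * Real.sqrt q * (u * Real.sqrt v)) (by
      intro a b
      refine (h3 stdAddChar (isPrimitive_stdAddChar q) a b).trans (le_of_eq (by ring)))
  have e1 : ‖∑ x : (ZMod q)ˣ, (if x0 ≤ (x : ZMod q).val then (1:ℂ) else 0) * ((Bs (Z + κ * (x : ZMod q) + ((x⁻¹ : (ZMod q)ˣ) : ZMod q)) : ℝ) : ℂ)‖
      = |∑ x : (ZMod q)ˣ, if x0 ≤ (x : ZMod q).val then Bs (Z + κ * (x : ZMod q) + ((x⁻¹ : (ZMod q)ˣ) : ZMod q)) else 0| := by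
    rw [← Real.norm_eq_abs, ← Complex.norm_real]
    congr 1
    push_cast
    apply Finset.sum_congr rfl
    intro x _
    split_ifs <;> simp
  rw [e1] at hf
  refine hf.trans ?_
  have i1 : (∑ a, ‖𝓕 (fun x : ZMod q => if x0 ≤ x.val then (1:ℂ) else 0) a‖) / q ≤ 2 + Real.log q := by
    rw [div_le_iff₀ hq0]
    have : ∀ a : ZMod q, ‖𝓕 (fun x : ZMod q => if x0 ≤ x.val then (1:ℂ) else 0) a‖ ≤ (if a = 0 then (q:ℝ) else 0) + q / 2 * (if a = 0 then 0 else wt a * (1:ℝ)) := by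
      intro a
      by_cases h : a = 0
      · subst h; simpa using dft_I_zero x0
      · simpa [h] using dft_I x0 a h
    refine (Finset.sum_le_sum (fun a _ => this a)).trans ?_
    rw [Finset.sum_add_distrib, ← Finset.mul_sum, wt_sum_gen (fun _ => 1) (by simp)]
    simp only [Finset.sum_ite_eq', Finset.mem_univ, if_true]
    have := inv_sum_le q hq1
    nlinarith
  have i2 : (∑ b, ‖𝓕 (fun x : ZMod q => ((Bs x : ℝ) : ℂ)) b‖ * Nat.gcd b.val q) / q ≤ q.divisors.card * (2 + Real.log q) := by
    rw [div_le_iff₀ hq0]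
    have : ∀ a : ZMod q, ‖𝓕 (fun x : ZMod q => ((Bs x : ℝ) : ℂ)) a‖ * Nat.gcd a.val q ≤ q / 4 * (if a = 0 then 0 else wt a * (Nat.gcd a.val q : ℝ)) := by
      intro a
      by_cases h : a = 0
      · subst h; simp [dft_B_zero]
      · rw [if_neg h, ← mul_assoc]
        gcongr
        exact dft_B a h
    refine (Finset.sum_le_sum (fun a _ => this a)).trans ?_
    rw [← Finset.mul_sum, wt_sum_gen (fun n => (Nat.gcd n q : ℝ)) (by
      intro n hn
      rw [Finset.mem_Ico] at hn
      rw [Nat.gcd_self_sub_left hn.2.le])]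
    have := gcd_sum_le q hq1
    have hp : 0 ≤ (q.divisors.card : ℝ) := by positivity
    have : q / 4 * (2 * ∑ n ∈ Finset.Ico 1 q, (Nat.gcd n q : ℝ) / n) ≤ q / 4 * (2 * (q.divisors.card * (1 + Real.log q))) := by gcongr
    refine this.trans ?_
    have : 0 ≤ (q.divisors.card : ℝ) * q := by positivity
    have : 0 ≤ (q.divisors.card : ℝ) * q * Real.log q := by positivity
    nlinarith
  calc _ ≤ (q.divisors.card * Real.sqrt q * (u * Real.sqrt v)) * (2 + Real.log q) * (q.divisors.card * (2 + Real.log q)) := by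
        gcongr
    _ = _ := by ring
end Sec9

lemma units_sum {q : ℕ} [NeZero q] (f : ℕ → ℝ) :
    ∑ x : (ZMod q)ˣ, f (x : ZMod q).val = ∑ x ∈ Finset.range q, if Nat.Coprime x q then f x else 0 := by
  apply Finset.sum_of_injOn (fun x : (ZMod q)ˣ => (x : ZMod q).val)
  · intro a _ b _ h
    exact Units.ext (ZMod.val_injective q h)
  · intro a _; simp [ZMod.val_lt]
  · intro n hn hnot
    rw [if_neg]
    intro hc
    apply hnot
    refine ⟨ZMod.unitOfCoprime n hc, by simp, ?_⟩
    simp only [ZMod.coe_unitOfCoprime]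
    exact ZMod.val_cast_of_lt (Finset.mem_range.mp hn)
  · intro x _
    have := ZMod.val_coe_unit_coprime x
    simp [this]

lemma val_sub_one {q : ℕ} [NeZero q] (m : ZMod q) :
    ((m - 1).val : ℝ) = m.val - 1 + if m = 0 then (q:ℝ) else 0 := by
  have hq : 1 ≤ q := NeZero.pos q
  split_ifs with h
  · subst h
    rcases Nat.exists_eq_succ_of_ne_zero (NeZero.ne q) with ⟨k, rfl⟩
    rw [zero_sub, ZMod.val_neg_one]; simp
  · have h0 : m.val ≠ 0 := by rwa [Ne, ZMod.val_eq_zero]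
    have hl := ZMod.val_lt m
    have : m - 1 = ((m.val - 1 : ℕ) : ZMod q) := by
      rw [Nat.cast_sub (by omega)]; simp
    rw [this, ZMod.val_cast_of_lt (by omega), Nat.cast_sub (by omega)]; simp

lemma Bs_refl {q : ℕ} [NeZero q] (m : ZMod q) : Bs (-m - 1) = - Bs m := by
  have hq : (0:ℝ) < q := by exact_mod_cast NeZero.pos q
  have h : ((-m - 1).val : ℝ) = q - 1 - m.val := by
    rw [val_sub_one]
    by_cases h : m = 0
    · subst h; simp; ring
    · haveI : NeZero m := ⟨h⟩
      have hl := ZMod.val_lt m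
      rw [if_neg (neg_ne_zero.mpr h), ZMod.val_neg_of_ne_zero, Nat.cast_sub hl.le]; ring
  rw [Bs, Bs, h]; field_simp; ring

lemma count_ap {q : ℕ} [NeZero q] (c : ZMod q) (Y n : ℕ) :
    (((Finset.Ico Y (Y + n)).filter (fun y : ℕ => (y : ZMod q) = c)).card : ℝ) = n / q + Bs (c - (Y : ZMod q) - (n : ZMod q)) - Bs (c - (Y : ZMod q)) := by
  have hq : (0:ℝ) < q := by exact_mod_cast NeZero.pos q
  induction n with
  | zero => simp
  | succ n ih =>
    rw [← add_assoc, ← Finset.insert_Ico_right_eq_Ico_add_one (by omega), Finset.filter_insert]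
    have h2 : c - Y - ((n + 1 : ℕ) : ZMod q) = (c - Y - n) - 1 := by push_cast; ring
    have h3 := val_sub_one (c - (Y : ZMod q) - (n : ZMod q))
    rw [h2]
    have h4 : Bs (c - (Y : ZMod q) - (n : ZMod q) - 1) = Bs (c - (Y : ZMod q) - (n : ZMod q)) - 1 / q + if c - (Y : ZMod q) - (n : ZMod q) = 0 then 1 else 0 := by
      rw [Bs, Bs, h3]; split_ifs <;> field_simp <;> ring
    rw [h4]
    have h5 : ((Y + n : ℕ) : ZMod q) = c ↔ c - (Y : ZMod q) - (n : ZMod q) = 0 := by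
      push_cast
      constructor
      · intro h; rw [← h]; ring
      · intro h; linear_combination -h
    by_cases h : c - (Y : ZMod q) - (n : ZMod q) = 0
    · rw [if_pos (h5.mpr h), if_pos h, Finset.card_insert_of_notMem (by simp)]
      push_cast; rw [ih]; field_simp; ring
    · rw [if_neg (fun h' => h (h5.mp h')), if_neg h, ih]
      push_cast; field_simp; ring

/-- per-q count -/
def cnt (q Y W : ℕ) : ℕ := ∑ x ∈ Finset.range q, ((Finset.Ico Y (W + x + 1)).filter (fun y => q ∣ x * y + 1)).card

lemma cnt_units {q : ℕ} [NeZero q] (Y W : ℕ) : (cnt q Y W : ℝ) =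
    ∑ x : (ZMod q)ˣ, (((Finset.Ico Y (W + (x : ZMod q).val + 1)).filter (fun y : ℕ => (y : ZMod q) = -((x⁻¹ : (ZMod q)ˣ) : ZMod q))).card : ℝ) := by
  have h1 : (cnt q Y W : ℝ) = ∑ x ∈ Finset.range q, if Nat.Coprime x q then (((Finset.Ico Y (W + x + 1)).filter (fun y => q ∣ x * y + 1)).card : ℝ) else 0 := by
    rw [cnt]; push_cast
    apply Finset.sum_congr rfl
    intro x _
    split_ifs with h
    · rfl
    · rw [Nat.cast_eq_zero, Finset.card_eq_zero, Finset.filter_eq_empty_iff]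
      intro y _ hd
      apply h
      rw [Nat.coprime_iff_gcd_eq_one]
      have h1 := Nat.gcd_dvd_left x q
      have h2 := (Nat.gcd_dvd_right x q).trans hd
      have := (Nat.dvd_add_right (h1.mul_right y)).mp h2
      exact Nat.dvd_one.mp this
  rw [h1, ← units_sum]
  apply Finset.sum_congr rfl
  intro x _
  congr 2
  apply Finset.filter_congr
  intro y _
  rw [← ZMod.natCast_eq_zero_iff]
  push_cast
  rw [ZMod.natCast_zmod_val]
  constructor
  · intro h
    have := x.inv_mul
    linear_combination ((x⁻¹ : (ZMod q)ˣ) : ZMod q) * h - (y : ZMod q) * this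
  · intro h
    rw [h]; simp

lemma cnt_main (q : ℕ) [NeZero q] (Y W : ℕ) (E : ℝ) (hE : ∀ (x0 : ℕ) (Z κ : ZMod q),
    |∑ x : (ZMod q)ˣ, if x0 ≤ (x : ZMod q).val then Bs (Z + κ * (x : ZMod q) + ((x⁻¹ : (ZMod q)ˣ) : ZMod q)) else 0| ≤ E) :
    |(cnt q Y W : ℝ) - (∑ x ∈ Finset.range q, if Nat.Coprime x q then max ((W : ℝ) + x + 1 - Y) 0 / q else 0)| ≤ 2 * E := by
  rw [cnt_units, ← units_sum]
  set x0 := Y - (W + 1)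
  have h1 := hE x0 (W : ZMod q) 1
  have h2 := hE x0 ((Y : ZMod q) - 1) 0
  have key : ∀ x : (ZMod q)ˣ, (((Finset.Ico Y (W + (x : ZMod q).val + 1)).filter (fun y : ℕ => (y : ZMod q) = -((x⁻¹ : (ZMod q)ˣ) : ZMod q))).card : ℝ)
     = max ((W : ℝ) + (x : ZMod q).val + 1 - Y) 0 / q
      - (if x0 ≤ (x : ZMod q).val then Bs ((W : ZMod q) + 1 * (x : ZMod q) + ((x⁻¹ : (ZMod q)ˣ) : ZMod q)) else 0)
      + (if x0 ≤ (x : ZMod q).val then Bs ((Y : ZMod q) - 1 + 0 * (x : ZMod q) + ((x⁻¹ : (ZMod q)ˣ) : ZMod q)) else 0) := by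
    intro x
    split_ifs with h
    · obtain ⟨n, hn⟩ : ∃ n, W + (x : ZMod q).val + 1 = Y + n := ⟨W + (x : ZMod q).val + 1 - Y, by omega⟩
      rw [hn, count_ap]
      have hn' : (W : ℝ) + (x : ZMod q).val + 1 = Y + n := by exact_mod_cast hn
      have hz : (W : ZMod q) + x + 1 = Y + n := by
        have : ((W + (x : ZMod q).val + 1 : ℕ) : ZMod q) = ((Y + n : ℕ) : ZMod q) := by rw [hn]
        push_cast at this
        rwa [ZMod.natCast_zmod_val] at this
      rw [hn', add_sub_cancel_left, max_eq_left (by positivity)]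
      have e1 : -((x⁻¹ : (ZMod q)ˣ) : ZMod q) - Y - n = -((W : ZMod q) + 1 * (x : ZMod q) + ((x⁻¹ : (ZMod q)ˣ) : ZMod q)) - 1 := by
        linear_combination hz
      have e2 : -((x⁻¹ : (ZMod q)ˣ) : ZMod q) - Y = -((Y : ZMod q) - 1 + 0 * (x : ZMod q) + ((x⁻¹ : (ZMod q)ˣ) : ZMod q)) - 1 := by ring
      rw [e1, e2, Bs_refl, Bs_refl]; ring
    · have hlt : W + (x : ZMod q).val + 1 < Y := by omega
      have : (W : ℝ) + (x : ZMod q).val + 1 < Y := by exact_mod_cast hlt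
      rw [max_eq_right (by linarith), Finset.Ico_eq_empty (by omega)]
      simp
  rw [Finset.sum_congr rfl (fun x _ => key x), Finset.sum_add_distrib, Finset.sum_sub_distrib]
  rw [abs_le] at *
  constructor <;> linarith

/-- positive part -/
noncomputable def pp (s : ℝ) : ℝ := max s 0

lemma pp_nonneg (s : ℝ) : 0 ≤ pp s := le_max_right _ _
lemma pp_mono : Monotone pp := fun a b h => max_le_max h le_rfl
lemma pp_add (s t : ℝ) (ht : 0 ≤ t) : pp (s + t) ≤ pp s + t := by
  unfold pp; apply max_le
  · have := le_max_left s 0; linarith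
  · have := le_max_right s 0; linarith
lemma pp_cont : Continuous pp := by unfold pp; fun_prop
lemma pp_zero {s : ℝ} (h : s ≤ 0) : pp s = 0 := max_eq_right h
lemma pp_pos {s : ℝ} (h : 0 ≤ s) : pp s = s := max_eq_left h

lemma ppsq_step (s c : ℝ) (hc : 0 ≤ c) : c * pp (s - c) ≤ pp s ^ 2 / 2 - pp (s - c) ^ 2 / 2 ∧
    pp s ^ 2 / 2 - pp (s - c) ^ 2 / 2 ≤ c * pp s := by
  rcases le_total s 0 with h | h
  · rw [pp_zero h, pp_zero (by linarith : s - c ≤ 0)]; simp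
  · rcases le_total (s - c) 0 with h' | h'
    · rw [pp_pos h, pp_zero h']; constructor <;> nlinarith
    · rw [pp_pos h, pp_pos h']; constructor <;> nlinarith

lemma sum_fixed_c (c T : ℝ) (hc : 0 < c) (hT : 0 ≤ T) (Q : ℕ) (hQ : T ≤ c * (Q + 1)) :
    |∑ q ∈ Finset.Icc 1 Q, pp (T - q * c) - T ^ 2 / (2 * c)| ≤ T := by
  have e : ∀ n : ℕ, T - (n : ℝ) * c - c = T - ((n + 1 : ℕ) : ℝ) * c := by intro n; push_cast; ring
  have hI : ∑ q ∈ Finset.Icc 1 Q, pp (T - q * c) = ∑ i ∈ Finset.range Q, pp (T - ((i + 1 : ℕ) : ℝ) * c) := by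
    rw [Finset.range_eq_Ico, Finset.sum_Ico_add' (fun i : ℕ => pp (T - (i : ℝ) * c)) 0 Q 1]
    rfl
  have h1 : c * ∑ i ∈ Finset.range Q, pp (T - ((i + 1 : ℕ) : ℝ) * c) ≤ T ^ 2 / 2 := by
    rw [Finset.mul_sum]
    have : ∀ i ∈ Finset.range Q, c * pp (T - ((i + 1 : ℕ) : ℝ) * c) ≤ (fun n : ℕ => pp (T - n * c) ^ 2 / 2) i - (fun n : ℕ => pp (T - n * c) ^ 2 / 2) (i + 1) := by
      intro i _
      have := (ppsq_step (T - (i:ℝ) * c) c hc.le).1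
      rwa [e] at this
    refine (Finset.sum_le_sum this).trans ?_
    rw [Finset.sum_range_sub']
    simp only [Nat.cast_zero, zero_mul, sub_zero]
    rw [pp_pos hT]
    have : 0 ≤ pp (T - Q * c) ^ 2 / 2 := by positivity
    linarith
  have h2 : T ^ 2 / 2 ≤ c * ∑ i ∈ Finset.range (Q + 1), pp (T - (i : ℝ) * c) := by
    rw [Finset.mul_sum]
    have : ∀ i ∈ Finset.range (Q + 1), (fun n : ℕ => pp (T - n * c) ^ 2 / 2) i - (fun n : ℕ => pp (T - n * c) ^ 2 / 2) (i + 1) ≤ c * pp (T - (i : ℝ) * c) := by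
      intro i _
      have := (ppsq_step (T - (i:ℝ) * c) c hc.le).2
      rwa [e] at this
    refine le_trans ?_ (Finset.sum_le_sum this)
    rw [Finset.sum_range_sub']
    simp only [Nat.cast_zero, zero_mul, sub_zero]
    rw [pp_pos hT, pp_zero (by push_cast; linarith)]
    simp
  rw [Finset.sum_range_succ'] at h2
  simp only [Nat.cast_zero, zero_mul, sub_zero] at h2
  rw [pp_pos hT] at h2
  rw [hI]
  set S := ∑ i ∈ Finset.range Q, pp (T - ((i + 1 : ℕ) : ℝ) * c)
  have e3 : T ^ 2 / (2 * c) = (T ^ 2 / 2) / c := by field_simp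
  rw [e3, abs_le]
  constructor
  · have : T ^ 2 / 2 / c ≤ S + T := by rw [div_le_iff₀ hc]; linarith
    linarith
  · have : S ≤ T ^ 2 / 2 / c := by rw [le_div_iff₀ hc]; linarith
    linarith

lemma int_vs_sum (α T : ℝ) (q : ℕ) (hq : 1 ≤ q) :
    |∑ x ∈ Finset.range q, pp (T + x - α * q) / q - ∫ c in (α - 1)..α, pp (T - q * c)| ≤ 1 := by
  have hq0 : (0:ℝ) < q := by exact_mod_cast hq
  have h1 := intervalIntegral.integral_comp_sub_mul (a := α - 1) (b := α) pp hq0.ne' T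
  rw [h1]
  have e : T - q * (α - 1) = (T - q * α) + q := by ring
  rw [e]
  have l := (pp_mono.monotoneOn (Set.Icc (T - q * α) (T - q * α + q))).sum_le_integral
  have u := (pp_mono.monotoneOn (Set.Icc (T - q * α) (T - q * α + q))).integral_le_sum
  have e1 : ∑ x ∈ Finset.range q, pp (T + x - α * q) / q = (q:ℝ)⁻¹ * ∑ i ∈ Finset.range q, pp (T - q * α + i) := by
    rw [Finset.mul_sum]; apply Finset.sum_congr rfl; intro x _
    rw [div_eq_inv_mul]; congr 2; ring
  have e2 : ∑ i ∈ Finset.range q, pp (T - q * α + ((i + 1 : ℕ) : ℝ)) ≤ ∑ i ∈ Finset.range q, pp (T - q * α + i) + q := by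
    have : (q : ℝ) = ∑ i ∈ Finset.range q, (1:ℝ) := by simp
    conv_rhs => rw [this]
    rw [← Finset.sum_add_distrib]
    simp only [Finset.sum_const, Finset.card_range, nsmul_eq_mul, mul_one]
    apply Finset.sum_le_sum
    intro i _
    have := pp_add (T - q * α + i) 1 zero_le_one
    push_cast
    rwa [← add_assoc]
  rw [e1, smul_eq_mul, ← mul_sub, abs_mul, abs_of_pos (inv_pos.mpr hq0), inv_mul_le_iff₀ hq0, mul_one, abs_le]
  constructor <;> linarith

noncomputable def HH (α T : ℝ) (Q : ℕ) : ℝ := ∑ q ∈ Finset.Icc 1 Q, ∑ x ∈ Finset.range q, pp (T + x - α * q) / q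

lemma HH_bound (α : ℝ) (hα : 1 < α) (T : ℝ) (hT : 0 ≤ T) (Q : ℕ) (hQ : Q = ⌊T / (α - 1)⌋₊) :
    |HH α T Q - T ^ 2 * Real.log (α / (α - 1)) / 2| ≤ T + T / (α - 1) := by
  have hβ : 0 < α - 1 := by linarith
  have hQ1 : T < (α - 1) * (Q + 1) := by
    have := Nat.lt_floor_add_one (T / (α - 1))
    rw [← hQ, div_lt_iff₀ hβ] at this; linarith
  have hQ2 : (Q : ℝ) ≤ T / (α - 1) := by rw [hQ]; exact Nat.floor_le (by positivity)
  have h1 : |HH α T Q - ∑ q ∈ Finset.Icc 1 Q, ∫ c in (α - 1)..α, pp (T - q * c)| ≤ T / (α - 1) := by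
    rw [HH, ← Finset.sum_sub_distrib]
    refine (Finset.abs_sum_le_sum_abs _ _).trans ?_
    refine (Finset.sum_le_sum (fun q hq => int_vs_sum α T q (Finset.mem_Icc.mp hq).1)).trans ?_
    simpa using hQ2
  have h2 : ∑ q ∈ Finset.Icc 1 Q, ∫ c in (α - 1)..α, pp (T - q * c) = ∫ c in (α - 1)..α, ∑ q ∈ Finset.Icc 1 Q, pp (T - q * c) := by
    rw [intervalIntegral.integral_finset_sum]
    intro i _
    apply Continuous.intervalIntegrable
    exact pp_cont.comp (by fun_prop)
  have h3 : ∫ c in (α - 1)..α, T ^ 2 / (2 * c) = T ^ 2 * Real.log (α / (α - 1)) / 2 := by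
    have : ∀ c : ℝ, T ^ 2 / (2 * c) = T ^ 2 / 2 * (1 / c) := by intro c; rw [div_mul_div_comm, mul_one]
    simp_rw [this]
    rw [intervalIntegral.integral_const_mul, integral_one_div_of_pos hβ (by linarith)]; ring
  have h4 : |(∫ c in (α - 1)..α, ∑ q ∈ Finset.Icc 1 Q, pp (T - q * c)) - ∫ c in (α - 1)..α, T ^ 2 / (2 * c)| ≤ T := by
    rw [← intervalIntegral.integral_sub]
    · have := intervalIntegral.norm_integral_le_of_norm_le_const (a := α - 1) (b := α) (C := T)
        (f := fun c => ∑ q ∈ Finset.Icc 1 Q, pp (T - q * c) - T ^ 2 / (2 * c)) (by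
          intro c hc
          rw [Set.uIoc_of_le (by linarith)] at hc
          apply sum_fixed_c c T (by linarith [hc.1]) hT Q
          have : (α - 1) * ((Q:ℝ) + 1) ≤ c * (Q + 1) := by
            have := hc.1.le
            gcongr
          linarith)
      rw [Real.norm_eq_abs] at this
      simpa using this
    · apply Continuous.intervalIntegrable
      exact continuous_finset_sum _ (fun i _ => pp_cont.comp (by fun_prop))
    · apply ContinuousOn.intervalIntegrable
      rw [Set.uIcc_of_le (by linarith)]
      apply ContinuousOn.div (by fun_prop) (by fun_prop)
      intro x hx
      have := hx.1
      have : 0 < x := by linarith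
      positivity
  rw [h2] at h1
  rw [h3] at h4
  rw [abs_le] at *
  constructor <;> linarith

lemma HH_bound' (α : ℝ) (hα : 1 < α) : ∃ C > 0, ∀ T : ℝ, 0 ≤ T → ∀ Q : ℕ, Q = ⌊T / (α - 1)⌋₊ → 
    |HH α T Q - T ^ 2 * Real.log (α / (α - 1)) / 2| ≤ C * T ^ (3/2 : ℝ) := by
  have hβ : 0 < α - 1 := by linarith
  have hL : 0 ≤ Real.log (α / (α - 1)) := Real.log_nonneg (by rw [le_div_iff₀ hβ]; linarith)
  set β := α - 1
  set L := Real.log (α / β)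
  have hsb : 0 < Real.sqrt β := Real.sqrt_pos.mpr hβ
  refine ⟨(1 + 1 / β) / Real.sqrt β + Real.sqrt β * L / 2, by positivity, fun T hT Q hQ => ?_⟩
  have e : T ^ (3/2 : ℝ) = T * Real.sqrt T := by
    rw [Real.sqrt_eq_rpow, ← Real.rpow_one_add' hT (by norm_num)]; norm_num
  rw [e]
  rcases lt_or_ge T β with h | h
  · have : Q = 0 := by rw [hQ, Nat.floor_eq_zero, div_lt_one hβ]; exact h
    subst this
    have h0 : HH α T 0 = 0 := by simp [HH]
    rw [h0, zero_sub, abs_neg, abs_of_nonneg (by positivity)]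
    have h1 : T = Real.sqrt T * Real.sqrt T := (Real.mul_self_sqrt hT).symm
    have h2 : Real.sqrt T ≤ Real.sqrt β := Real.sqrt_le_sqrt h.le
    calc T ^ 2 * L / 2 = (Real.sqrt T * L / 2) * (T * Real.sqrt T) := by rw [pow_two]; nth_rewrite 2 [h1]; ring
      _ ≤ (Real.sqrt β * L / 2) * (T * Real.sqrt T) := by gcongr
      _ ≤ _ := by
        have : 0 ≤ (1 + 1 / β) / Real.sqrt β * (T * Real.sqrt T) := by positivity
        linarith
  · refine (HH_bound α hα T hT Q hQ).trans ?_
    have h2 : Real.sqrt β ≤ Real.sqrt T := Real.sqrt_le_sqrt h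
    calc T + T / β = ((1 + 1 / β) / Real.sqrt β) * (T * Real.sqrt β) := by field_simp
      _ ≤ ((1 + 1 / β) / Real.sqrt β) * (T * Real.sqrt T) := by gcongr
      _ ≤ _ := by
        have : 0 ≤ Real.sqrt β * L / 2 * (T * Real.sqrt T) := by positivity
        linarith

lemma mu_ind (x q Q : ℕ) (hq : 1 ≤ q) (hQ : q ≤ Q) :
    (if Nat.Coprime x q then (1:ℝ) else 0) = ∑ d ∈ Finset.Icc 1 Q, if d ∣ x ∧ d ∣ q then (ArithmeticFunction.moebius d : ℝ) else 0 := by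
  have hg : Nat.gcd x q ≠ 0 := by
    intro h; rw [Nat.gcd_eq_zero_iff] at h; omega
  have h := ArithmeticFunction.coe_mul_zeta_apply (f := ArithmeticFunction.moebius) (x := Nat.gcd x q)
  rw [ArithmeticFunction.moebius_mul_coe_zeta, ArithmeticFunction.one_apply] at h
  have h' : (if Nat.gcd x q = 1 then (1:ℝ) else 0) = ∑ d ∈ (Nat.gcd x q).divisors, (ArithmeticFunction.moebius d : ℝ) := by
    exact_mod_cast h
  rw [← Finset.sum_filter]
  simp only [Nat.coprime_iff_gcd_eq_one]
  rw [h']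
  apply Finset.sum_congr _ (fun _ _ => rfl)
  ext d
  simp only [Nat.mem_divisors, Finset.mem_filter, Finset.mem_Icc, Nat.dvd_gcd_iff]
  constructor
  · rintro ⟨⟨a, b⟩, _⟩
    exact ⟨⟨Nat.pos_of_dvd_of_pos b hq, (Nat.le_of_dvd hq b).trans hQ⟩, a, b⟩
  · rintro ⟨_, a, b⟩; exact ⟨⟨a, b⟩, hg⟩

lemma sum_dvd_range (d n : ℕ) (hd : 0 < d) (f : ℕ → ℝ) :
    (∑ x ∈ Finset.range (d * n), if d ∣ x then f x else 0) = ∑ x ∈ Finset.range n, f (d * x) := by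
  rw [← Finset.sum_filter]
  symm
  apply Finset.sum_nbij (fun x => d * x)
  · intro x hx; simp at *; exact Nat.mul_lt_mul_of_pos_left hx hd
  · intro a _ b _ h; exact Nat.eq_of_mul_eq_mul_left hd h
  · intro x hx
    simp at hx
    obtain ⟨h, m, rfl⟩ := hx
    exact ⟨m, by simpa using Nat.lt_of_mul_lt_mul_left h, rfl⟩
  · intros; rfl

lemma sum_dvd_Icc (d Q : ℕ) (hd : 0 < d) (f : ℕ → ℝ) :
    (∑ x ∈ Finset.Icc 1 Q, if d ∣ x then f x else 0) = ∑ x ∈ Finset.Icc 1 (Q / d), f (d * x) := by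
  rw [← Finset.sum_filter]
  symm
  apply Finset.sum_nbij (fun x => d * x)
  · intro x hx; simp at *
    rw [Nat.le_div_iff_mul_le hd] at hx
    refine ⟨Nat.mul_pos hd hx.1, by linarith [hx.2]⟩
  · intro a _ b _ h; exact Nat.eq_of_mul_eq_mul_left hd h
  · intro x hx
    simp at hx
    obtain ⟨⟨h1, h2⟩, m, rfl⟩ := hx
    refine ⟨m, ?_, rfl⟩
    simp
    rw [Nat.le_div_iff_mul_le hd]
    exact ⟨Nat.pos_of_mul_pos_left h1, by linarith⟩
  · intros; rfl

noncomputable def GG (α T : ℝ) (Q : ℕ) : ℝ := ∑ q ∈ Finset.Icc 1 Q, ∑ x ∈ Finset.range q, if Nat.Coprime x q then pp (T + x - α * q) / q else 0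

lemma GG_eq (α T : ℝ) (Q : ℕ) : GG α T Q = ∑ d ∈ Finset.Icc 1 Q, (ArithmeticFunction.moebius d : ℝ) * HH α (T / d) (Q / d) := by
  have h1 : GG α T Q = ∑ q ∈ Finset.Icc 1 Q, ∑ d ∈ Finset.Icc 1 Q, ∑ x ∈ Finset.range q, 
      if d ∣ q then (if d ∣ x then (ArithmeticFunction.moebius d : ℝ) * (pp (T + x - α * q) / q) else 0) else 0 := by
    unfold GG
    apply Finset.sum_congr rfl; intro q hq
    rw [Finset.mem_Icc] at hq
    rw [Finset.sum_comm]
    apply Finset.sum_congr rfl; intro x _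
    have h2 : (if Nat.Coprime x q then pp (T + x - α * q) / q else 0) = (if Nat.Coprime x q then (1:ℝ) else 0) * (pp (T + x - α * q) / q) := by
      split_ifs <;> simp
    rw [h2, mu_ind x q Q hq.1 hq.2, Finset.sum_mul]
    apply Finset.sum_congr rfl; intro d _
    by_cases a : d ∣ x <;> by_cases b : d ∣ q <;> simp [a, b]
  rw [h1, Finset.sum_comm]
  apply Finset.sum_congr rfl; intro d hd
  have hd0 : 0 < d := by rw [Finset.mem_Icc] at hd; omega
  have h3 : ∀ q, (∑ x ∈ Finset.range q, 
      if d ∣ q then (if d ∣ x then (ArithmeticFunction.moebius d : ℝ) * (pp (T + x - α * q) / q) else 0) else 0)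
      = if d ∣ q then ∑ x ∈ Finset.range q, (if d ∣ x then (ArithmeticFunction.moebius d : ℝ) * (pp (T + x - α * q) / q) else 0) else 0 := by
    intro q; split_ifs <;> simp
  simp_rw [h3]
  rw [sum_dvd_Icc d Q hd0, HH, Finset.mul_sum]
  apply Finset.sum_congr rfl; intro q hq
  rw [sum_dvd_range d q hd0, Finset.mul_sum]
  apply Finset.sum_congr rfl; intro x hx
  congr 1
  have hdr : (0:ℝ) < d := by exact_mod_cast hd0
  push_cast
  have e : T + (d:ℝ) * x - α * (d * q) = d * (T / d + x - α * q) := by field_simp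
  have e2 : ∀ s, pp (d * s) = d * pp s := by
    intro s; unfold pp; rw [mul_max_of_nonneg _ _ hdr.le, mul_zero]
  rw [e, e2, mul_div_mul_left _ _ hdr.ne']

lemma mu_tsum : HasSum (fun d : ℕ => (ArithmeticFunction.moebius d : ℝ) / (d:ℝ) ^ 2) (6 / Real.pi ^ 2) := by
  have h1 := ArithmeticFunction.LSeries_zeta_mul_Lseries_moebius (s := 2) (by norm_num)
  have h2 := ArithmeticFunction.LSeries_zeta_eq_riemannZeta (s := 2) (by norm_num)
  rw [h2, riemannZeta_two] at h1
  have h3 : LSeriesSummable (fun n => ((ArithmeticFunction.moebius n : ℤ) : ℂ)) 2 := ArithmeticFunction.LSeriesSummable_moebius_iff.mpr (by norm_num)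
  have h4 := h3.hasSum
  have hpi : (Real.pi : ℂ) ≠ 0 := by exact_mod_cast Real.pi_ne_zero
  have h5 : LSeries (fun n => ((ArithmeticFunction.moebius n : ℤ) : ℂ)) 2 = ((6 / Real.pi ^ 2 : ℝ) : ℂ) := by
    push_cast
    field_simp
    field_simp at h1
    linear_combination h1
  have h6 : (fun d : ℕ => LSeries.term (fun n => ((ArithmeticFunction.moebius n : ℤ) : ℂ)) 2 d) = fun d : ℕ => (((ArithmeticFunction.moebius d : ℝ) / (d:ℝ) ^ 2 : ℝ) : ℂ) := by
    ext d
    rcases Nat.eq_zero_or_pos d with h | h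
    · subst h; simp
    · rw [LSeries.term_of_ne_zero h.ne']
      push_cast
      norm_num [Complex.cpow_ofNat]
  have h7 : HasSum (fun d : ℕ => (((ArithmeticFunction.moebius d : ℝ) / (d:ℝ) ^ 2 : ℝ) : ℂ)) ((6 / Real.pi ^ 2 : ℝ) : ℂ) := by
    rw [← h6, ← h5]; exact h4
  exact Complex.hasSum_ofReal.mp h7

theorem GG_bound (α : ℝ) (hα : 1 < α) : ∃ C > 0, ∀ T : ℝ, 0 ≤ T → ∀ Q : ℕ, Q = ⌊T / (α - 1)⌋₊ →
    |GG α T Q - T ^ 2 * Real.log (α / (α - 1)) * (3 / Real.pi ^ 2)| ≤ C * T ^ (3/2 : ℝ) := by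
  obtain ⟨C, hC, h⟩ := HH_bound' α hα
  have hs : Summable (fun d : ℕ => 1 / (d:ℝ) ^ (3/2 : ℝ)) := Real.summable_one_div_nat_rpow.mpr (by norm_num)
  refine ⟨C * (∑' d : ℕ, 1 / (d:ℝ) ^ (3/2 : ℝ)) + 1, by positivity, fun T hT Q hQ => ?_⟩
  set L := Real.log (α / (α - 1))
  have hG : HasSum (fun d : ℕ => (ArithmeticFunction.moebius d : ℝ) * HH α (T / d) (Q / d)) (GG α T Q) := by
    rw [GG_eq]
    apply hasSum_sum_of_ne_finset_zero
    intro d hd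
    rw [Finset.mem_Icc, not_and_or, not_le, not_le] at hd
    rcases hd with hd | hd
    · have : d = 0 := by omega
      subst this; simp
    · rw [Nat.div_eq_of_lt hd]; simp [HH]
  have hM := mu_tsum.mul_left (T ^ 2 * L / 2)
  have hD := hG.sub hM
  have hb : ∀ d : ℕ, ‖(ArithmeticFunction.moebius d : ℝ) * HH α (T / d) (Q / d) - T ^ 2 * L / 2 * ((ArithmeticFunction.moebius d : ℝ) / (d:ℝ) ^ 2)‖ ≤ C * T ^ (3/2 : ℝ) * (1 / (d:ℝ) ^ (3/2 : ℝ)) := by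
    intro d
    have hmu : |(ArithmeticFunction.moebius d : ℝ)| ≤ 1 := by
      exact_mod_cast ArithmeticFunction.abs_moebius_le_one (n := d)
    have hh := h (T / d) (by positivity) (Q / d) (by
      rw [hQ, ← Nat.floor_div_natCast]; congr 1; ring)
    have e : (ArithmeticFunction.moebius d : ℝ) * HH α (T / d) (Q / d) - T ^ 2 * L / 2 * ((ArithmeticFunction.moebius d : ℝ) / (d:ℝ) ^ 2) = (ArithmeticFunction.moebius d : ℝ) * (HH α (T / d) (Q / d) - (T / d) ^ 2 * L / 2) := by
      rw [div_pow]; ring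
    rw [e, Real.norm_eq_abs, abs_mul]
    calc _ ≤ 1 * |HH α (T / d) (Q / d) - (T / d) ^ 2 * L / 2| := by gcongr
      _ ≤ C * (T / d) ^ (3/2 : ℝ) := by rw [one_mul]; exact hh
      _ = _ := by rw [Real.div_rpow hT (by positivity)]; ring
  have hfin := tsum_of_norm_bounded (hs.hasSum.mul_left (C * T ^ (3/2 : ℝ))) hb
  rw [hD.tsum_eq, Real.norm_eq_abs] at hfin
  have e2 : T ^ 2 * L / 2 * (6 / Real.pi ^ 2) = T ^ 2 * L * (3 / Real.pi ^ 2) := by ring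
  rw [e2] at hfin
  refine hfin.trans ?_
  have : 0 ≤ T ^ (3/2 : ℝ) := by positivity
  nlinarith

lemma two_log_le (ε : ℝ) (hε : 0 < ε) (q : ℕ) (hq : 1 ≤ q) : 2 + Real.log q ≤ (2 + 1 / ε) * (q:ℝ) ^ ε := by
  have hq1 : (1:ℝ) ≤ q := by exact_mod_cast hq
  have h1 := Real.log_le_rpow_div (x := q) (by positivity) hε
  have h2 : 1 ≤ (q:ℝ) ^ ε := Real.one_le_rpow hq1 hε.le
  have : (q:ℝ) ^ ε / ε = 1 / ε * (q:ℝ) ^ ε := by ring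
  rw [this] at h1
  linarith

lemma divisor_bound (ε : ℝ) (hε : 0 < ε) : ∃ C : ℝ, 1 ≤ C ∧ ∀ n : ℕ, 1 ≤ n → (n.divisors.card : ℝ) ≤ C * (n:ℝ) ^ ε := by
  set P0 := ⌈(2:ℝ) ^ (1 / ε)⌉₊
  have hl2 : 0 < Real.log 2 := Real.log_pos (by norm_num)
  set C' := 1 + 1 / (ε * Real.log 2)
  have hC' : 1 ≤ C' := by
    have : 0 < 1 / (ε * Real.log 2) := by positivity
    linarith
  refine ⟨C' ^ P0, one_le_pow₀ hC', fun n hn => ?_⟩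
  rw [Nat.card_divisors (by omega)]
  push_cast
  have h1 : ∀ p ∈ n.primeFactors, ((n.factorization p : ℝ) + 1) ≤ (if p < P0 then C' else 1) * ((p:ℝ) ^ (n.factorization p)) ^ ε := by
    intro p hp
    have hp2 : 2 ≤ p := (Nat.prime_of_mem_primeFactors hp).two_le
    set a := n.factorization p
    have hp2' : (2:ℝ) ≤ p := by exact_mod_cast hp2
    have e : ((p:ℝ) ^ a) ^ ε = ((p:ℝ) ^ ε) ^ a := by
      rw [← Real.rpow_natCast, ← Real.rpow_natCast, ← Real.rpow_mul (by positivity), ← Real.rpow_mul (by positivity), mul_comm]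
    rw [e]
    split_ifs with h
    · have h2 : 1 + a * (ε * Real.log 2) ≤ ((p:ℝ) ^ ε) ^ a := by
        have h3 : 1 + ε * Real.log 2 ≤ (p:ℝ) ^ ε := by
          have : (2:ℝ) ^ ε ≤ (p:ℝ) ^ ε := Real.rpow_le_rpow (by norm_num) hp2' hε.le
          refine le_trans ?_ this
          rw [Real.rpow_def_of_pos (by norm_num)]
          have := Real.add_one_le_exp (Real.log 2 * ε)
          linarith
        calc _ ≤ (1 + ε * Real.log 2) ^ a := one_add_mul_le_pow (by nlinarith [mul_pos hε hl2]) a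
          _ ≤ _ := by gcongr
      have hx : 0 < ε * Real.log 2 := mul_pos hε hl2
      calc (a:ℝ) + 1 ≤ C' * (1 + a * (ε * Real.log 2)) := by
            simp only [C']
            have : (1 + 1 / (ε * Real.log 2)) * (1 + a * (ε * Real.log 2)) = 1 + a + a * (ε * Real.log 2) + 1 / (ε * Real.log 2) := by field_simp; ring
            rw [this]
            have : 0 ≤ a * (ε * Real.log 2) := by positivity
            have : 0 ≤ 1 / (ε * Real.log 2) := by positivity
            linarith
        _ ≤ _ := by gcongr
    · rw [one_mul]
      have h2 : 2 ≤ (p:ℝ) ^ ε := by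
        have h3 : (2:ℝ) ^ (1 / ε) ≤ p := (Nat.le_ceil _).trans (by exact_mod_cast not_lt.mp h)
        calc (2:ℝ) = ((2:ℝ) ^ (1 / ε)) ^ ε := by rw [← Real.rpow_mul (by norm_num), one_div_mul_cancel hε.ne', Real.rpow_one]
          _ ≤ _ := by gcongr
      calc (a:ℝ) + 1 = 1 + a * (1:ℝ) := by ring
        _ ≤ (1 + 1) ^ a := one_add_mul_le_pow (by norm_num) a
        _ ≤ _ := by norm_num; gcongr
  refine (Finset.prod_le_prod (fun p _ => by positivity) h1).trans ?_
  rw [Finset.prod_mul_distrib, Real.finset_prod_rpow _ _ (fun p _ => by positivity)]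
  have h4 : ∏ p ∈ n.primeFactors, ((p:ℝ) ^ (n.factorization p)) = n := by
    have := Nat.prod_factorization_pow_eq_self (n := n) (by omega)
    rw [Finsupp.prod] at this
    conv_rhs => rw [← this]
    push_cast; rfl
  rw [h4]
  gcongr
  rw [Finset.prod_ite, Finset.prod_const, Finset.prod_const_one, mul_one]
  apply pow_le_pow_right₀ hC'
  calc _ ≤ (Finset.range P0).card := Finset.card_le_card (by intro p hp; simp at *; exact hp.2)
    _ = P0 := by simp

lemma uv_sum (s u v : ℕ → ℕ) (h1 : ∀ q, 1 ≤ q → q = s q * u q ^ 2 * v q) (h2 : ∀ q, 1 ≤ q → v q ∣ u q) (X : ℕ) (D : ℝ)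
    (hD : ∀ n, 1 ≤ n → n ≤ X → (n.divisors.card : ℝ) ≤ D) :
    ∑ q ∈ Finset.Icc 1 X, ((u q : ℝ) * Real.sqrt (v q)) ≤ X * D * (2 + Real.log X) := by
  rcases Nat.eq_zero_or_pos X with hX | hX
  · subst hX; simp
  have hD0 : 0 ≤ D := (by positivity : (0:ℝ) ≤ _).trans (hD 1 le_rfl hX)
  have h3 : ∀ q ∈ Finset.Icc 1 X, ((u q : ℝ) * Real.sqrt (v q)) ≤ ∑ a ∈ Finset.Icc 1 X, ∑ b ∈ a.divisors, if a ^ 2 * b ∣ q then (a : ℝ) * Real.sqrt b else 0 := by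
    intro q hq
    rw [Finset.mem_Icc] at hq
    have e1 := h1 q hq.1
    have e2 := h2 q hq.1
    have hu : 1 ≤ u q := by
      rcases Nat.eq_zero_or_pos (u q) with h | h
      · rw [h] at e1; simp at e1; omega
      · exact h
    have hd : u q ^ 2 * v q ∣ q := ⟨s q, by linarith⟩
    have hle : u q ≤ X := by
      have : u q ∣ q := (dvd_pow_self _ two_ne_zero).trans ((Dvd.intro _ rfl).trans hd)
      exact (Nat.le_of_dvd (by omega) this).trans hq.2
    have i1 := Finset.single_le_sum (s := (u q).divisors) (f := fun b : ℕ => if (u q) ^ 2 * b ∣ q then (u q : ℝ) * Real.sqrt b else 0)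
      (by intro i _; split_ifs <;> positivity) (Nat.mem_divisors.mpr ⟨e2, by omega⟩)
    have i2 := Finset.single_le_sum (s := Finset.Icc 1 X) (f := fun a : ℕ => ∑ b ∈ a.divisors, if a ^ 2 * b ∣ q then (a : ℝ) * Real.sqrt b else 0)
      (by intro i _; apply Finset.sum_nonneg; intro j _; split_ifs <;> positivity) (Finset.mem_Icc.mpr ⟨hu, hle⟩)
    rw [if_pos hd] at i1
    exact i1.trans i2
  refine (Finset.sum_le_sum h3).trans ?_
  rw [Finset.sum_comm]
  have h4 : ∀ a ∈ Finset.Icc 1 X, (∑ q ∈ Finset.Icc 1 X, ∑ b ∈ a.divisors, if a ^ 2 * b ∣ q then (a : ℝ) * Real.sqrt b else 0) ≤ X * D * (a:ℝ)⁻¹ := by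
    intro a ha
    rw [Finset.mem_Icc] at ha
    rw [Finset.sum_comm]
    have ha0 : (0:ℝ) < a := by exact_mod_cast ha.1
    have h5 : ∀ b ∈ a.divisors, (∑ q ∈ Finset.Icc 1 X, if a ^ 2 * b ∣ q then (a : ℝ) * Real.sqrt b else 0) ≤ X * (a:ℝ)⁻¹ := by
      intro b hb
      have hb1 : 0 < b := Nat.pos_of_mem_divisors hb
      have hb0 : (1:ℝ) ≤ b := by exact_mod_cast hb1
      rw [sum_dvd_Icc _ _ (Nat.mul_pos (Nat.pow_pos ha.1) hb1)]
      simp only [Finset.sum_const, Nat.card_Icc, nsmul_eq_mul, Nat.add_sub_cancel]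
      have h6 : ((X / (a ^ 2 * b) : ℕ) : ℝ) ≤ X / (a ^ 2 * b) := by
        have := @Nat.cast_div_le ℝ _ _ _ X (a ^ 2 * b)
        push_cast at this; exact this
      have hsb : Real.sqrt b ≤ b := by
        rw [Real.sqrt_le_left (by positivity)]; nlinarith
      calc _ ≤ (X:ℝ) / (a ^ 2 * b) * (a * b) := by gcongr
        _ = _ := by field_simp
    refine (Finset.sum_le_card_nsmul _ _ _ h5).trans ?_
    rw [nsmul_eq_mul]
    have := hD a ha.1 ha.2
    calc _ ≤ D * (X * (a:ℝ)⁻¹) := by gcongr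
      _ = _ := by ring
  refine (Finset.sum_le_sum h4).trans ?_
  rw [← Finset.mul_sum]
  have h7 : ∑ a ∈ Finset.Icc 1 X, (a:ℝ)⁻¹ ≤ 1 + Real.log X := by
    have h := harmonic_le_one_add_log X
    rw [harmonic_eq_sum_Icc] at h
    push_cast at h; exact h
  gcongr
  linarith

lemma err_sum (s u v : ℕ → ℕ) (h1 : ∀ q, 1 ≤ q → q = s q * u q ^ 2 * v q) (h2 : ∀ q, 1 ≤ q → v q ∣ u q) (ε : ℝ) (hε : 0 < ε) :
    ∃ C > 0, ∀ X : ℕ, ∑ q ∈ Finset.Icc 1 X, ((q.divisors.card : ℝ) ^ 2 * Real.sqrt q * (u q * Real.sqrt (v q)) * (2 + Real.log q) ^ 2) ≤ C * (X:ℝ) ^ (3/2 + ε) := by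
  obtain ⟨e, hee⟩ : ∃ e, e = ε / 6 := ⟨_, rfl⟩
  have he : 0 < e := by rw [hee]; positivity
  obtain ⟨C, hC, hdiv⟩ := divisor_bound e he
  obtain ⟨K, hKK⟩ : ∃ K, K = 2 + 1 / e := ⟨_, rfl⟩
  have hK : 0 < K := by rw [hKK]; positivity
  refine ⟨C ^ 3 * K ^ 3, by positivity, fun X => ?_⟩
  rcases Nat.eq_zero_or_pos X with hX | hX
  · subst hX; simp; positivity
  have hX0 : (0:ℝ) < X := by exact_mod_cast hX
  have hD : ∀ n, 1 ≤ n → n ≤ X → (n.divisors.card : ℝ) ≤ C * (X:ℝ) ^ e := by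
    intro n hn hnX
    refine (hdiv n hn).trans ?_
    have : (n:ℝ) ≤ X := by exact_mod_cast hnX
    gcongr
  have hlog := two_log_le e he X hX
  rw [← hKK] at hlog
  have h3 : ∀ q ∈ Finset.Icc 1 X, ((q.divisors.card : ℝ) ^ 2 * Real.sqrt q * (u q * Real.sqrt (v q)) * (2 + Real.log q) ^ 2) ≤ ((C * (X:ℝ) ^ e) ^ 2 * Real.sqrt X * (K * (X:ℝ) ^ e) ^ 2) * (u q * Real.sqrt (v q)) := by
    intro q hq
    rw [Finset.mem_Icc] at hq
    have i1 := hD q hq.1 hq.2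
    have hqX : (q:ℝ) ≤ X := by exact_mod_cast hq.2
    have hq0 : (0:ℝ) < q := by exact_mod_cast hq.1
    have i2 : 2 + Real.log q ≤ K * (X:ℝ) ^ e := by
      refine le_trans ?_ hlog
      have := Real.log_le_log hq0 hqX
      linarith
    have i3 : 0 ≤ 2 + Real.log q := by have := Real.log_natCast_nonneg q; linarith
    clear h1 h2
    generalize C * (X:ℝ) ^ e = A at *
    generalize K * (X:ℝ) ^ e = B at *
    have i4 : Real.sqrt q ≤ Real.sqrt X := Real.sqrt_le_sqrt hqX
    calc _ ≤ A ^ 2 * Real.sqrt X * (u q * Real.sqrt (v q)) * B ^ 2 := by gcongr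
      _ = _ := by ring
  refine (Finset.sum_le_sum h3).trans ?_
  rw [← Finset.mul_sum]
  have h4 := uv_sum s u v h1 h2 X _ hD
  calc _ ≤ ((C * (X:ℝ) ^ e) ^ 2 * Real.sqrt X * (K * (X:ℝ) ^ e) ^ 2) * (X * (C * (X:ℝ) ^ e) * (K * (X:ℝ) ^ e)) := by
        refine mul_le_mul_of_nonneg_left (h4.trans ?_) (by positivity)
        gcongr
    _ = C ^ 3 * K ^ 3 * (X * Real.sqrt X * ((X:ℝ) ^ e) ^ 6) := by ring
    _ = _ := by
      congr 1
      rw [Real.sqrt_eq_rpow, ← Real.rpow_one_add' hX0.le (by norm_num), ← Real.rpow_natCast, ← Real.rpow_mul hX0.le, ← Real.rpow_add hX0]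
      congr 1
      rw [hee]; push_cast; ring

theorem cnt_total (α : ℝ) (hα : 1 < α) (ε : ℝ) (hε : 0 < ε) : ∃ C > 0, ∀ W Q : ℕ, 1 ≤ W → Q = ⌊(W:ℝ) / (α - 1)⌋₊ →
    |(∑ q ∈ Finset.Icc 1 Q, cnt q ⌈α * q⌉₊ W : ℕ) - (W:ℝ) ^ 2 * Real.log (α / (α - 1)) * (3 / Real.pi ^ 2)| ≤ C * (W:ℝ) ^ (3/2 + ε) := by
  have hβ : 0 < α - 1 := by linarith
  have hex : ∀ q : ℕ, ∃ s u v : ℕ, 1 ≤ q → (q = s * u ^ 2 * v ∧ v ∣ u ∧ ∀ Y W : ℕ, |(cnt q Y W : ℝ) - (∑ x ∈ Finset.range q, if Nat.Coprime x q then pp ((W : ℝ) + x + 1 - Y) / q else 0)| ≤ 2 * ((q.divisors.card : ℝ) ^ 2 * Real.sqrt q * (u * Real.sqrt v) * (2 + Real.log q) ^ 2)) := by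
    intro q
    rcases Nat.eq_zero_or_pos q with h | h
    · exact ⟨0, 0, 0, fun h' => by omega⟩
    · haveI : NeZero q := ⟨h.ne'⟩
      obtain ⟨s, u, v, a, b, c⟩ := per_q q inferInstance
      exact ⟨s, u, v, fun _ => ⟨a, b, fun Y W => cnt_main q Y W _ c⟩⟩
  choose s u v huv using hex
  obtain ⟨C1, hC1, hE⟩ := err_sum s u v (fun q hq => (huv q hq).1) (fun q hq => (huv q hq).2.1) ε hε
  obtain ⟨C2, hC2, hG⟩ := GG_bound α hα
  refine ⟨2 * (C1 * (1 / (α - 1)) ^ (3/2 + ε)) + 1 / (α - 1) + C2, by positivity, fun W Q hW hQ => ?_⟩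
  have hW1 : (1:ℝ) ≤ W := by exact_mod_cast hW
  have hQ2 : (Q : ℝ) ≤ W / (α - 1) := by rw [hQ]; exact Nat.floor_le (by positivity)
  have hg := hG W (by positivity) Q hQ
  have h1 : |((∑ q ∈ Finset.Icc 1 Q, cnt q ⌈α * q⌉₊ W : ℕ) : ℝ) - GG α W Q| ≤ ∑ q ∈ Finset.Icc 1 Q, (2 * ((q.divisors.card : ℝ) ^ 2 * Real.sqrt q * (u q * Real.sqrt (v q)) * (2 + Real.log q) ^ 2) + 1) := by
    rw [GG]; push_cast
    rw [← Finset.sum_sub_distrib]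
    refine (Finset.abs_sum_le_sum_abs _ _).trans (Finset.sum_le_sum fun q hq => ?_)
    rw [Finset.mem_Icc] at hq
    have a1 := (huv q hq.1).2.2 ⌈α * q⌉₊ W
    have hq0 : (0:ℝ) < q := by exact_mod_cast hq.1
    have a2 : |(∑ x ∈ Finset.range q, if Nat.Coprime x q then pp ((W : ℝ) + x + 1 - (⌈α * q⌉₊ : ℝ)) / q else 0) - ∑ x ∈ Finset.range q, if Nat.Coprime x q then pp ((W : ℝ) + x - α * q) / q else 0| ≤ 1 := by
      rw [← Finset.sum_sub_distrib]
      refine (Finset.abs_sum_le_sum_abs _ _).trans ?_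
      have : ∀ x ∈ Finset.range q, |(if Nat.Coprime x q then pp ((W : ℝ) + x + 1 - (⌈α * q⌉₊ : ℝ)) / q else 0) - if Nat.Coprime x q then pp ((W : ℝ) + x - α * q) / q else 0| ≤ 1 / q := by
        intro x _
        split_ifs
        · rw [← sub_div, abs_div, abs_of_pos hq0]
          gcongr
          have b1 := Nat.le_ceil (α * q)
          have b2 := Nat.ceil_lt_add_one (a := α * q) (by positivity)
          have b3 := pp_add ((W : ℝ) + x - α * q) (α * q + 1 - ⌈α * q⌉₊) (by linarith)
          have e : (W : ℝ) + x - α * q + (α * q + 1 - ⌈α * q⌉₊) = (W : ℝ) + x + 1 - ⌈α * q⌉₊ := by ring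
          rw [e] at b3
          have b4 := pp_mono (by linarith : (W : ℝ) + x - α * q ≤ (W : ℝ) + x + 1 - ⌈α * q⌉₊)
          rw [abs_le]; constructor <;> linarith
        · simp
      refine (Finset.sum_le_card_nsmul _ _ _ this).trans ?_
      simp; rw [mul_inv_cancel₀ hq0.ne']
    rw [abs_le] at *
    constructor <;> linarith
  rw [Finset.sum_add_distrib, ← Finset.mul_sum] at h1
  simp only [Finset.sum_const, Nat.card_Icc, nsmul_eq_mul, Nat.add_sub_cancel, mul_one] at h1
  have h2 := hE Q
  have h3 : (Q:ℝ) ^ (3/2 + ε) ≤ (1 / (α - 1)) ^ (3/2 + ε) * (W:ℝ) ^ (3/2 + ε) := by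
    rw [← Real.mul_rpow (by positivity) (by positivity)]
    apply Real.rpow_le_rpow (by positivity) _ (by positivity)
    rw [one_div_mul_eq_div]; exact hQ2
  have h4 : (W:ℝ) ≤ (W:ℝ) ^ (3/2 + ε) := by
    conv_lhs => rw [← Real.rpow_one (W:ℝ)]
    exact Real.rpow_le_rpow_of_exponent_le hW1 (by linarith)
  have h5 : (W:ℝ) ^ (3/2:ℝ) ≤ (W:ℝ) ^ (3/2 + ε) := Real.rpow_le_rpow_of_exponent_le hW1 (by linarith)
  have h6 : (Q:ℝ) ≤ 1 / (α - 1) * (W:ℝ) ^ (3/2 + ε) := by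
    calc (Q:ℝ) ≤ 1 / (α - 1) * W := by rw [one_div_mul_eq_div]; exact hQ2
      _ ≤ _ := by gcongr
  have h7 : C1 * (Q:ℝ) ^ (3/2 + ε) ≤ C1 * ((1 / (α - 1)) ^ (3/2 + ε) * (W:ℝ) ^ (3/2 + ε)) := by gcongr
  have h8 : C2 * (W:ℝ) ^ (3/2:ℝ) ≤ C2 * (W:ℝ) ^ (3/2 + ε) := by gcongr
  have h9 : (2 * (C1 * (1 / (α - 1)) ^ (3/2 + ε)) + 1 / (α - 1) + C2) * (W:ℝ) ^ (3/2 + ε) = 2 * (C1 * ((1 / (α - 1)) ^ (3/2 + ε) * (W:ℝ) ^ (3/2 + ε))) + 1 / (α - 1) * (W:ℝ) ^ (3/2 + ε) + C2 * (W:ℝ) ^ (3/2 + ε) := by ring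
  rw [h9]
  rw [abs_le] at *
  constructor <;> linarith

noncomputable def Dm (n : ℕ) (ω : ℝ) : Matrix (Fin 2) (Fin 2) ℤ :=
  ((List.range n).map (fun i => Mmat (1 + ⌊TB^[i] ω⌋) (-1))).prod

lemma OmegaB_eq (ω : ℝ) : OmegaB ω = Dm (perB ω) ω := rfl

lemma Dm_zero (ω : ℝ) : Dm 0 ω = 1 := by simp [Dm]

lemma Dm_succ (n : ℕ) (ω : ℝ) : Dm (n + 1) ω = Mmat (1 + ⌊ω⌋) (-1) * Dm n (TB ω) := by
  unfold Dm
  rw [List.range_succ_eq_map, List.map_cons, List.prod_cons, List.map_map]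
  rfl

lemma Dm_add (m n : ℕ) (ω : ℝ) : Dm (m + n) ω = Dm m ω * Dm n (TB^[m] ω) := by
  induction m generalizing ω with
  | zero => simp [Dm_zero]
  | succ m ih =>
    have : m + 1 + n = (m + n) + 1 := by ring
    rw [this, Dm_succ, ih, Dm_succ, Function.iterate_succ_apply, mul_assoc]

lemma Dm_mul (m k : ℕ) (ω : ℝ) (h : TB^[m] ω = ω) : Dm (m * k) ω = (Dm m ω) ^ k := by
  induction k with
  | zero => simp [Dm_zero]
  | succ k ih =>
    rw [Nat.mul_succ, add_comm, Dm_add, h, ih, pow_succ']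

lemma TB_eq (ω : ℝ) (a : ℤ) (w : ℝ) (hw : 1 < w) (h : ω = a - 1 / w) : ⌊ω⌋ = a - 1 ∧ TB ω = w := by
  have hw0 : 0 < w := by linarith
  have h1 : 1 / w < 1 := by rw [div_lt_one hw0]; exact hw
  have h2 : 0 < 1 / w := by positivity
  have hf : ⌊ω⌋ = a - 1 := by
    rw [Int.floor_eq_iff]; push_cast; constructor <;> linarith
  refine ⟨hf, ?_⟩
  rw [TB, hf, h]; push_cast; 
  have : (1 + ((a:ℝ) - 1) - (a - 1 / w)) = 1 / w := by ring
  rw [this, one_div_one_div]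

/-- core CF lemma -/
lemma cf_core (N : ℕ) : ∀ (q x y p : ℤ) (u ω : ℝ), q ≤ N → 0 ≤ x → x < q → p * q - x * y = 1 → 1 < u →
    ω = (y * u - p) / (q * u - x) → ∃ n : ℕ, 0 < n ∧ TB^[n] ω = u ∧ Dm n ω = !![y, -p; q, -x] := by
  induction N with
  | zero => intro q x y p u ω h1 h2 h3; exfalso; push_cast at h1; omega
  | succ N ih =>
    intro q x y p u ω hqN hx hxq hdet hu hω
    have hq1 : 1 ≤ q := by omega
    have hu0 : 0 < u := by linarith
    rcases eq_or_lt_of_le hq1 with hq | hq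
    · subst hq
      have hx0 : x = 0 := by omega
      subst hx0
      have hp : p = 1 := by linarith
      subst hp
      have := TB_eq ω y u hu (by rw [hω]; push_cast; rw [one_mul, sub_zero, sub_div, mul_div_cancel_right₀ _ hu0.ne'])
      refine ⟨1, one_pos, by simpa using this.2, ?_⟩
      rw [Dm_succ, Dm_zero, this.1, mul_one, Mmat]; simp
    · -- y = a q - q1
      obtain ⟨a, q1, hy, hq10, hq1q⟩ : ∃ a q1 : ℤ, y = a * q - q1 ∧ 0 ≤ q1 ∧ q1 < q := by
        refine ⟨-((-y) / q), (-y) % q, ?_, Int.emod_nonneg _ (by omega), Int.emod_lt_of_pos _ (by omega)⟩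
        have := Int.mul_ediv_add_emod (-y) q
        linarith
      have hq1pos : 0 < q1 := by
        rcases eq_or_lt_of_le hq10 with h | h
        · exfalso
          rw [← h] at hy
          have : q * (p - x * a) = 1 := by rw [hy] at hdet; linarith
          have := Int.eq_one_or_neg_one_of_mul_eq_one this
          omega
        · exact h
      have hx1 : 1 ≤ x := by
        by_contra hlt
        have : x = 0 := by omega
        rw [this] at hdet
        have : q * p = 1 := by linarith
        have := Int.eq_one_or_neg_one_of_mul_eq_one this
        omega
      obtain ⟨x1, hx1d⟩ : ∃ x1, x1 = a * x - p := ⟨_, rfl⟩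
      have hdet' : x * q1 - x1 * q = 1 := by
        have : q1 = a * q - y := by linarith
        rw [hx1d, this]; linarith
      have hx10 : 0 ≤ x1 := by
        by_contra hlt
        push Not at hlt
        nlinarith
      have hx1q1 : x1 < q1 := by
        by_contra hge
        push Not at hge
        nlinarith
      have hdiff : q1 - x1 ≤ q - x := by
        by_contra hlt
        push Not at hlt
        nlinarith
      obtain ⟨w, hw⟩ : ∃ w : ℝ, w = ((q:ℝ) * u - x) / (q1 * u - x1) := ⟨_, rfl⟩
      have c1 : (0:ℝ) < q1 := by exact_mod_cast hq1pos
      have c2 : (x1:ℝ) < q1 := by exact_mod_cast hx1q1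
      have c3 : (q1:ℝ) < q := by exact_mod_cast hq1q
      have c4 : (x:ℝ) < q := by exact_mod_cast hxq
      have c5 : (q1:ℝ) - x1 ≤ q - x := by exact_mod_cast hdiff
      have d1 : 0 < (q1:ℝ) * u - x1 := by nlinarith
      have d2 : 0 < (q:ℝ) * u - x := by nlinarith
      have hw1 : 1 < w := by
        rw [hw, lt_div_iff₀ d1]; nlinarith
      have hωw : ω = a - 1 / w := by
        rw [hω, hw, one_div_div, div_eq_iff d2.ne', sub_mul, div_mul_cancel₀ _ d2.ne', hy, hx1d]
        push_cast; ring
      have ht := TB_eq ω a w hw1 hωw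
      obtain ⟨n, hn, hn1, hn2⟩ := ih q1 x1 q x u w (by push_cast at hqN; omega) hx10 hx1q1 hdet' hu hw
      refine ⟨n + 1, by omega, by rw [Function.iterate_succ_apply, ht.2, hn1], ?_⟩
      rw [Dm_succ, ht.1, ht.2, hn2, Mmat, Matrix.mul_fin_two]
      have e1 : (1 + (a - 1)) * q + -1 * q1 = y := by rw [hy]; ring
      have e2 : (1 + (a - 1)) * -x + -1 * -x1 = -p := by rw [hx1d]; ring
      rw [e1, e2]; simp

lemma TB_irr (ω : ℝ) (h : Irrational ω) : Irrational (TB ω) ∧ 1 < TB ω ∧ ω * TB ω = (1 + ⌊ω⌋ : ℤ) * TB ω - 1 := by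
  have h1 : Irrational (((1 + ⌊ω⌋ : ℤ) : ℝ) - ω) := h.intCast_sub _
  have h0 := h1.ne_zero
  have hl : ((1 + ⌊ω⌋ : ℤ) : ℝ) - ω < 1 := by
    have h2 : (⌊ω⌋:ℝ) ≤ ω := Int.floor_le ω
    have h3 : (⌊ω⌋:ℝ) ≠ ω := fun e => h ⟨⌊ω⌋, by rw [← e]; simp⟩
    have := lt_of_le_of_ne h2 h3
    push_cast; linarith
  have hp : 0 < ((1 + ⌊ω⌋ : ℤ) : ℝ) - ω := by
    have := Int.lt_floor_add_one ω
    push_cast; linarith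
  refine ⟨?_, ?_, ?_⟩
  · rw [TB, one_div]; exact h1.inv
  · rw [TB, lt_div_iff₀ hp]; linarith
  · rw [TB]
    have : ((1 + ⌊ω⌋ : ℤ) : ℝ) * (1 / (((1 + ⌊ω⌋ : ℤ) : ℝ) - ω)) - ω * (1 / (((1 + ⌊ω⌋ : ℤ) : ℝ) - ω)) = 1 := by
      rw [← sub_mul, mul_one_div_cancel h0]
    linarith

lemma Dm_inv (n : ℕ) (ω : ℝ) (h : Irrational ω) (h1 : 1 < ω) : ∃ q x y p : ℤ, Dm (n + 1) ω = !![y, -p; q, -x] ∧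
    p * q - x * y = 1 ∧ 0 ≤ x ∧ x < q ∧ x ≤ p ∧ q - x ≤ y - p ∧
    ω * (q * TB^[n + 1] ω - x) = y * TB^[n + 1] ω - p := by
  induction n generalizing ω with
  | zero =>
    have ha : 1 ≤ ⌊ω⌋ := by rw [Int.le_floor]; push_cast; linarith
    obtain ⟨t1, t2, t3⟩ := TB_irr ω h
    refine ⟨1, 0, 1 + ⌊ω⌋, 1, ?_, by ring, le_rfl, one_pos, by norm_num, by omega, ?_⟩
    · rw [Dm_succ, Dm_zero, mul_one, Mmat]; simp
    · simp only [zero_add, Function.iterate_one]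
      push_cast at *; linarith
  | succ n ih =>
    have ha : 1 ≤ ⌊ω⌋ := by rw [Int.le_floor]; push_cast; linarith
    obtain ⟨t1, t2, t3⟩ := TB_irr ω h
    obtain ⟨q, x, y, p, i1, i2, i3, i4, i5, i6, i7⟩ := ih (TB ω) t1 t2
    obtain ⟨a, haa⟩ : ∃ a, a = 1 + ⌊ω⌋ := ⟨_, rfl⟩
    rw [← haa] at t3
    have ha2 : 2 ≤ a := by omega
    refine ⟨y, p, a * y - q, a * p - x, ?_, by linarith, by omega, by omega, by nlinarith, by nlinarith, ?_⟩
    · rw [Dm_succ, i1, Mmat, ← haa, Matrix.mul_fin_two]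
      congr 1
      simp; constructor <;> ring
    · rw [← Function.iterate_succ_apply] at i7
      push_cast
      generalize TB^[n + 1 + 1] ω = u at *
      have : ω * (y * u - p) = (ω * TB ω) * (q * u - x) := by rw [mul_assoc, i7]
      rw [this, t3]
      linear_combination (a:ℝ) * i7

def Red (ω : ℝ) : Prop := 1 < ω ∧ ∃ ω' : ℝ, IsConjPair ω ω' ∧ 0 < ω' ∧ ω' < 1

lemma red_periodic (ω : ℝ) (h : Red ω) : ∃ n : ℕ, 0 < n ∧ TB^[n] ω = ω := by
  obtain ⟨hω1, ω', ⟨hirr, A, B, C, hA, _, e1, e2, hne⟩, h0, h1⟩ := h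
  have hAr : (0:ℝ) < A := by exact_mod_cast hA
  have hsum : (A:ℝ) * (ω + ω') = -B := by
    have : (ω - ω') * (A * (ω + ω') + B) = 0 := by linear_combination e1 - e2
    rcases mul_eq_zero.mp this with h | h
    · exact absurd (by linarith) hne
    · linarith
  obtain ⟨s, hs⟩ : ∃ s : ℝ, s = 2 * A * ω + B := ⟨_, rfl⟩
  have hs' : -s = 2 * A * ω' + B := by rw [hs]; linear_combination -2 * hsum
  have hs0 : 0 < s := by nlinarith
  obtain ⟨D, hD⟩ : ∃ D : ℤ, D = B ^ 2 - 4 * A * C := ⟨_, rfl⟩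
  have hsD : s ^ 2 = D := by
    rw [hs, hD]; push_cast; linear_combination 4 * (A:ℝ) * e1
  have hD0 : 0 < D := by
    have : (0:ℝ) < D := by rw [← hsD]; positivity
    exact_mod_cast this
  have hDs : ¬ IsSquare D := by
    rintro ⟨k, hk⟩
    have h3 : s ^ 2 = (k:ℝ) ^ 2 := by rw [hsD, hk]; push_cast; ring
    have h4 : ∃ k' : ℤ, s = k' := by
      rcases sq_eq_sq_iff_eq_or_eq_neg.mp h3 with h | h
      · exact ⟨k, h⟩
      · exact ⟨-k, by rw [h]; push_cast; ring⟩
    obtain ⟨k', hk'⟩ := h4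
    apply hirr
    refine ⟨(k' - B) / (2 * A), ?_⟩
    push_cast
    rw [div_eq_iff (by positivity), ← hk', hs]; ring
  obtain ⟨X0, Y0, hp0, hY0⟩ := Pell.exists_of_not_isSquare hD0 hDs
  obtain ⟨X, Y, hp, hY, hX⟩ : ∃ X Y : ℤ, X ^ 2 - D * Y ^ 2 = 1 ∧ 1 ≤ Y ∧ 1 ≤ X := by
    refine ⟨|X0|, |Y0|, by rw [sq_abs, sq_abs]; exact hp0, Int.one_le_abs hY0, Int.one_le_abs ?_⟩
    intro hx
    rw [hx] at hp0
    nlinarith [sq_nonneg Y0]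
  have hpr : (X:ℝ) ^ 2 - s ^ 2 * (Y:ℝ) ^ 2 = 1 := by rw [hsD]; exact_mod_cast hp
  have hYr : (1:ℝ) ≤ Y := by exact_mod_cast hY
  have hXr : (1:ℝ) ≤ X := by exact_mod_cast hX
  have hlam : 1 < (X:ℝ) + Y * s := by nlinarith
  have hmul : ((X:ℝ) - Y * s) * (X + Y * s) = 1 := by linear_combination hpr
  have hm0 : 0 < (X:ℝ) - Y * s := by
    by_contra hneg; push Not at hneg; nlinarith
  have hm1 : (X:ℝ) - Y * s < 1 := by
    by_contra hneg; push Not at hneg; nlinarith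
  have hq0 : (0:ℝ) < 2 * A * Y := by positivity
  have hx : ((-X - B * Y : ℤ) : ℝ) = (2 * A * Y : ℝ) * ω' - (X - Y * s) := by
    push_cast; linear_combination (Y:ℝ) * hs'
  have hxpos : 0 ≤ -X - B * Y := by
    have : ((-1 : ℤ) : ℝ) < ((-X - B * Y : ℤ) : ℝ) := by
      rw [hx]; push_cast
      have : 0 < 2 * (A:ℝ) * Y * ω' := by positivity
      linarith
    have := Int.cast_lt.mp this
    omega
  have hxlt : -X - B * Y < 2 * A * Y := by
    have : ((-X - B * Y : ℤ) : ℝ) < ((2 * A * Y : ℤ) : ℝ) := by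
      rw [hx]; push_cast
      nlinarith
    exact Int.cast_lt.mp this
  have hden : ((2 * A * Y : ℤ) : ℝ) * ω - ((-X - B * Y : ℤ) : ℝ) = X + Y * s := by
    rw [hs]; push_cast; ring
  obtain ⟨n, hn, hn1, _⟩ := cf_core (2 * A * Y).toNat (2 * A * Y) (-X - B * Y) (X - B * Y) (2 * C * Y) ω ω
    (by rw [Int.toNat_of_nonneg (by positivity)]) hxpos hxlt (by rw [hD] at hp; linear_combination hp) hω1 (by
      rw [eq_div_iff (by rw [hden]; linarith), ]
      push_cast
      linear_combination 2 * (Y:ℝ) * e1)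
  exact ⟨n, hn, hn1⟩

lemma sq4_not (t : ℤ) (ht : 3 ≤ t) : Irrational (Real.sqrt ((t:ℝ) ^ 2 - 4)) := by
  have : ((t:ℝ) ^ 2 - 4) = ((t ^ 2 - 4 : ℤ) : ℝ) := by push_cast; ring
  rw [this, irrational_sqrt_intCast_iff]
  refine ⟨?_, by nlinarith⟩
  rintro ⟨k, hk⟩
  have hk2 : |k| * |k| = t ^ 2 - 4 := by rw [abs_mul_abs_self]; exact hk.symm
  have hk0 := abs_nonneg k
  rcases lt_or_ge |k| t with h | h
  · have : |k| ≤ t - 1 := by omega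
    nlinarith
  · nlinarith

noncomputable def phi (q x y : ℤ) : ℝ := ((y + x : ℝ) + Real.sqrt (((y - x : ℤ) : ℝ) ^ 2 - 4)) / (2 * q)

lemma phi_red (q x y p : ℤ) (hx : 0 ≤ x) (hxq : x < q) (hqy : q < y) (hdet : p * q - x * y = 1) (ht : 3 ≤ y - x) :
    Red (phi q x y) := by
  have hirr := sq4_not (y - x) ht
  obtain ⟨r, hr⟩ : ∃ r, r = Real.sqrt (((y - x : ℤ) : ℝ) ^ 2 - 4) := ⟨_, rfl⟩
  have htr : (3:ℝ) ≤ ((y - x : ℤ) : ℝ) := by exact_mod_cast ht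
  have hr2 : r ^ 2 = ((y - x : ℤ) : ℝ) ^ 2 - 4 := by rw [hr, Real.sq_sqrt]; nlinarith
  have hr0 : 0 ≤ r := by rw [hr]; exact Real.sqrt_nonneg _
  have hq0 : (0:ℝ) < q := by exact_mod_cast (by omega : 0 < q)
  rw [← hr] at hirr
  have hphi : phi q x y = ((y + x : ℝ) + r) / (2 * q) := by rw [phi, hr]
  have hd : (p:ℝ) * q - x * y = 1 := by exact_mod_cast hdet
  have key : (2 * (q:ℝ) - (y + x)) ^ 2 < r ^ 2 := by
    rw [hr2]
    have h2 : (q - x) * (q - y) + 1 < 0 := by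
      have a1 : 1 ≤ q - x := by omega
      have a2 : 1 ≤ y - q := by omega
      rcases eq_or_lt_of_le a1 with h | h
      · have : 2 ≤ y - q := by omega
        nlinarith
      · nlinarith
    have h3 : ((q:ℝ) - x) * (q - y) + 1 < 0 := by exact_mod_cast h2
    push_cast; nlinarith
  have key2 := abs_lt_of_sq_lt_sq key hr0
  rw [abs_lt] at key2
  have hrt : r < ((y - x : ℤ) : ℝ) := by
    by_contra hge; push Not at hge; nlinarith
  push_cast at hrt
  have hxr : (0:ℝ) ≤ x := by exact_mod_cast hx
  have hirr' : Irrational (phi q x y) := by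
    have h5 : phi q x y = (((y + x : ℤ) : ℝ) + r) / ((2 * q : ℤ) : ℝ) := by rw [hphi]; push_cast; ring
    rw [h5]
    exact (hirr.intCast_add _).div_intCast (by omega)
  refine ⟨?_, ((y + x : ℝ) - r) / (2 * q), ⟨hirr', ?_⟩, ?_, ?_⟩
  · rw [hphi, lt_div_iff₀ (by positivity)]; linarith
  · -- primitive polynomial
    set g : ℕ := Int.gcd (Int.gcd q (-(x + y)) : ℤ) p with hg
    have hg1 : (g:ℤ) ∣ q := (Int.gcd_dvd_left _ _).trans (Int.gcd_dvd_left _ _)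
    have hg2 : (g:ℤ) ∣ -(x + y) := (Int.gcd_dvd_left _ _).trans (Int.gcd_dvd_right _ _)
    have hg3 : (g:ℤ) ∣ p := Int.gcd_dvd_right _ _
    have hgpos : 0 < g := by
      rcases Nat.eq_zero_or_pos g with h | h
      · rw [h] at hg1; simp at hg1; omega
      · exact h
    obtain ⟨A, hA⟩ := hg1
    obtain ⟨B, hB⟩ := hg2
    obtain ⟨C, hC⟩ := hg3
    have hgr : (0:ℝ) < g := by exact_mod_cast hgpos
    have eA : (q:ℝ) = g * A := by exact_mod_cast hA
    have eB : -((x:ℝ) + y) = g * B := by exact_mod_cast hB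
    have eC : (p:ℝ) = g * C := by exact_mod_cast hC
    have poly : ∀ e : ℝ, e ^ 2 = r ^ 2 → (A:ℝ) * (((y + x : ℝ) + e) / (2 * q)) ^ 2 + B * (((y + x : ℝ) + e) / (2 * q)) + C = 0 := by
      intro e he
      have h6 : (q:ℝ) * (((y + x : ℝ) + e) / (2 * q)) ^ 2 + -((x:ℝ) + y) * (((y + x : ℝ) + e) / (2 * q)) + p = 0 := by
        field_simp
        rw [hr2] at he; push_cast at he
        linear_combination he + 4 * hd
      rw [eB, eC] at h6
      have h7 : (g:ℝ) * ((A:ℝ) * (((y + x : ℝ) + e) / (2 * q)) ^ 2 + B * (((y + x : ℝ) + e) / (2 * q)) + C) = 0 := by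
        generalize ((y + x : ℝ) + e) / (2 * q) = z at h6 ⊢
        linear_combination h6 - z ^ 2 * eA
      rcases mul_eq_zero.mp h7 with h | h
      · linarith
      · exact h
    refine ⟨A, B, C, ?_, ?_, ?_, ?_, ?_⟩
    · have : 0 < (g:ℤ) * A := by rw [← hA]; omega
      exact pos_of_mul_pos_right this (by positivity)
    · have h8 : Int.gcd (Int.gcd ((g:ℤ) * A) (g * B) : ℤ) (g * C) = g := by rw [← hA, ← hB, ← hC]
      rw [Int.gcd_mul_left] at h8
      rw [Int.natAbs_natCast, Nat.cast_mul, Int.gcd_mul_left, Int.natAbs_natCast] at h8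
      exact Nat.eq_of_mul_eq_mul_left hgpos (by linarith)
    · rw [hphi]; exact poly r rfl
    · have := poly (-r) (by ring)
      rw [← sub_eq_add_neg] at this; exact this
    · rw [hphi]
      intro h
      rw [div_left_inj' (by positivity)] at h
      have : r = 0 := by linarith
      rw [this] at hirr
      exact hirr.ne_zero rfl
  · apply div_pos _ (by positivity); linarith
  · rw [div_lt_one (by positivity)]; linarith

lemma fix_phi (ω : ℝ) (h : Irrational ω) (h1 : 1 < ω) (q x y p : ℤ) (hdet : p * q - x * y = 1) (hx : 0 ≤ x) (hxq : x < q)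
    (hxp : x ≤ p) (hqp : q - x ≤ y - p) (hfix : ω * (q * ω - x) = y * ω - p) :
    q < y ∧ 3 ≤ y - x ∧ ω = phi q x y ∧ q * ω - x = (((y - x : ℤ) : ℝ) + Real.sqrt (((y - x : ℤ) : ℝ) ^ 2 - 4)) / 2 := by
  have hd : (p:ℝ) * q - x * y = 1 := by exact_mod_cast hdet
  have hq0 : (0:ℝ) < q := by exact_mod_cast (by omega : 0 < q)
  obtain ⟨s, hs⟩ : ∃ s : ℝ, s = 2 * q * ω - (x + y) := ⟨_, rfl⟩
  have hs2 : s ^ 2 = ((y - x : ℤ) : ℝ) ^ 2 - 4 := by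
    rw [hs]; push_cast; linear_combination 4 * (q:ℝ) * hfix - 4 * hd
  have hsirr : Irrational s := by
    have : s = ((2 * q : ℤ) : ℝ) * ω - ((x + y : ℤ) : ℝ) := by rw [hs]; push_cast; ring
    rw [this]
    exact (h.intCast_mul (by omega)).sub_intCast _
  have hs0 : 0 < s := by
    by_contra hneg
    push Not at hneg
    have f1 : (q:ℝ) - x - y + p ≤ 0 := by exact_mod_cast (by omega : q - x - y + p ≤ 0)
    have : (q:ℝ) - x - y + p = (1 - ω) * (q * (1 + ω) - (x + y)) := by linear_combination hfix
    have h3 : (q:ℝ) * (1 + ω) - (x + y) < 0 := by nlinarith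
    nlinarith
  have hsq : s = Real.sqrt (((y - x : ℤ) : ℝ) ^ 2 - 4) := by rw [← hs2, Real.sqrt_sq hs0.le]
  have ht : 3 ≤ y - x := by
    have hpos : 0 < y - x := by omega
    by_contra hlt
    have h4 : (4:ℝ) < ((y - x : ℤ) : ℝ) ^ 2 := by nlinarith [sq_pos_of_pos hs0]
    have h5 : 4 < (y - x) ^ 2 := by exact_mod_cast h4
    nlinarith
  refine ⟨?_, ht, ?_, ?_⟩
  · rcases eq_or_lt_of_le (by omega : q ≤ y) with hqy | hqy
    · exfalso
      rw [← hqy] at hdet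
      have : q * (p - x) = 1 := by linarith
      have := Int.eq_one_or_neg_one_of_mul_eq_one this
      omega
    · exact hqy
  · rw [phi, ← hsq, hs]; field_simp; ring
  · rw [← hsq, hs]; push_cast; ring

lemma red_per (ω : ℝ) (h : Red ω) : 0 < perB ω ∧ TB^[perB ω] ω = ω := by
  have : perB ω ∈ {n : ℕ | 0 < n ∧ TB^[n] ω = ω} := Nat.sInf_mem (red_periodic ω h)
  exact this

lemma red_tau (ω : ℝ) (h : Red ω) : ∃ q x y p : ℤ, OmegaB ω = !![y, -p; q, -x] ∧ p * q - x * y = 1 ∧ 0 ≤ x ∧ x < q ∧ q < y ∧ 3 ≤ y - x ∧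
    ω = phi q x y ∧ specRad (OmegaB ω) = q * ω - x := by
  obtain ⟨hp, hper⟩ := red_per ω h
  have h1 := h.1
  have hirr : Irrational ω := by obtain ⟨_, _, h, _⟩ := h; exact h.1
  obtain ⟨n, hn⟩ : ∃ n, perB ω = n + 1 := ⟨perB ω - 1, by omega⟩
  obtain ⟨q, x, y, p, i1, i2, i3, i4, i5, i6, i7⟩ := Dm_inv n ω hirr h1
  rw [← hn] at i1 i7
  rw [hper] at i7
  obtain ⟨j1, j2, j3, j4⟩ := fix_phi ω hirr h1 q x y p i2 i3 i4 i5 i6 i7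
  refine ⟨q, x, y, p, i1, i2, i3, i4, j1, j2, j3, ?_⟩
  rw [OmegaB_eq, i1, specRad, Matrix.trace_fin_two, j4]
  simp [sub_eq_add_neg]

/-- every triple is a power of Omega -/
lemma triple_pow (q x y p : ℤ) (hx : 0 ≤ x) (hxq : x < q) (hqy : q < y) (hdet : p * q - x * y = 1) (ht : 3 ≤ y - x) :
    ∃ k : ℕ, 0 < k ∧ !![y, -p; q, -x] = OmegaB (phi q x y) ^ k := by
  have hred := phi_red q x y p hx hxq hqy hdet ht
  obtain ⟨hp, hper⟩ := red_per _ hred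
  obtain ⟨r, hr⟩ : ∃ r, r = Real.sqrt (((y - x : ℤ) : ℝ) ^ 2 - 4) := ⟨_, rfl⟩
  have htr : (3:ℝ) ≤ ((y - x : ℤ) : ℝ) := by exact_mod_cast ht
  have hr2 : r ^ 2 = ((y - x : ℤ) : ℝ) ^ 2 - 4 := by rw [hr, Real.sq_sqrt]; nlinarith
  have hr0 : 0 ≤ r := by rw [hr]; exact Real.sqrt_nonneg _
  have hq0 : (0:ℝ) < q := by exact_mod_cast (by omega : 0 < q)
  have hd : (p:ℝ) * q - x * y = 1 := by exact_mod_cast hdet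
  have hphi : phi q x y = ((y + x : ℝ) + r) / (2 * q) := by rw [phi, hr]
  have hden : (q:ℝ) * phi q x y - x = (((y - x : ℤ) : ℝ) + r) / 2 := by
    rw [hphi]; push_cast; field_simp; ring
  obtain ⟨n, hn, hn1, hn2⟩ := cf_core q.toNat q x y p (phi q x y) (phi q x y) (by rw [Int.toNat_of_nonneg (by omega)]) hx hxq hdet hred.1 (by
    rw [eq_div_iff (by rw [hden]; positivity), hden, hphi]
    push_cast at hr2 ⊢
    field_simp
    linear_combination hr2 + 4 * hd)
  have hmp : perB (phi q x y) = Function.minimalPeriod TB (phi q x y) := by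
    apply le_antisymm
    · apply Nat.sInf_le
      refine ⟨Function.IsPeriodicPt.minimalPeriod_pos hn hn1, Function.iterate_minimalPeriod⟩
    · exact Function.IsPeriodicPt.minimalPeriod_le hp hper
  have hdvd : perB (phi q x y) ∣ n := by
    rw [hmp]; exact Function.IsPeriodicPt.minimalPeriod_dvd hn1
  obtain ⟨k, hk⟩ := hdvd
  refine ⟨k, ?_, ?_⟩
  · rcases Nat.eq_zero_or_pos k with h | h
    · rw [h] at hk; simp at hk; omega
    · exact h
  · rw [← hn2, hk, Dm_mul _ _ _ hper, OmegaB_eq]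

lemma eig_pow (M : Matrix (Fin 2) (Fin 2) ℤ) (ω l : ℝ) (h0 : (M 0 0 : ℝ) * ω + M 0 1 = l * ω)
    (h1 : (M 1 0 : ℝ) * ω + M 1 1 = l) (k : ℕ) :
    (((M ^ k) 0 0 : ℤ) : ℝ) * ω + ((M ^ k) 0 1 : ℤ) = l ^ k * ω ∧ (((M ^ k) 1 0 : ℤ) : ℝ) * ω + ((M ^ k) 1 1 : ℤ) = l ^ k := by
  induction k with
  | zero => simp
  | succ k ih =>
    obtain ⟨i0, i1⟩ := ih
    rw [pow_succ]
    simp only [Matrix.mul_apply, Fin.sum_univ_two]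
    push_cast
    constructor
    · linear_combination (((M ^ k) 0 0 : ℤ) : ℝ) * h0 + (((M ^ k) 0 1 : ℤ) : ℝ) * h1 + l * i0
    · linear_combination (((M ^ k) 1 0 : ℤ) : ℝ) * h0 + (((M ^ k) 1 1 : ℤ) : ℝ) * h1 + l * i1

/-- basic facts about phi -/
lemma phi_facts (q x y p : ℤ) (hq : 0 < q) (hdet : p * q - x * y = 1) (ht : 3 ≤ y - x) :
    phi q x y * (q * phi q x y - x) = y * phi q x y - p ∧
    2 ≤ (q:ℝ) * phi q x y - x ∧ (q:ℝ) * phi q x y - x < y - x ∧ (y:ℝ) - x ≤ (q * phi q x y - x) + 1 ∧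
    (q * phi q x y - x) + (q * phi q x y - x)⁻¹ = y - x := by
  obtain ⟨r, hr⟩ : ∃ r, r = Real.sqrt (((y - x : ℤ) : ℝ) ^ 2 - 4) := ⟨_, rfl⟩
  have htr : (3:ℝ) ≤ ((y - x : ℤ) : ℝ) := by exact_mod_cast ht
  have hr2 : r ^ 2 = ((y - x : ℤ) : ℝ) ^ 2 - 4 := by rw [hr, Real.sq_sqrt]; nlinarith
  have hr0 : 0 ≤ r := by rw [hr]; exact Real.sqrt_nonneg _
  have hq0 : (0:ℝ) < q := by exact_mod_cast hq
  have hd : (p:ℝ) * q - x * y = 1 := by exact_mod_cast hdet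
  have hphi : phi q x y = ((y + x : ℝ) + r) / (2 * q) := by rw [phi, hr]
  push_cast at hr2 htr
  have hden : (q:ℝ) * phi q x y - x = ((y - x : ℝ) + r) / 2 := by
    rw [hphi]; field_simp; ring
  have hrt : r < (y:ℝ) - x := by
    by_contra hge; push Not at hge; nlinarith
  have hr1 : 1 ≤ r := by nlinarith
  have hrt2 : (y:ℝ) - x ≤ r + 2 := by nlinarith
  rw [hden]
  refine ⟨?_, by linarith, by linarith, by linarith, ?_⟩
  · rw [hphi]; field_simp; linear_combination hr2 + 4 * hd
  · have : ((y - x : ℝ) + r) ≠ 0 := by linarith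
    field_simp; linear_combination hr2

lemma add_inv_le (a b : ℝ) (ha : 1 ≤ a) (hb : 1 ≤ b) : a + a⁻¹ ≤ b + b⁻¹ ↔ a ≤ b := by
  have key : (b + b⁻¹) - (a + a⁻¹) = (b - a) * (1 - (a * b)⁻¹) := by
    have : a ≠ 0 := by linarith
    have : b ≠ 0 := by linarith
    field_simp; ring
  constructor
  · intro h
    by_contra hlt
    push Not at hlt
    have h1 : (a * b)⁻¹ < 1 := by apply inv_lt_one_of_one_lt₀; nlinarith
    nlinarith
  · intro h
    have h1 : (a * b)⁻¹ ≤ 1 := by apply inv_le_one_of_one_le₀; nlinarith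
    nlinarith

noncomputable def PP (α : ℝ) (W : ℕ) : Finset ((_ : ℕ) × (_ : ℕ) × ℕ) :=
  (Finset.Icc 1 ⌊(W:ℝ) / (α - 1)⌋₊).sigma fun q => (Finset.range q).sigma fun x =>
    (Finset.Ico ⌈α * q⌉₊ (W + x + 1)).filter (fun y => q ∣ x * y + 1)

lemma PP_card (α : ℝ) (W : ℕ) : (PP α W).card = ∑ q ∈ Finset.Icc 1 ⌊(W:ℝ) / (α - 1)⌋₊, cnt q ⌈α * q⌉₊ W := by
  rw [PP, Finset.card_sigma]
  apply Finset.sum_congr rfl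
  intro q _
  rw [Finset.card_sigma, cnt]

noncomputable def ph (v : (_ : ℕ) × (_ : ℕ) × ℕ) : ℝ := phi v.1 v.2.1 v.2.2

noncomputable def AF (α : ℝ) (W : ℕ) : Finset ((_ : ℕ) × (_ : ℕ) × ℕ) :=
  open Classical in (PP α W).filter (fun v => v.1 < v.2.2 ∧ v.2.1 + 3 ≤ v.2.2 ∧ α ≤ ph v)

lemma mem_PP (α : ℝ) (W q x y : ℕ) : (⟨q, x, y⟩ : (_ : ℕ) × (_ : ℕ) × ℕ) ∈ PP α W ↔
    (1 ≤ q ∧ q ≤ ⌊(W:ℝ) / (α - 1)⌋₊) ∧ x < q ∧ (⌈α * q⌉₊ ≤ y ∧ y < W + x + 1) ∧ q ∣ x * y + 1 := by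
  simp [PP]

lemma mem_AF (α : ℝ) (hα : 1 < α) (W q x y : ℕ) : (⟨q, x, y⟩ : (_ : ℕ) × (_ : ℕ) × ℕ) ∈ AF α W ↔
    x < q ∧ q < y ∧ q ∣ x * y + 1 ∧ x + 3 ≤ y ∧ y ≤ W + x ∧ α ≤ phi q x y := by
  rw [AF, Finset.mem_filter, mem_PP]
  simp only [ph]
  constructor
  · rintro ⟨⟨_, h1, h2, h3⟩, h4, h5, h6⟩
    exact ⟨h1, h4, h3, h5, by omega, h6⟩
  · rintro ⟨h1, h2, h3, h4, h5, h6⟩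
    obtain ⟨p, hp⟩ := h3
    obtain ⟨f1, f2, f3, f4, f5⟩ := phi_facts q x y p (by omega) (by
      have : ((x * y + 1 : ℕ) : ℤ) = ((q * p : ℕ) : ℤ) := by rw [hp]
      push_cast at this; linarith) (by omega)
    push_cast at f3
    have hq0 : (0:ℝ) < q := by exact_mod_cast (by omega : 0 < q)
    have h7 : α * q ≤ y := by nlinarith
    have h5r : (y:ℝ) ≤ W + x := by exact_mod_cast h5
    have h1r : (x:ℝ) + 1 ≤ q := by exact_mod_cast h1
    refine ⟨⟨⟨by omega, ?_⟩, h1, ⟨Nat.ceil_le.mpr h7, by omega⟩, ⟨p, hp⟩⟩, h2, h4, h6⟩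
    apply Nat.le_floor
    rw [le_div_iff₀ (by linarith)]
    nlinarith

/-- integer triple into AF -/
lemma int_AF (α : ℝ) (hα : 1 < α) (W : ℕ) (q x y p : ℤ) (hdet : p * q - x * y = 1) (hx : 0 ≤ x) (hxq : x < q) (hqy : q < y)
    (ht : 3 ≤ y - x) (hW : y - x ≤ W) (h : α ≤ phi q x y) :
    ∃ v ∈ AF α W, ph v = phi q x y ∧ (v.1 : ℤ) = q ∧ (v.2.1 : ℤ) = x ∧ (v.2.2 : ℤ) = y := by
  obtain ⟨q', rfl⟩ := Int.eq_ofNat_of_zero_le (by omega : 0 ≤ q)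
  obtain ⟨x', rfl⟩ := Int.eq_ofNat_of_zero_le hx
  obtain ⟨y', rfl⟩ := Int.eq_ofNat_of_zero_le (by omega : 0 ≤ y)
  refine ⟨⟨q', x', y'⟩, ?_, rfl, rfl, rfl, rfl⟩
  rw [mem_AF α hα]
  refine ⟨by omega, by omega, ?_, by omega, by omega, h⟩
  have : (q' : ℤ) ∣ ((x' * y' + 1 : ℕ) : ℤ) := ⟨p, by push_cast; linarith⟩
  exact_mod_cast this

def SS (α R : ℝ) : Set ℝ := {ω : ℝ | 1 < ω ∧ α ≤ ω ∧ rhoB ω ≤ R ∧ ∃ ω' : ℝ, IsConjPair ω ω' ∧ 0 < ω' ∧ ω' < 1}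

lemma mem_SS (α R ω : ℝ) : ω ∈ SS α R ↔ Red ω ∧ α ≤ ω ∧ rhoB ω ≤ R := by
  simp only [SS, Red, Set.mem_setOf_eq]; tauto

/-- the trace criterion -/
lemma rho_crit (R : ℝ) (hR : 0 < R) (l t : ℝ) (ti : ℤ) (hti : (ti:ℝ) = t) (hl : 2 ≤ l) (ht : l + l⁻¹ = t) (h3 : 3 ≤ ti) :
    2 * Real.log l ≤ R ↔ ti ≤ ⌊Real.exp (R/2) + (Real.exp (R/2))⁻¹⌋₊ := by
  have h1 : 2 * Real.log l ≤ R ↔ l ≤ Real.exp (R/2) := by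
    rw [← Real.log_le_iff_le_exp (by linarith)]
    constructor <;> intro h <;> linarith
  have hN : 1 ≤ Real.exp (R/2) := Real.one_le_exp (by linarith)
  rw [h1, ← add_inv_le l _ (by linarith) hN, ht, ← hti]
  obtain ⟨n, rfl⟩ := Int.eq_ofNat_of_zero_le (by omega : 0 ≤ ti)
  rw [Nat.cast_le, Nat.le_floor_iff (by positivity)]
  simp

lemma SS_sub (α : ℝ) (hα : 1 < α) (R : ℝ) (hR : 0 < R) (W : ℕ) (hW : W = ⌊Real.exp (R/2) + (Real.exp (R/2))⁻¹⌋₊) :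
    SS α R ⊆ ((AF α W).image ph : Finset ℝ) := by
  intro ω hω
  rw [mem_SS] at hω
  obtain ⟨hr, hα', hrho⟩ := hω
  obtain ⟨q, x, y, p, h1, h2, h3, h4, h5, h6, h7, h8⟩ := red_tau ω hr
  obtain ⟨f1, f2, f3, f4, f5⟩ := phi_facts q x y p (by omega) h2 h6
  rw [← h7] at f1 f2 f3 f4 f5
  rw [rhoB, h8] at hrho
  rw [rho_crit R hR _ _ (y - x) (by push_cast; rfl) f2 f5 h6, ← hW] at hrho
  obtain ⟨v, hv, hv2, _⟩ := int_AF α hα W q x y p h2 h3 h4 h5 h6 hrho (by rw [← h7]; exact hα')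
  rw [Finset.coe_image]
  exact ⟨v, hv, by rw [hv2, h7]⟩

lemma SS_le (α : ℝ) (hα : 1 < α) (R : ℝ) (hR : 0 < R) (W : ℕ) (hW : W = ⌊Real.exp (R/2) + (Real.exp (R/2))⁻¹⌋₊) :
    (SS α R).Finite ∧ (SS α R).ncard ≤ (AF α W).card := by
  have h := SS_sub α hα R hR W hW
  refine ⟨(Finset.finite_toSet _).subset h, ?_⟩
  calc (SS α R).ncard ≤ (((AF α W).image ph : Finset ℝ) : Set ℝ).ncard := Set.ncard_le_ncard h (Finset.finite_toSet _)
    _ = ((AF α W).image ph).card := Set.ncard_coe_finset _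
    _ ≤ _ := Finset.card_image_le

lemma AF_info (α : ℝ) (hα : 1 < α) (W : ℕ) (v : (_ : ℕ) × (_ : ℕ) × ℕ) (hv : v ∈ AF α W) :
    Red (ph v) ∧ ∃ k : ℕ, 0 < k ∧ (∃ p : ℤ, !![(v.2.2 : ℤ), -p; (v.1 : ℤ), -(v.2.1 : ℤ)] = OmegaB (ph v) ^ k) ∧
     α ≤ ph v ∧ 2 ^ k ≤ W ∧ (2 ≤ k → ∃ u ∈ AF α (Nat.sqrt W + 1), ph u = ph v) ∧
     (k = 1 → ∀ R > 0, W = ⌊Real.exp (R/2) + (Real.exp (R/2))⁻¹⌋₊ → rhoB (ph v) ≤ R) := by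
  obtain ⟨q, x, y⟩ := v
  rw [mem_AF α hα] at hv
  obtain ⟨h1, h2, ⟨p, hp⟩, h4, h5, h6⟩ := hv
  have hdet : (p:ℤ) * q - x * y = 1 := by
    have : ((x * y + 1 : ℕ) : ℤ) = ((q * p : ℕ) : ℤ) := by rw [hp]
    push_cast at this; linarith
  have hred := phi_red q x y p (by omega) (by omega) (by omega) hdet (by omega)
  have hph : ph ⟨q, x, y⟩ = phi q x y := rfl
  rw [hph]
  refine ⟨hred, ?_⟩
  obtain ⟨k, hk, hkM⟩ := triple_pow q x y p (by omega) (by omega) (by omega) hdet (by omega)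
  obtain ⟨q', x', y', p', g1, g2, g3, g4, g5, g6, g7, g8⟩ := red_tau _ hred
  obtain ⟨f1, f2, f3, f4, f5⟩ := phi_facts q x y p (by omega) hdet (by omega)
  obtain ⟨e1, e2, e3, e4, e5⟩ := phi_facts q' x' y' p' (by omega) g2 g6
  rw [← g7] at e1 e2 e3 e4 e5
  clear hph
  generalize phi (q:ℤ) (x:ℤ) (y:ℤ) = ω at *
  have hpow := (eig_pow (OmegaB ω) ω (q' * ω - x') (by rw [g1]; simp; linear_combination -e1) (by rw [g1]; simp; ring) k).2
  rw [← hkM] at hpow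
  simp at hpow
  have hlam : (q:ℝ) * ω - x = (q' * ω - x') ^ k := by rw [← hpow]; ring
  push_cast at f1 f2 f3 f4 f5
  have hWr : (y:ℝ) - x ≤ W := by
    have : (y:ℝ) ≤ W + x := by exact_mod_cast h5
    linarith
  refine ⟨k, hk, ⟨p, hkM⟩, h6, ?_, ?_, ?_⟩
  · have : (2:ℝ) ^ k ≤ W := by
      calc (2:ℝ) ^ k ≤ (q' * ω - x') ^ k := by gcongr
        _ ≤ W := by rw [← hlam]; linarith
    exact_mod_cast this
  · intro hk2
    have h7 : (q' * ω - x') ^ 2 ≤ (W:ℝ) := by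
      calc (q' * ω - x') ^ 2 ≤ (q' * ω - x') ^ k := by apply pow_le_pow_right₀ (by linarith) hk2
        _ ≤ W := by rw [← hlam]; linarith
    have h8 : ((y' - x' - 1 : ℤ) : ℝ) ^ 2 ≤ W := by
      push_cast
      have : (3:ℝ) ≤ y' - x' := by exact_mod_cast g6
      nlinarith
    obtain ⟨m, hm⟩ := Int.eq_ofNat_of_zero_le (by omega : 0 ≤ y' - x' - 1)
    rw [hm] at h8
    have h9 : m ^ 2 ≤ W := by exact_mod_cast h8
    have h10 : m ≤ Nat.sqrt W := Nat.le_sqrt'.mpr h9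
    obtain ⟨u, hu, hu2, _⟩ := int_AF α hα (Nat.sqrt W + 1) q' x' y' p' g2 g3 g4 g5 g6 (by push_cast; omega) (by rw [← g7]; exact h6)
    exact ⟨u, hu, by rw [hu2, g7]⟩
  · intro hk1 R hR hW
    rw [hk1, pow_one] at hlam
    rw [rhoB, g8, rho_crit R hR _ _ (y' - x') (by push_cast; rfl) e2 e5 g6, ← hW]
    have h11 : (y':ℝ) - x' = y - x := by rw [← e5, ← f5, hlam]
    have h12 : y' - x' = (y:ℤ) - x := by exact_mod_cast h11
    omega

lemma AF_le (α : ℝ) (hα : 1 < α) (R : ℝ) (hR : 0 < R) (W : ℕ) (hW : W = ⌊Real.exp (R/2) + (Real.exp (R/2))⁻¹⌋₊) :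
    (AF α W).card ≤ (SS α R).ncard + (AF α (Nat.sqrt W + 1)).card * (Nat.log 2 W + 1) := by
  classical
  have hinfo := AF_info α hα W
  choose! hred k hk0 hkM hka hkW hk2 hk1 using hinfo
  rw [← Finset.card_filter_add_card_filter_not (s := AF α W) (fun v => k v = 1)]
  have hinj : ∀ v ∈ AF α W, ∀ u ∈ AF α W, ph v = ph u → k v = k u → v = u := by
    intro v hv u hu h1 h2
    obtain ⟨p, hp⟩ := hkM v hv
    obtain ⟨p', hp'⟩ := hkM u hu
    rw [h1, h2, ← hp'] at hp
    have a0 := congrFun (congrFun hp 0) 0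
    have a1 := congrFun (congrFun hp 1) 0
    have a2 := congrFun (congrFun hp 1) 1
    simp at a0 a1 a2
    obtain ⟨q, x, y⟩ := v
    obtain ⟨q', x', y'⟩ := u
    simp only at a0 a1 a2
    subst a0 a1 a2; rfl
  apply add_le_add
  · rw [← Finset.card_image_of_injOn (f := ph), ← Set.ncard_coe_finset]
    · apply Set.ncard_le_ncard _ (SS_le α hα R hR W hW).1
      intro ω hω
      rw [Finset.coe_image] at hω
      obtain ⟨v, hv, rfl⟩ := hω
      simp only [Finset.coe_filter, Set.mem_setOf_eq] at hv
      rw [mem_SS]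
      exact ⟨hred v hv.1, hka v hv.1, hk1 v hv.1 hv.2 R hR hW⟩
    · intro v hv u hu h
      simp only [Finset.coe_filter, Set.mem_setOf_eq] at hv hu
      exact hinj v hv.1 u hu.1 h (by rw [hv.2, hu.2])
  · rw [← Finset.card_image_of_injOn (f := fun v => (ph v, k v))]
    · calc _ ≤ (((AF α (Nat.sqrt W + 1)).image ph) ×ˢ Finset.range (Nat.log 2 W + 1)).card := by
            apply Finset.card_le_card
            intro z hz
            rw [Finset.mem_image] at hz
            obtain ⟨v, hv, rfl⟩ := hz
            rw [Finset.mem_filter] at hv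
            rw [Finset.mem_product, Finset.mem_image, Finset.mem_range]
            refine ⟨hk2 v hv.1 ?_, ?_⟩
            · have := hk0 v hv.1
              have := hv.2
              omega
            · have := hkW v hv.1
              exact Nat.lt_succ_of_le (Nat.le_log_of_pow_le (by norm_num) this)
        _ ≤ _ := by
            rw [Finset.card_product, Finset.card_range]
            exact Nat.mul_le_mul_right _ Finset.card_image_le
    · intro v hv u hu h
      simp only [Finset.coe_filter, Set.mem_setOf_eq] at hv hu
      simp only [Prod.mk.injEq] at h
      exact hinj v hv.1 u hu.1 h.1 h.2

lemma AF_le_PP (α : ℝ) (W : ℕ) : (AF α W).card ≤ (PP α W).card := by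
  rw [AF]; exact Finset.card_filter_le _ _

lemma x_unique (q x x' y : ℕ) (hx : x < q) (hx' : x' < q) (h : q ∣ x * y + 1) (h' : q ∣ x' * y + 1) : x = x' := by
  have hc : Nat.Coprime q y := by
    have h1 : Nat.gcd q y ∣ x * y + 1 := (Nat.gcd_dvd_left _ _).trans h
    have h2 : Nat.gcd q y ∣ x * y := (Nat.gcd_dvd_right _ _).mul_left _
    exact Nat.dvd_one.mp ((Nat.dvd_add_right h2).mp h1)
  have h3 : x * y + 1 ≡ x' * y + 1 [MOD q] := by
    exact ((Nat.modEq_zero_iff_dvd).mpr h).trans ((Nat.modEq_zero_iff_dvd).mpr h').symm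
  have h4 : x * y ≡ x' * y [MOD q] := Nat.ModEq.add_right_cancel' 1 h3
  have h5 : x ≡ x' [MOD q] := Nat.ModEq.cancel_right_of_coprime hc h4
  exact Nat.ModEq.eq_of_lt_of_lt h5 hx hx'

lemma PP_le (α : ℝ) (hα : 1 < α) (W : ℕ) : (PP α W).card ≤ (AF α W).card + 2 * ⌊(W:ℝ) / (α - 1)⌋₊ := by
  classical
  set Q := ⌊(W:ℝ) / (α - 1)⌋₊ with hQ
  have hsub : PP α W ⊆ AF α W ∪ ((PP α W).filter (fun v => v.2.2 = ⌈α * v.1⌉₊) ∪ (PP α W).filter (fun v => v.2.2 = v.1 + 1)) := by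
    rintro ⟨q, x, y⟩ hv
    rw [Finset.mem_union, Finset.mem_union, Finset.mem_filter, Finset.mem_filter, mem_AF α hα]
    by_contra hcon
    push Not at hcon
    obtain ⟨c1, c2, c3⟩ := hcon
    have c2 := c2 hv
    have c3 := c3 hv
    simp only at c2 c3
    rw [mem_PP] at hv
    obtain ⟨⟨h1, h2⟩, h3, ⟨h4, h5⟩, ⟨p, hp⟩⟩ := hv
    have hq0 : (0:ℝ) < q := by exact_mod_cast (by omega : 0 < q)
    have h6 : q < y := by
      have : α * q ≤ y := Nat.ceil_le.mp h4
      have : (q:ℝ) < y := by nlinarith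
      exact_mod_cast this
    have h7 : x + 3 ≤ y := by omega
    have hlt := c1 h3 h6 ⟨p, hp⟩ h7 (by omega)
    obtain ⟨f1, f2, f3, f4, f5⟩ := phi_facts q x y p (by omega) (by
      have : ((x * y + 1 : ℕ) : ℤ) = ((q * p : ℕ) : ℤ) := by rw [hp]
      push_cast at this; linarith) (by omega)
    push_cast at f4
    have h8 : ⌈α * q⌉₊ ≤ y - 1 := by omega
    have h9 := Nat.ceil_le.mp h8
    rw [Nat.cast_sub (by omega)] at h9
    push_cast at h9
    nlinarith
  have hQb : ∀ f : ℕ → ℕ, ((PP α W).filter (fun v => v.2.2 = f v.1)).card ≤ Q := by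
    intro f
    rw [← Finset.card_image_of_injOn (f := fun v => v.1)]
    · calc _ ≤ (Finset.Icc 1 Q).card := by
            apply Finset.card_le_card
            intro z hz
            rw [Finset.mem_image] at hz
            obtain ⟨⟨q, x, y⟩, hv, rfl⟩ := hz
            rw [Finset.mem_filter, mem_PP] at hv
            rw [Finset.mem_Icc]
            exact hv.1.1
        _ = Q := by simp
    · rintro ⟨q, x, y⟩ hv ⟨q', x', y'⟩ hu h
      simp only [Finset.coe_filter, Set.mem_setOf_eq, mem_PP] at hv hu h
      subst h
      obtain ⟨⟨_, h1, _, h2⟩, h3⟩ := hv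
      obtain ⟨⟨_, g1, _, g2⟩, g3⟩ := hu
      have hy : y = y' := by rw [h3, g3]
      subst hy
      have := x_unique q x x' y h1 g1 h2 g2
      subst this; rfl
  calc (PP α W).card ≤ _ := Finset.card_le_card hsub
    _ ≤ _ := Finset.card_union_le _ _
    _ ≤ (AF α W).card + 2 * Q := by
      have := Finset.card_union_le ((PP α W).filter (fun v => v.2.2 = ⌈α * v.1⌉₊)) ((PP α W).filter (fun v => v.2.2 = v.1 + 1))
      have h1 := hQb (fun q => ⌈α * q⌉₊)
      have h2 := hQb (fun q => q + 1)
      omega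

lemma log2_sqrt (W : ℕ) (hW : 1 ≤ W) : ((Nat.log 2 W : ℝ) + 1) ≤ 2 * Real.sqrt W := by
  have h1 : ∀ m : ℕ, (m + 1) ^ 2 ≤ 4 * 2 ^ m := by
    have : ∀ m : ℕ, (m + 1) ^ 2 ≤ 4 * 2 ^ m ∧ (m + 2) ^ 2 ≤ 4 * 2 ^ (m + 1) ∧ 2 * m + 5 ≤ 4 * 2 ^ (m + 1) := by
      intro m
      induction m with
      | zero => norm_num
      | succ m ih =>
        obtain ⟨a, b, c⟩ := ih
        have e : 2 ^ (m + 1 + 1) = 2 * 2 ^ (m + 1) := by ring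
        refine ⟨b, ?_, by rw [e]; omega⟩
        rw [e]; nlinarith
    exact fun m => (this m).1
  have h2 := Nat.pow_log_le_self 2 (by omega : W ≠ 0)
  have h3 : (Nat.log 2 W + 1) ^ 2 ≤ 4 * W := (h1 _).trans (by omega)
  have h4 : ((Nat.log 2 W : ℝ) + 1) ^ 2 ≤ 4 * W := by exact_mod_cast h3
  have h5 : (2 * Real.sqrt W) ^ 2 = 4 * W := by rw [mul_pow, Real.sq_sqrt (by positivity)]; norm_num
  rw [← h5] at h4
  exact le_of_sq_le_sq h4 (by positivity)

set_option maxHeartbeats 1000000 in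
lemma main_bound (α : ℝ) (hα : 1 < α) (ε : ℝ) (hε : 0 < ε) : ∃ K > (0:ℝ), ∀ R > (0:ℝ),
    |((SS α R).ncard : ℝ) - Real.exp R / (2 * (Real.pi ^ 2 / 6)) * Real.log (α / (α - 1))| ≤ K * Real.exp ((3/4+ε) * R) := by
  obtain ⟨C1, hC1, H1⟩ := cnt_total α hα (2 * ε) (by positivity)
  obtain ⟨C2, hC2, H2⟩ := cnt_total α hα (1 / 2) (by positivity)
  have hα0 : 0 < α - 1 := by linarith
  obtain ⟨L, hL⟩ : ∃ L, L = Real.log (α / (α - 1)) * (3 / Real.pi ^ 2) := ⟨_, rfl⟩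
  have hL0 : 0 < L := by
    rw [hL]
    apply mul_pos
    · apply Real.log_pos; rw [lt_div_iff₀ hα0]; linarith
    · positivity
  have P2 : ∀ V : ℕ, 1 ≤ V → ((PP α V).card : ℝ) ≤ (L + C2) * (V:ℝ) ^ 2 := by
    intro V hV
    have := H2 V _ hV rfl
    rw [← PP_card, mul_assoc, ← hL] at this
    have h3 : ((V:ℝ)) ^ ((3:ℝ)/2 + 1/2) = (V:ℝ) ^ 2 := by
      rw [← Real.rpow_natCast]; norm_num
    rw [h3] at this
    have := (abs_le.mp this).2
    linarith
  obtain ⟨e, he⟩ : ∃ e : ℝ, e = 3 / 2 + 2 * ε := ⟨_, rfl⟩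
  refine ⟨(C1 + 2 / (α - 1) + 8 * (L + C2) + 2 * L) * 2 ^ e, by positivity, ?_⟩
  intro R hR
  obtain ⟨N, hN⟩ : ∃ N, N = Real.exp (R / 2) := ⟨_, rfl⟩
  have hN1 : 1 ≤ N := by rw [hN]; exact Real.one_le_exp (by linarith)
  obtain ⟨W, hW⟩ : ∃ W : ℕ, W = ⌊N + N⁻¹⌋₊ := ⟨_, rfl⟩
  have hNi0 : 0 < N⁻¹ := by positivity
  have hNi : N⁻¹ ≤ 1 := inv_le_one_of_one_le₀ hN1
  have hWN : (W:ℝ) ≤ N + N⁻¹ := by rw [hW]; exact Nat.floor_le (by positivity)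
  have hWN2 : N + N⁻¹ < W + 1 := by rw [hW]; exact Nat.lt_floor_add_one _
  have hW1 : 1 ≤ W := by rw [hW]; apply Nat.le_floor; push_cast; linarith
  have hW1r : (1:ℝ) ≤ W := by exact_mod_cast hW1
  have hexpR : Real.exp R = N ^ 2 := by rw [hN, ← Real.exp_nat_mul]; congr 1; push_cast; ring
  have hNe : Real.exp ((3/4+ε) * R) = N ^ e := by
    rw [hN, ← Real.exp_mul, he]; congr 1; ring
  have hmain : Real.exp R / (2 * (Real.pi ^ 2 / 6)) * Real.log (α / (α - 1)) = N ^ 2 * L := by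
    rw [hexpR, hL]
    have := Real.pi_ne_zero
    field_simp; ring
  rw [hmain, hNe]
  obtain ⟨X, hX⟩ : ∃ X, X = 2 * N := ⟨_, rfl⟩
  have hX1 : 1 ≤ X := by linarith
  have hWX : (W:ℝ) ≤ X := by linarith
  have hXe : (2:ℝ) ^ e * N ^ e = X ^ e := by rw [hX, Real.mul_rpow (by norm_num) (by linarith)]
  rw [mul_assoc, hXe]
  have e1 : X ≤ X ^ e := by
    conv_lhs => rw [← Real.rpow_one X]
    exact Real.rpow_le_rpow_of_exponent_le hX1 (by rw [he]; linarith)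
  have e2 : (W:ℝ) * Real.sqrt W ≤ X ^ e := by
    have : (W:ℝ) * Real.sqrt W = (W:ℝ) ^ ((3:ℝ)/2) := by
      rw [Real.sqrt_eq_rpow, ← Real.rpow_one_add' (by positivity) (by norm_num)]; norm_num
    rw [this]
    exact (Real.rpow_le_rpow_of_exponent_le hW1r (by rw [he]; linarith)).trans (Real.rpow_le_rpow (by positivity) hWX (by rw [he]; positivity))
  have e3 : (W:ℝ) ^ e ≤ X ^ e := Real.rpow_le_rpow (by positivity) hWX (by rw [he]; positivity)
  have b1 := H1 W _ hW1 rfl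
  rw [← PP_card, mul_assoc, ← hL, ← he] at b1
  have b1' := abs_le.mp b1
  rw [hN] at hW
  have b2 := (SS_le α hα R hR W hW).2
  have b3 := AF_le α hα R hR W hW
  have b4 := AF_le_PP α W
  have b5 := PP_le α hα W
  have b6 := AF_le_PP α (Nat.sqrt W + 1)
  have b7 := P2 (Nat.sqrt W + 1) (by omega)
  have b8 := log2_sqrt W hW1
  have hs : (((Nat.sqrt W + 1 : ℕ) : ℝ)) ^ 2 ≤ 4 * W := by
    have h1 : Nat.sqrt W ^ 2 ≤ W := Nat.sqrt_le' W
    have h2 : (Nat.sqrt W + 1) ^ 2 ≤ 4 * W := by nlinarith [Nat.sqrt_le_self W]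
    exact_mod_cast h2
  have b9 : ((AF α (Nat.sqrt W + 1)).card : ℝ) * ((Nat.log 2 W : ℝ) + 1) ≤ 8 * (L + C2) * (W * Real.sqrt W) := by
    calc ((AF α (Nat.sqrt W + 1)).card : ℝ) * ((Nat.log 2 W : ℝ) + 1) ≤ ((L + C2) * (4 * W)) * (2 * Real.sqrt W) := by
          have : ((AF α (Nat.sqrt W + 1)).card : ℝ) ≤ (L + C2) * (4 * W) := by
            calc ((AF α (Nat.sqrt W + 1)).card : ℝ) ≤ ((PP α (Nat.sqrt W + 1)).card : ℝ) := by exact_mod_cast b6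
              _ ≤ _ := b7
              _ ≤ _ := by gcongr
          gcongr
      _ = _ := by ring
  have b9' : 8 * (L + C2) * (W * Real.sqrt W) ≤ 8 * (L + C2) * X ^ e := by gcongr
  have bQ : (⌊(W:ℝ) / (α - 1)⌋₊ : ℝ) ≤ X ^ e / (α - 1) := by
    calc (⌊(W:ℝ) / (α - 1)⌋₊ : ℝ) ≤ (W:ℝ) / (α - 1) := Nat.floor_le (by positivity)
      _ ≤ _ := by gcongr; linarith
  have b2r : ((SS α R).ncard : ℝ) ≤ (AF α W).card := by exact_mod_cast b2
  have b3r : ((AF α W).card : ℝ) ≤ (SS α R).ncard + (AF α (Nat.sqrt W + 1)).card * ((Nat.log 2 W : ℝ) + 1) := by exact_mod_cast b3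
  have b4r : ((AF α W).card : ℝ) ≤ (PP α W).card := by exact_mod_cast b4
  have b5r : ((PP α W).card : ℝ) ≤ (AF α W).card + 2 * ⌊(W:ℝ) / (α - 1)⌋₊ := by exact_mod_cast b5
  have c1 : C1 * (W:ℝ) ^ e ≤ C1 * X ^ e := by gcongr
  have c2 : |(W:ℝ) ^ 2 * L - N ^ 2 * L| ≤ 2 * L * X ^ e := by
    have : (W:ℝ) ^ 2 * L - N ^ 2 * L = L * ((W - N) * (W + N)) := by ring
    rw [this, abs_mul, abs_of_pos hL0, abs_mul, abs_of_pos (by linarith : 0 < (W:ℝ) + N)]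
    have h1 : |(W:ℝ) - N| ≤ 1 := by rw [abs_le]; constructor <;> linarith
    have h2 : |(W:ℝ) - N| * (W + N) ≤ 1 * (2 * X ^ e) := by
      apply mul_le_mul h1 (by linarith) (by linarith) (by norm_num)
    calc L * (|(W:ℝ) - N| * (W + N)) ≤ L * (1 * (2 * X ^ e)) := by gcongr
      _ = _ := by ring
  have c2' := abs_le.mp c2
  have c3 : (C1 + 2 / (α - 1) + 8 * (L + C2) + 2 * L) * X ^ e = C1 * X ^ e + 2 * (X ^ e / (α - 1)) + 8 * (L + C2) * X ^ e + 2 * L * X ^ e := by ring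
  have c4 : 0 ≤ X ^ e / (α - 1) := by positivity
  have c5 : 0 ≤ 8 * (L + C2) * X ^ e := by positivity
  rw [c3, abs_le]
  constructor <;> linarith [b1'.1, b1'.2, c2'.1, c2'.2]

theorem stmt4 (α : ℝ) (hα : 1 < α) :
    ∀ ε > (0 : ℝ), ∃ K > (0 : ℝ), ∀ R > (0 : ℝ),
      |({ω : ℝ | 1 < ω ∧ α ≤ ω ∧ rhoB ω ≤ R ∧
          ∃ ω' : ℝ, IsConjPair ω ω' ∧ 0 < ω' ∧ ω' < 1}.ncard : ℝ) -
        Real.exp R / (2 * (Real.pi ^ 2 / 6)) * Real.log (α / (α - 1))|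
      ≤ K * Real.exp ((3 / 4 + ε) * R) := by
  intro ε hε
  exact main_bound α hα ε hε
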